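/- There exists β₀ > 0 such that for all β < β₀ the following holds. For all natural numbers n ≥ 1 and k₁,…,k_n ≥ 0 with k = k₁+⋯+k_n there is a constant K depending only on β₀, n, k (not on N) such that for every N ≥ 1, every h ≥ 0, and every (t₁,…,t_N) with t₁²+⋯+t_N² = 1, E[(⟨∏_{l=1}^n S_l^{k_l}⟩ − (∏_{l=1}^n a(k_l)) · ⟨S₁²⟩^{k/2})²] ≤ K · max_{i≤N}|t_i|. -/

import Mathlib

open MeasureTheory ProbabilityTheory Finset

noncomputable section

/-- A spin configuration on `N` sites. -/
abbrev Cfg (N : ℕ) := Fin N → Bool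

/-- The spin value `±1` of a Boolean. -/
def spin (b : Bool) : ℝ := if b then 1 else -1

/-- Minus the SK Hamiltonian. -/
def negH (N : ℕ) (β h : ℝ) (g : Fin N → Fin N → ℝ) (σ : Cfg N) : ℝ :=
  (β / Real.sqrt N) *
      ∑ i : Fin N, ∑ j : Fin N, (if i < j then g i j * spin (σ i) * spin (σ j) else 0) +
    h * ∑ i : Fin N, spin (σ i)

/-- Gibbs average `⟨f⟩` of a function of `ι`-indexed replicas. -/
def gibbs (N : ℕ) (β h : ℝ) (g : Fin N → Fin N → ℝ) {ι : Type} [DecidableEq ι] [Fintype ι]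
    (f : (ι → Cfg N) → ℝ) : ℝ :=
  (∑ σs : ι → Cfg N, f σs * ∏ l, Real.exp (negH N β h g (σs l))) /
    (∑ σ : Cfg N, Real.exp (negH N β h g σ)) ^ (Fintype.card ι)

/-- The law of the disorder: i.i.d. standard Gaussians. -/
def gaussN (N : ℕ) : Measure (Fin N → Fin N → ℝ) :=
  Measure.pi fun _ => Measure.pi fun _ => gaussianReal 0 1

/-- `ν(f) = E⟨f⟩`. -/
def nu (N : ℕ) (β h : ℝ) {ι : Type} [DecidableEq ι] [Fintype ι]
    (f : (ι → Cfg N) → ℝ) : ℝ :=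
  ∫ g, gibbs N β h g f ∂ gaussN N

/-- `S_l = Σ_i t_i (σ_i^{1(l)} - σ_i^{2(l)})`, replica pairs indexed by `Fin m × Fin 2`. -/
def Sbar (N m : ℕ) (t : Fin N → ℝ) (σs : Fin m × Fin 2 → Cfg N) (l : Fin m) : ℝ :=
  ∑ i, t i * (spin (σs (l, 0) i) - spin (σs (l, 1) i))

/-- `a(k)`: the `k`-th moment of a standard Gaussian. -/
def gaussMoment (k : ℕ) : ℝ := ∫ x, x ^ k ∂ (gaussianReal 0 1 : Measure ℝ)

/-- The overlap `R_{l,l'}` of two configurations. -/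
def overlap (N : ℕ) (σ τ : Cfg N) : ℝ := (∑ i, spin (σ i) * spin (τ i)) / N

/-- The Gibbs weight of the point `a` for the (negative) Hamiltonian `H`. -/
def gibbsWeight {A : Type} [Fintype A] (H : A → ℝ) (a : A) : ℝ :=
  Real.exp (H a) / ∑ b, Real.exp (H b)

/-- The average of a function of `ι`-indexed replicas under the Gibbs measure of `H`. -/
def gibbsAvg {A ι : Type} [Fintype A] [Fintype ι] [DecidableEq ι] (H : A → ℝ)
    (f : (ι → A) → ℝ) : ℝ :=
  ∑ σs, f σs * ∏ l, gibbsWeight H (σs l)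

theorem gibbs_eq_gibbsAvg (N : ℕ) (β h : ℝ) (g : Fin N → Fin N → ℝ) {ι : Type} [DecidableEq ι]
    [Fintype ι] (f : (ι → Cfg N) → ℝ) : gibbs N β h g f = gibbsAvg (negH N β h g) f := by
  unfold gibbs gibbsAvg gibbsWeight
  rw [Finset.sum_div]
  refine Finset.sum_congr rfl fun σs _ => ?_
  rw [Finset.prod_div_distrib, Finset.prod_const, Finset.card_univ, mul_div_assoc]

section GibbsAvg

variable {A ι κ : Type} [Fintype A] [Fintype ι] [DecidableEq ι] [Fintype κ] [DecidableEq κ]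

theorem gibbsWeight_nonneg (H : A → ℝ) (a : A) : 0 ≤ gibbsWeight H a := by
  unfold gibbsWeight; positivity

theorem sum_exp_pos [Nonempty A] (H : A → ℝ) : 0 < ∑ b, Real.exp (H b) :=
  Finset.sum_pos (fun _ _ => Real.exp_pos _) Finset.univ_nonempty

theorem sum_gibbsWeight [Nonempty A] (H : A → ℝ) : ∑ a, gibbsWeight H a = 1 := by
  unfold gibbsWeight
  rw [← Finset.sum_div, div_self (sum_exp_pos H).ne']

theorem prod_gibbsWeight_nonneg (H : A → ℝ) (σs : ι → A) : 0 ≤ ∏ l, gibbsWeight H (σs l) :=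
  Finset.prod_nonneg fun _ _ => gibbsWeight_nonneg H _

theorem sum_prod_gibbsWeight [Nonempty A] (H : A → ℝ) :
    ∑ σs : ι → A, ∏ l, gibbsWeight H (σs l) = 1 := by
  have := (Finset.prod_univ_sum (fun _ : ι => (Finset.univ : Finset A))
    (fun _ a => gibbsWeight H a)).symm
  rw [Fintype.piFinset_univ] at this
  rw [this]
  simp [sum_gibbsWeight]

theorem gibbsAvg_abs_le [Nonempty A] (H : A → ℝ) (f : (ι → A) → ℝ) {C : ℝ}
    (hf : ∀ σs, |f σs| ≤ C) : |gibbsAvg H f| ≤ C := by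
  unfold gibbsAvg
  refine (Finset.abs_sum_le_sum_abs _ _).trans ?_
  calc _ ≤ ∑ σs : ι → A, C * ∏ l, gibbsWeight H (σs l) := by
        refine Finset.sum_le_sum fun σs _ => ?_
        rw [abs_mul, abs_of_nonneg (prod_gibbsWeight_nonneg H σs)]
        exact mul_le_mul_of_nonneg_right (hf σs) (prod_gibbsWeight_nonneg H σs)
    _ = C := by rw [← Finset.mul_sum, sum_prod_gibbsWeight, mul_one]

theorem sum_comp_equiv_sum (w : A → ℝ) (hw : ∑ a, w a = 1) (e : ι → κ)
    (he : Function.Injective e) (f : (ι → A) → ℝ) :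
    ∑ τ : κ → A, f (fun l => τ (e l)) * ∏ l, w (τ l) = ∑ σ : ι → A, f σ * ∏ l, w (σ l) := by
  classical
  have key : ∀ τ : κ → A, f (fun l => τ (e l)) * ∏ l, w (τ l) =
      ∑ σ : ι → A, f σ * ∏ l : κ, (w (τ l) * ∏ i : ι, if e i = l then (if τ l = σ i then 1 else 0) else 1) := by
    intro τ
    rw [Finset.sum_eq_single (fun l => τ (e l))]
    · congr 1
      refine Finset.prod_congr rfl fun l _ => ?_
      rw [Finset.prod_eq_one, mul_one]
      intro i _
      split_ifs with h1 h2
      · rfl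
      · exact absurd (congrArg τ h1.symm) h2
      · rfl
    · intro σ _ hσ
      obtain ⟨i, hi⟩ := Function.ne_iff.mp hσ
      rw [Finset.prod_eq_zero (Finset.mem_univ (e i)), mul_zero]
      rw [Finset.prod_eq_zero (Finset.mem_univ i), mul_zero]
      simp only [if_true]
      exact if_neg (Ne.symm hi)
    · simp
  simp_rw [key]
  rw [Finset.sum_comm]
  refine Finset.sum_congr rfl fun σ _ => ?_
  rw [← Finset.mul_sum]
  congr 1
  have := (Finset.prod_univ_sum (fun _ : κ => (Finset.univ : Finset A))
    (fun l a => w a * ∏ i : ι, if e i = l then (if a = σ i then 1 else 0) else 1)).symm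
  rw [Fintype.piFinset_univ] at this
  rw [this]
  have h2 : ∀ l : κ, l ∉ Finset.univ.image e →
      ∑ a, w a * ∏ i : ι, (if e i = l then (if a = σ i then (1:ℝ) else 0) else 1) = 1 := by
    intro l hl
    refine Eq.trans (Finset.sum_congr rfl fun a _ => ?_) hw
    rw [Finset.prod_eq_one, mul_one]
    intro i _
    rw [if_neg]
    intro h
    exact hl (Finset.mem_image.mpr ⟨i, Finset.mem_univ _, h⟩)
  rw [← Finset.prod_subset (Finset.subset_univ (Finset.univ.image e)) (fun l _ hl => h2 l hl),
    Finset.prod_image (fun _ _ _ _ h => he h)]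
  refine Finset.prod_congr rfl fun i _ => ?_
  rw [Finset.sum_eq_single (σ i)]
  · rw [Finset.prod_eq_one, mul_one]
    intro j _
    split_ifs with h1 h2
    · rfl
    · exact absurd (by rw [he h1]) h2
    · rfl
  · intro a _ ha
    rw [Finset.prod_eq_zero (Finset.mem_univ i), mul_zero]
    simp [ha]
  · simp

theorem gibbsAvg_comp [Nonempty A] (H : A → ℝ) (e : ι → κ) (he : Function.Injective e)
    (f : (ι → A) → ℝ) : gibbsAvg H (fun τ : κ → A => f fun l => τ (e l)) = gibbsAvg H f :=
  sum_comp_equiv_sum _ (sum_gibbsWeight H) e he f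

theorem continuous_gibbsAvg [Nonempty A] {X : Type*} [TopologicalSpace X] {H : X → A → ℝ}
    (hH : ∀ a, Continuous fun x => H x a) (f : (ι → A) → ℝ) :
    Continuous fun x => gibbsAvg (H x) f := by
  unfold gibbsAvg gibbsWeight
  refine continuous_finsetSum _ fun σs _ => continuous_const.mul ?_
  refine continuous_finsetProd _ fun l _ => ?_
  refine Continuous.div ?_ ?_ fun x => (sum_exp_pos (H x)).ne'
  · exact Real.continuous_exp.comp (hH _)
  · exact continuous_finsetSum _ fun a _ => Real.continuous_exp.comp (hH _)

theorem hasDerivAt_gibbsWeight [Nonempty A] {H : ℝ → A → ℝ} {H' : A → ℝ} {x : ℝ}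
    (hH : ∀ a, HasDerivAt (fun y => H y a) (H' a) x) (a : A) :
    HasDerivAt (fun y => gibbsWeight (H y) a)
      (gibbsWeight (H x) a * (H' a - ∑ b, gibbsWeight (H x) b * H' b)) x := by
  have h1 : HasDerivAt (fun y => ∑ b, Real.exp (H y b)) (∑ b, Real.exp (H x b) * H' b) x :=
    HasDerivAt.fun_sum fun b _ => (hH b).exp
  have h2 := (hH a).exp.fun_div h1 (sum_exp_pos (H x)).ne'
  refine h2.congr_deriv ?_
  have hZ := (sum_exp_pos (H x)).ne'
  have h3 : ∑ b, gibbsWeight (H x) b * H' b =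
      (∑ b, Real.exp (H x b) * H' b) / ∑ b, Real.exp (H x b) := by
    rw [Finset.sum_div]
    exact Finset.sum_congr rfl fun b _ => by unfold gibbsWeight; ring
  rw [h3]
  unfold gibbsWeight
  field_simp

/-- The coefficients `1` on the replicas in use and `-n` on one extra replica. -/
def replicaCoeff (ι : Type) [Fintype ι] : Option ι → ℝ
  | some _ => 1
  | none => -(Fintype.card ι : ℝ)

theorem gibbsAvg_option (H : A → ℝ) (F : (ι → A) → A → ℝ) :
    gibbsAvg H (fun τ : Option ι → A => F (fun l => τ (some l)) (τ none)) =
      ∑ σs : ι → A, (∑ b, gibbsWeight H b * F σs b) * ∏ l, gibbsWeight H (σs l) := by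
  unfold gibbsAvg
  rw [← (Equiv.piOptionEquivProd (β := fun _ : Option ι => A)).symm.sum_comp,
    Fintype.sum_prod_type, Finset.sum_comm]
  refine Finset.sum_congr rfl fun σs _ => ?_
  rw [Finset.sum_mul]
  refine Finset.sum_congr rfl fun b _ => ?_
  rw [Fintype.prod_option]
  simp only [Equiv.piOptionEquivProd, Equiv.coe_fn_symm_mk]
  ring

theorem hasDerivAt_gibbsAvg [Nonempty A] {H : ℝ → A → ℝ} {H' : A → ℝ} {x : ℝ}
    (hH : ∀ a, HasDerivAt (fun y => H y a) (H' a) x) (f : (ι → A) → ℝ) :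
    HasDerivAt (fun y => gibbsAvg (H y) f)
      (gibbsAvg (H x) fun τ : Option ι → A =>
        f (fun l => τ (some l)) * ∑ k, replicaCoeff ι k * H' (τ k)) x := by
  have h1 : HasDerivAt (fun y => gibbsAvg (H y) f)
      (∑ σs : ι → A, f σs * ∑ l, (∏ j ∈ Finset.univ.erase l, gibbsWeight (H x) (σs j)) •
        (gibbsWeight (H x) (σs l) * (H' (σs l) - ∑ b, gibbsWeight (H x) b * H' b))) x := by
    unfold gibbsAvg
    refine HasDerivAt.fun_sum fun σs _ => HasDerivAt.const_mul _ ?_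
    exact HasDerivAt.fun_finsetProd fun l _ => hasDerivAt_gibbsWeight hH (σs l)
  refine h1.congr_deriv ?_
  have h2 : (fun τ : Option ι → A =>
        f (fun l => τ (some l)) * ∑ k, replicaCoeff ι k * H' (τ k)) =
      fun τ : Option ι → A => (fun (σs : ι → A) (b : A) => f σs * (∑ l, H' (σs l) -
        (Fintype.card ι : ℝ) * H' b)) (fun l => τ (some l)) (τ none) := by
    funext τ
    simp only [Fintype.sum_option, replicaCoeff, one_mul]
    ring
  rw [h2]
  refine Eq.trans ?_ (gibbsAvg_option (H x) fun (σs : ι → A) (b : A) =>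
    f σs * (∑ l, H' (σs l) - (Fintype.card ι : ℝ) * H' b)).symm
  refine Finset.sum_congr rfl fun σs _ => ?_
  set m := ∑ b, gibbsWeight (H x) b * H' b with hm
  have h3 : ∑ b, gibbsWeight (H x) b * (f σs * (∑ l, H' (σs l) - (Fintype.card ι : ℝ) * H' b)) =
      f σs * (∑ l, H' (σs l) - (Fintype.card ι : ℝ) * m) := by
    have : ∀ b, gibbsWeight (H x) b * (f σs * (∑ l, H' (σs l) - (Fintype.card ι : ℝ) * H' b)) =
      gibbsWeight (H x) b * (f σs * ∑ l, H' (σs l)) -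
        f σs * (Fintype.card ι : ℝ) * (gibbsWeight (H x) b * H' b) := fun b => by ring
    simp_rw [this]
    rw [Finset.sum_sub_distrib, ← Finset.sum_mul, sum_gibbsWeight, ← Finset.mul_sum]
    ring
  rw [h3, mul_assoc]
  congr 1
  have h4 : ∀ l ∈ (Finset.univ : Finset ι), (∏ j ∈ Finset.univ.erase l, gibbsWeight (H x) (σs j)) •
        (gibbsWeight (H x) (σs l) * (H' (σs l) - m)) =
      (∏ j, gibbsWeight (H x) (σs j)) * (H' (σs l) - m) := by
    intro l hl
    rw [← Finset.prod_erase_mul _ _ hl, smul_eq_mul]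
    ring
  rw [Finset.sum_congr rfl h4, ← Finset.mul_sum, Finset.sum_sub_distrib, Finset.sum_const,
    Finset.card_univ, nsmul_eq_mul, mul_comm]

end GibbsAvg

section GaussianIntegration

theorem integrable_gaussianReal_iff (f : ℝ → ℝ) :
    Integrable f (gaussianReal 0 1) ↔ Integrable (fun x => gaussianPDFReal 0 1 x * f x) := by
  rw [gaussianReal_of_var_ne_zero _ one_ne_zero,
    integrable_withDensity_iff_integrable_smul' (measurable_gaussianPDF 0 1)
      (Filter.Eventually.of_forall fun _ => gaussianPDF_lt_top)]
  simp only [toReal_gaussianPDF, smul_eq_mul]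

theorem hasDerivAt_gaussianPDFReal (x : ℝ) :
    HasDerivAt (gaussianPDFReal 0 1) (-(x * gaussianPDFReal 0 1 x)) x := by
  have h : HasDerivAt (fun x : ℝ => -(x - 0) ^ 2 / (2 * ((1 : NNReal) : ℝ))) (-x) x := by
    refine ((((hasDerivAt_id x).sub_const 0).fun_pow 2).fun_neg.div_const
      (2 * ((1 : NNReal) : ℝ))).congr_deriv ?_
    simp
    ring
  rw [gaussianPDFReal_def]
  refine (h.exp.const_mul _).congr_deriv ?_
  ring

theorem integral_mul_gaussianReal {f f' : ℝ → ℝ} (hf : ∀ x, HasDerivAt f (f' x) x)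
    (h0 : Integrable f (gaussianReal 0 1)) (h1 : Integrable f' (gaussianReal 0 1))
    (h2 : Integrable (fun x => x * f x) (gaussianReal 0 1)) :
    ∫ x, x * f x ∂gaussianReal 0 1 = ∫ x, f' x ∂gaussianReal 0 1 := by
  rw [integrable_gaussianReal_iff] at h0 h1 h2
  rw [integral_gaussianReal_eq_integral_smul one_ne_zero,
    integral_gaussianReal_eq_integral_smul one_ne_zero]
  simp only [smul_eq_mul]
  have := integral_mul_deriv_eq_deriv_mul_of_integrable (u := f) (u' := f')
    (v := gaussianPDFReal 0 1) (v' := fun x => -(x * gaussianPDFReal 0 1 x))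
    (fun x _ => hf x) (fun x _ => hasDerivAt_gaussianPDFReal x)
    (by refine h2.neg.congr (Filter.Eventually.of_forall fun x => ?_)
        simp only [Pi.neg_apply, Pi.mul_apply]; ring)
    (by refine h1.congr (Filter.Eventually.of_forall fun x => ?_)
        simp only [Pi.mul_apply]; ring)
    (by refine h0.congr (Filter.Eventually.of_forall fun x => ?_)
        simp only [Pi.mul_apply]; ring)
  calc ∫ x, gaussianPDFReal 0 1 x * (x * f x)
      = -∫ x, f x * -(x * gaussianPDFReal 0 1 x) := by
        rw [← integral_neg]; congr 1; funext x; ring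
    _ = ∫ x, gaussianPDFReal 0 1 x * f' x := by
        rw [this, neg_neg]; congr 1; funext x; ring

theorem integrable_pow_gaussianReal (k : ℕ) :
    Integrable (fun x : ℝ => x ^ k) (gaussianReal 0 1) := by
  have h := (memLp_id_gaussianReal' (μ := 0) (v := 1) (k : ENNReal) (by simp))
  rcases Nat.eq_zero_or_pos k with rfl | hk
  · simp
  · have := h.integrable_norm_pow hk.ne'
    refine this.mono' (by fun_prop) (Filter.Eventually.of_forall fun x => ?_)
    simp

theorem gaussMoment_add_two (k : ℕ) : gaussMoment (k + 2) = (k + 1) * gaussMoment k := by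
  unfold gaussMoment
  have h := integral_mul_gaussianReal (f := fun x : ℝ => x ^ (k + 1))
    (f' := fun x => ((k + 1 : ℕ) : ℝ) * x ^ k)
    (fun x => by simpa using hasDerivAt_pow (k + 1) x)
    (integrable_pow_gaussianReal _) ((integrable_pow_gaussianReal _).const_mul _)
    ((integrable_pow_gaussianReal (k + 2)).congr (Filter.Eventually.of_forall fun x => by
      simp only []; ring))
  rw [integral_const_mul] at h
  rw [← Nat.cast_succ, ← h]
  congr 1; funext x; ring

theorem gaussMoment_zero : gaussMoment 0 = 1 := by simp [gaussMoment]

theorem gaussMoment_one : gaussMoment 1 = 0 := by simp [gaussMoment]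

theorem gaussMoment_two : gaussMoment 2 = 1 := by
  simpa [gaussMoment_zero] using gaussMoment_add_two 0

theorem gaussMoment_odd (k : ℕ) : gaussMoment (2 * k + 1) = 0 := by
  induction k with
  | zero => simpa using gaussMoment_one
  | succ k ih =>
    have := gaussMoment_add_two (2 * k + 1)
    rw [ih, mul_zero] at this
    exact this

theorem measurePreserving_update_pi {ι : Type*} [Fintype ι] [DecidableEq ι] {α : ι → Type*}
    [∀ i, MeasurableSpace (α i)] (μ : ∀ i, Measure (α i)) [∀ i, IsProbabilityMeasure (μ i)]
    {Y : Type*} [MeasurableSpace Y] (ν : Measure Y) [IsProbabilityMeasure ν] (i : ι)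
    (T : α i × Y → α i) (hT : MeasurePreserving T ((μ i).prod ν) (μ i)) :
    MeasurePreserving (fun p : (∀ i, α i) × Y => Function.update p.1 i (T (p.1 i, p.2)))
      ((Measure.pi μ).prod ν) (Measure.pi μ) := by
  have hmeas : Measurable (fun p : (∀ i, α i) × Y => Function.update p.1 i (T (p.1 i, p.2))) := by
    rw [measurable_pi_iff]
    intro k
    by_cases hk : k = i
    · subst hk
      simp only [Function.update_self]
      exact hT.measurable.comp (((measurable_pi_apply k).comp measurable_fst).prodMk measurable_snd)
    · simp only [Function.update_of_ne hk]
      exact (measurable_pi_apply k).comp measurable_fst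
  refine ⟨hmeas, (Measure.pi_eq fun s hs => ?_).symm⟩
  rw [Measure.map_apply hmeas (MeasurableSet.univ_pi hs),
    Measure.prod_apply_symm (hmeas (MeasurableSet.univ_pi hs))]
  have h1 : ∀ y : Y, (fun x => (x, y)) ⁻¹' ((fun p : (∀ i, α i) × Y =>
      Function.update p.1 i (T (p.1 i, p.2))) ⁻¹' (Set.univ.pi s)) =
      Set.univ.pi (Function.update s i ((fun x => (x, y)) ⁻¹' (T ⁻¹' s i))) := by
    intro y
    ext x
    simp only [Set.mem_preimage, Set.mem_pi, Set.mem_univ, true_imp_iff]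
    refine forall_congr' fun k => ?_
    by_cases hk : k = i
    · subst hk; simp
    · simp [Function.update_of_ne hk]
  simp_rw [h1, Measure.pi_pi]
  have h2 : ∀ y : Y, ∏ k, μ k (Function.update s i ((fun x => (x, y)) ⁻¹' (T ⁻¹' s i)) k) =
      μ i ((fun x => (x, y)) ⁻¹' (T ⁻¹' s i)) * ∏ k ∈ Finset.univ.erase i, μ k (s k) := by
    intro y
    rw [← Finset.mul_prod_erase _ _ (Finset.mem_univ i), Function.update_self]
    congr 1
    refine Finset.prod_congr rfl fun k hk => ?_
    rw [Function.update_of_ne (Finset.ne_of_mem_erase hk)]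
  simp_rw [h2]
  have hm : Measurable fun y => μ i ((fun x => (x, y)) ⁻¹' (T ⁻¹' s i)) :=
    measurable_measure_prodMk_right (hT.measurable (hs i))
  rw [lintegral_mul_const _ hm,
    ← Measure.prod_apply_symm (hT.measurable (hs i)), hT.measure_preimage (hs i).nullMeasurableSet,
    Finset.mul_prod_erase _ (fun k => μ k (s k)) (Finset.mem_univ i)]

instance instIsProbabilityMeasureGaussN (N : ℕ) : IsProbabilityMeasure (gaussN N) := by
  unfold gaussN; infer_instance

/-- Replace one entry of the disorder. -/
def setEntry {N : ℕ} (g : Fin N → Fin N → ℝ) (i j : Fin N) (y : ℝ) : Fin N → Fin N → ℝ :=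
  Function.update g i (Function.update (g i) j y)

theorem setEntry_apply {N : ℕ} (g : Fin N → Fin N → ℝ) (i j a b : Fin N) (y : ℝ) :
    setEntry g i j y a b = if a = i ∧ b = j then y else g a b := by
  unfold setEntry
  by_cases ha : a = i
  · subst ha
    by_cases hb : b = j
    · subst hb; simp
    · simp [hb]
  · simp [ha]

theorem measurePreserving_setEntry {N : ℕ} (i j : Fin N) :
    MeasurePreserving (fun p : (Fin N → Fin N → ℝ) × ℝ => setEntry p.1 i j p.2)
      ((gaussN N).prod (gaussianReal 0 1)) (gaussN N) := by
  unfold setEntry gaussN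
  have h0 : MeasurePreserving (fun p : ℝ × ℝ => p.2)
      ((gaussianReal 0 1).prod (gaussianReal 0 1)) (gaussianReal 0 1) := measurePreserving_snd
  have h1 := measurePreserving_update_pi (fun _ : Fin N => gaussianReal 0 1)
    (gaussianReal 0 1) j (fun p : ℝ × ℝ => p.2) h0
  exact measurePreserving_update_pi (fun _ : Fin N => Measure.pi fun _ : Fin N => gaussianReal 0 1)
    (gaussianReal 0 1) i _ h1

theorem integral_setEntry {N : ℕ} (i j : Fin N) {G : (Fin N → Fin N → ℝ) → ℝ}
    (hG : Integrable G (gaussN N)) :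
    ∫ g, G g ∂gaussN N = ∫ g, ∫ y, G (setEntry g i j y) ∂gaussianReal 0 1 ∂gaussN N := by
  have hmp := measurePreserving_setEntry i j
  rw [← integral_prod (fun p : (Fin N → Fin N → ℝ) × ℝ => G (setEntry p.1 i j p.2))
    (hmp.integrable_comp_of_integrable hG)]
  conv_lhs => rw [← hmp.map_eq]
  rw [integral_map hmp.measurable.aemeasurable]
  rw [hmp.map_eq]
  exact hG.aestronglyMeasurable

theorem integrable_entry {N : ℕ} (i j : Fin N) : Integrable (fun g => g i j) (gaussN N) := by
  have h1 : MeasurePreserving (fun g : Fin N → Fin N → ℝ => g i) (gaussN N)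
      (Measure.pi fun _ : Fin N => gaussianReal 0 1) := measurePreserving_eval _ i
  have h2 : MeasurePreserving (fun v : Fin N → ℝ => v j)
      (Measure.pi fun _ : Fin N => gaussianReal 0 1) (gaussianReal 0 1) := measurePreserving_eval _ j
  have h3 : Integrable (fun x : ℝ => x) (gaussianReal 0 1) := by
    simpa using integrable_pow_gaussianReal 1
  exact (h2.comp h1).integrable_comp_of_integrable h3

theorem integrable_of_continuous_of_bounded {X : Type*} [TopologicalSpace X] [MeasurableSpace X]
    [OpensMeasurableSpace X] {μ : Measure X} [IsFiniteMeasure μ] {F : X → ℝ} (hc : Continuous F)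
    {C : ℝ} (hb : ∀ x, |F x| ≤ C) : Integrable F μ :=
  Integrable.of_bound hc.measurable.aestronglyMeasurable C
    (Filter.Eventually.of_forall fun x => by simpa using hb x)

theorem continuous_setEntry {N : ℕ} (g : Fin N → Fin N → ℝ) (i j : Fin N) :
    Continuous fun y => setEntry g i j y := by
  unfold setEntry
  exact continuous_const.update i (continuous_const.update j continuous_id)

theorem integral_entry_mul {N : ℕ} (i j : Fin N) {G G' : (Fin N → Fin N → ℝ) → ℝ}
    (hG : Continuous G) (hG' : Continuous G') {C C' : ℝ} (hC : ∀ g, |G g| ≤ C)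
    (hC' : ∀ g, |G' g| ≤ C')
    (hd : ∀ g y, HasDerivAt (fun y => G (setEntry g i j y)) (G' (setEntry g i j y)) y) :
    ∫ g, g i j * G g ∂gaussN N = ∫ g, G' g ∂gaussN N := by
  have hInt : Integrable (fun g => g i j * G g) (gaussN N) :=
    (integrable_entry i j).mul_bdd (c := C) hG.measurable.aestronglyMeasurable
      (Filter.Eventually.of_forall fun g => by simpa using hC g)
  rw [integral_setEntry i j hInt,
    integral_setEntry i j (integrable_of_continuous_of_bounded hG' hC')]
  congr 1
  funext g
  have hx : Integrable (fun x : ℝ => x) (gaussianReal 0 1) := by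
    simpa using integrable_pow_gaussianReal 1
  have hGc : Continuous fun y => G (setEntry g i j y) := hG.comp (continuous_setEntry g i j)
  have hGc' : Continuous fun y => G' (setEntry g i j y) := hG'.comp (continuous_setEntry g i j)
  have := integral_mul_gaussianReal (hd g)
    (integrable_of_continuous_of_bounded hGc fun y => hC _)
    (integrable_of_continuous_of_bounded hGc' fun y => hC' _)
    (hx.mul_bdd (c := C) hGc.measurable.aestronglyMeasurable
      (Filter.Eventually.of_forall fun y => by simpa using hC _))
  rw [← this]
  congr 1
  funext y
  rw [setEntry_apply]
  simp

end GaussianIntegration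

section LinearHamiltonian

variable {A ι : Type} [Fintype A] [Nonempty A] [Fintype ι] [DecidableEq ι] {N : ℕ}

/-- A random Hamiltonian which is linear in the disorder. -/
def linHam (w : Fin N → Fin N → ℝ) (φ : Fin N → Fin N → A → ℝ) (base : A → ℝ)
    (g : Fin N → Fin N → ℝ) (a : A) : ℝ :=
  ∑ i, ∑ j, w i j * g i j * φ i j a + base a

theorem continuous_linHam (w : Fin N → Fin N → ℝ) (φ : Fin N → Fin N → A → ℝ) (base : A → ℝ)
    (a : A) : Continuous fun g => linHam w φ base g a := by
  unfold linHam
  fun_prop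

theorem exists_abs_le (f : (ι → A) → ℝ) : ∃ C, 0 ≤ C ∧ ∀ σs, |f σs| ≤ C :=
  ⟨∑ σs, |f σs|, Finset.sum_nonneg fun _ _ => abs_nonneg _, fun σs =>
    Finset.single_le_sum (f := fun σs => |f σs|) (fun _ _ => abs_nonneg _) (Finset.mem_univ σs)⟩

theorem integrable_gibbsAvg_linHam (w : Fin N → Fin N → ℝ) (φ : Fin N → Fin N → A → ℝ)
    (base : A → ℝ) (f : (ι → A) → ℝ) :
    Integrable (fun g => gibbsAvg (linHam w φ base g) f) (gaussN N) := by
  obtain ⟨C, -, hC⟩ := exists_abs_le f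
  exact integrable_of_continuous_of_bounded
    (continuous_gibbsAvg (continuous_linHam w φ base) f) fun g => gibbsAvg_abs_le _ f hC

theorem integral_entry_mul_gibbsAvg (w : Fin N → Fin N → ℝ) (φ : Fin N → Fin N → A → ℝ)
    (base : A → ℝ) (i j : Fin N) (f : (ι → A) → ℝ) :
    ∫ g, g i j * gibbsAvg (linHam w φ base g) f ∂gaussN N =
      w i j * ∫ g, gibbsAvg (linHam w φ base g) (fun τ : Option ι → A =>
        f (fun l => τ (some l)) * ∑ k, replicaCoeff ι k * φ i j (τ k)) ∂gaussN N := by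
  set f' : (Option ι → A) → ℝ := fun τ =>
        f (fun l => τ (some l)) * ∑ k, replicaCoeff ι k * φ i j (τ k) with hf'
  obtain ⟨C, -, hC⟩ := exists_abs_le f
  obtain ⟨C', -, hC'⟩ := exists_abs_le f'
  rw [← integral_const_mul]
  refine integral_entry_mul i j (C := C) (C' := |w i j| * C')
    (continuous_gibbsAvg (continuous_linHam w φ base) f)
    (continuous_const.mul (continuous_gibbsAvg (continuous_linHam w φ base) f'))
    (fun g => gibbsAvg_abs_le _ f hC) (fun g => ?_) (fun g y => ?_)
  · rw [abs_mul]
    exact mul_le_mul_of_nonneg_left (gibbsAvg_abs_le _ f' hC') (abs_nonneg _)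
  · have hd : ∀ a, HasDerivAt (fun y => linHam w φ base (setEntry g i j y) a) (w i j * φ i j a) y := by
      intro a
      unfold linHam
      refine HasDerivAt.add_const _ ?_
      have h1 : ∀ k l, HasDerivAt (fun y => w k l * setEntry g i j y k l * φ k l a)
          (if k = i ∧ l = j then w i j * φ i j a else 0) y := by
        intro k l
        by_cases h : k = i ∧ l = j
        · obtain ⟨rfl, rfl⟩ := h
          simp only [setEntry_apply, and_self, if_true]
          simpa using ((hasDerivAt_id y).const_mul (w k l)).mul_const (φ k l a)
        · simp only [setEntry_apply, if_neg h]
          exact hasDerivAt_const _ _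
      refine (HasDerivAt.fun_sum fun k _ => HasDerivAt.fun_sum fun l _ => h1 k l).congr_deriv ?_
      simp [ite_and]
    refine (hasDerivAt_gibbsAvg hd f).congr_deriv ?_
    rw [hf']
    unfold gibbsAvg
    rw [Finset.mul_sum]
    refine Finset.sum_congr rfl fun τ _ => ?_
    beta_reduce
    have : ∑ k, replicaCoeff ι k * (w i j * φ i j (τ k)) =
        w i j * ∑ k, replicaCoeff ι k * φ i j (τ k) := by
      rw [Finset.mul_sum]
      exact Finset.sum_congr rfl fun k _ => by ring
    rw [this]
    ring

theorem gibbsAvg_sum {T : Type*} (s : Finset T) (H : A → ℝ) (F : T → (ι → A) → ℝ) :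
    gibbsAvg H (fun σs => ∑ k ∈ s, F k σs) = ∑ k ∈ s, gibbsAvg H (F k) := by
  unfold gibbsAvg
  simp_rw [Finset.sum_mul]
  exact Finset.sum_comm

theorem gibbsAvg_const_mul (H : A → ℝ) (c : ℝ) (f : (ι → A) → ℝ) :
    gibbsAvg H (fun σs => c * f σs) = c * gibbsAvg H f := by
  unfold gibbsAvg
  rw [Finset.mul_sum]
  exact Finset.sum_congr rfl fun _ _ => by ring

theorem hasDerivAt_integral_gibbsAvg {w w' : ℝ → Fin N → Fin N → ℝ}
    (hw : ∀ θ i j, HasDerivAt (fun θ => w θ i j) (w' θ i j) θ) {Cw : ℝ}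
    (hw' : ∀ θ i j, |w' θ i j| ≤ Cw) (φ : Fin N → Fin N → A → ℝ) (base : A → ℝ)
    (f : (ι → A) → ℝ) (θ : ℝ) :
    HasDerivAt (fun θ => ∫ g, gibbsAvg (linHam (w θ) φ base g) f ∂gaussN N)
      (∑ i, ∑ j, w' θ i j * w θ i j * ∫ g, gibbsAvg (linHam (w θ) φ base g)
        (fun τ : Option (Option ι) → A => (f (fun l => τ (some (some l))) *
          ∑ k, replicaCoeff ι k * φ i j (τ (some k))) *
            ∑ k, replicaCoeff (Option ι) k * φ i j (τ k)) ∂gaussN N) θ := by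
  let F' : Fin N → Fin N → (Option ι → A) → ℝ := fun i j τ =>
        f (fun l => τ (some l)) * ∑ k, replicaCoeff ι k * φ i j (τ k)
  have hF'C : ∀ i j, ∃ C, 0 ≤ C ∧ ∀ τ, |F' i j τ| ≤ C := fun i j => exists_abs_le _
  choose C hC0 hC using hF'C
  have hder : ∀ g θ, HasDerivAt (fun θ => gibbsAvg (linHam (w θ) φ base g) f)
      (∑ i, ∑ j, w' θ i j * (g i j * gibbsAvg (linHam (w θ) φ base g) (F' i j))) θ := by
    intro g θ
    have hd : ∀ a, HasDerivAt (fun θ => linHam (w θ) φ base g a)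
        (∑ i, ∑ j, w' θ i j * g i j * φ i j a) θ := by
      intro a
      unfold linHam
      exact HasDerivAt.add_const _ (HasDerivAt.fun_sum fun k _ => HasDerivAt.fun_sum fun l _ =>
        ((hw θ k l).mul_const _).mul_const _)
    refine (hasDerivAt_gibbsAvg hd f).congr_deriv ?_
    have : (fun τ : Option ι → A => f (fun l => τ (some l)) *
        ∑ k, replicaCoeff ι k * ∑ i, ∑ j, w' θ i j * g i j * φ i j (τ k)) =
        fun τ => ∑ i, ∑ j, (w' θ i j * g i j) * F' i j τ := by
      funext τ
      simp only [F', Finset.mul_sum]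
      rw [Finset.sum_comm]
      refine Finset.sum_congr rfl fun i _ => ?_
      rw [Finset.sum_comm]
      refine Finset.sum_congr rfl fun j _ => Finset.sum_congr rfl fun k _ => ?_
      ring
    rw [this, gibbsAvg_sum]
    refine Finset.sum_congr rfl fun i _ => ?_
    rw [gibbsAvg_sum]
    refine Finset.sum_congr rfl fun j _ => ?_
    rw [gibbsAvg_const_mul, mul_assoc]
  have hInt : ∀ θ i j, Integrable (fun g : Fin N → Fin N → ℝ => w' θ i j * (g i j *
      gibbsAvg (linHam (w θ) φ base g) (F' i j))) (gaussN N) := by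
    intro θ i j
    refine Integrable.const_mul ((integrable_entry i j).mul_bdd (c := C i j)
      (continuous_gibbsAvg (continuous_linHam _ φ base) _).measurable.aestronglyMeasurable
      (Filter.Eventually.of_forall fun g => ?_)) _
    simpa using gibbsAvg_abs_le _ _ (hC i j)
  have main := (hasDerivAt_integral_of_dominated_loc_of_deriv_le (μ := gaussN N) (s := Set.univ)
    (x₀ := θ) (F := fun θ g => gibbsAvg (linHam (w θ) φ base g) f)
    (F' := fun θ g => ∑ i, ∑ j, w' θ i j * (g i j * gibbsAvg (linHam (w θ) φ base g) (F' i j)))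
    (bound := fun g => ∑ i, ∑ j, Cw * (|g i j| * C i j)) Filter.univ_mem
    (Filter.Eventually.of_forall fun θ =>
      (integrable_gibbsAvg_linHam (w θ) φ base f).aestronglyMeasurable)
    (integrable_gibbsAvg_linHam (w θ) φ base f)
    (integrable_finsetSum _ fun i _ => integrable_finsetSum _ fun j _ =>
      hInt θ i j).aestronglyMeasurable
    (Filter.Eventually.of_forall fun g θ _ => by
      rw [Real.norm_eq_abs]
      refine (Finset.abs_sum_le_sum_abs _ _).trans (Finset.sum_le_sum fun i _ => ?_)
      refine (Finset.abs_sum_le_sum_abs _ _).trans (Finset.sum_le_sum fun j _ => ?_)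
      rw [abs_mul, abs_mul]
      have := hw' θ i j
      have h2 := gibbsAvg_abs_le (linHam (w θ) φ base g) _ (hC i j)
      have h3 := hC0 i j
      have : 0 ≤ Cw := (abs_nonneg _).trans this
      gcongr)
    (integrable_finsetSum _ fun i _ => integrable_finsetSum _ fun j _ =>
      ((integrable_entry i j).abs.mul_const _).const_mul _)
    (Filter.Eventually.of_forall fun g θ _ => hder g θ)).2
  refine main.congr_deriv ?_
  rw [integral_finsetSum _ fun i _ => integrable_finsetSum _ fun j _ => hInt θ i j]
  refine Finset.sum_congr rfl fun i _ => ?_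
  rw [integral_finsetSum _ fun j _ => hInt θ i j]
  refine Finset.sum_congr rfl fun j _ => ?_
  rw [integral_const_mul, integral_entry_mul_gibbsAvg, mul_assoc]

end LinearHamiltonian

section DisorderAvg

variable {A ι κ : Type} [Fintype A] [Fintype ι] [DecidableEq ι] [Fintype κ] [DecidableEq κ] {N : ℕ}

/-- A disordered system whose Hamiltonian is linear in the Gaussian disorder. -/
structure LinModel (A : Type) (N : ℕ) where
  /-- The strength with which each disorder variable enters. -/
  coupling : Fin N → Fin N → ℝ
  /-- The function multiplying each disorder variable. -/
  inter : Fin N → Fin N → A → ℝ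
  /-- The deterministic part of the Hamiltonian. -/
  base : A → ℝ

/-- The (negative) Hamiltonian of the model. -/
def LinModel.ham (m : LinModel A N) (g : Fin N → Fin N → ℝ) : A → ℝ :=
  linHam m.coupling m.inter m.base g

/-- The average over the disorder of the Gibbs average. -/
def LinModel.avg (m : LinModel A N) (f : (ι → A) → ℝ) : ℝ :=
  ∫ g, gibbsAvg (m.ham g) f ∂gaussN N

namespace LinModel

variable [Nonempty A] (m : LinModel A N)

theorem avg_sum {T : Type*} (s : Finset T) (F : T → (ι → A) → ℝ) :
    m.avg (fun σs => ∑ k ∈ s, F k σs) = ∑ k ∈ s, m.avg (F k) := by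
  unfold avg
  simp_rw [gibbsAvg_sum]
  exact integral_finsetSum _ fun k _ => integrable_gibbsAvg_linHam _ _ _ (F k)

theorem avg_const_mul (c : ℝ) (f : (ι → A) → ℝ) :
    m.avg (fun σs => c * f σs) = c * m.avg f := by
  unfold avg
  simp_rw [gibbsAvg_const_mul]
  exact integral_const_mul _ _

theorem avg_add (f f' : (ι → A) → ℝ) :
    m.avg (fun σs => f σs + f' σs) =
      m.avg f + m.avg f' := by
  have := avg_sum m Finset.univ (fun b : Bool => if b then f else f')
  simpa using this

theorem avg_sub (f f' : (ι → A) → ℝ) :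
    m.avg (fun σs => f σs - f' σs) =
      m.avg f - m.avg f' := by
  have := avg_add m (fun σs => f σs - f' σs) f'
  simp only [sub_add_cancel] at this
  exact eq_sub_of_add_eq this.symm

theorem avg_neg (f : (ι → A) → ℝ) :
    m.avg (fun σs => -f σs) = -m.avg f := by
  simpa using avg_const_mul m (-1) f

theorem avg_nonneg {f : (ι → A) → ℝ} (hf : ∀ σs, 0 ≤ f σs) :
    0 ≤ m.avg f := by
  unfold avg gibbsAvg
  exact integral_nonneg fun g => Finset.sum_nonneg fun σs _ =>
    mul_nonneg (hf σs) (prod_gibbsWeight_nonneg _ σs)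

theorem avg_mono {f f' : (ι → A) → ℝ} (hf : ∀ σs, f σs ≤ f' σs) :
    m.avg f ≤ m.avg f' := by
  have := avg_nonneg m (fun σs => sub_nonneg.2 (hf σs))
  rw [avg_sub] at this
  linarith

theorem abs_avg_le {f f' : (ι → A) → ℝ} (hf : ∀ σs, |f σs| ≤ f' σs) :
    |m.avg f| ≤ m.avg f' := by
  rw [abs_le]
  constructor
  · rw [neg_le, ← avg_neg]
    exact avg_mono m fun σs => (neg_le_abs _).trans (hf σs)
  · exact avg_mono m fun σs => (le_abs_self _).trans (hf σs)

theorem avg_const (c : ℝ) : m.avg (fun _ : ι → A => c) = c := by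
  have : ∀ g, gibbsAvg (m.ham g) (fun _ : ι → A => c) = c := by
    intro g
    unfold gibbsAvg
    rw [← Finset.mul_sum, sum_prod_gibbsWeight, mul_one]
  unfold avg
  simp [this]

theorem abs_avg_le_const {f : (ι → A) → ℝ} {C : ℝ} (hf : ∀ σs, |f σs| ≤ C) :
    |m.avg f| ≤ C :=
  (abs_avg_le m hf).trans_eq (avg_const m C)

theorem avg_comp (e : ι → κ) (he : Function.Injective e) (f : (ι → A) → ℝ) :
    m.avg (fun τ : κ → A => f fun l => τ (e l)) = m.avg f := by
  unfold avg
  simp_rw [gibbsAvg_comp _ e he f]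

end LinModel

end DisorderAvg

section Cavity

variable {N : ℕ}

/-- The interaction functions: products of two spins, and single spins on the diagonal. -/
def pairSpin (a b : Fin N) (σ : Cfg N) : ℝ :=
  if a = b then spin (σ a) else spin (σ a) * spin (σ b)

/-- The coupling strengths along the cavity path at site `i`, with the diagonal entry of the
disorder at `i` as cavity field. -/
def cavCoupling (β q : ℝ) (i : Fin N) (θ : ℝ) (a b : Fin N) : ℝ :=
  if a = b then (if a = i then β * Real.sqrt q * Real.sin θ else 0)
  else if a < b then β / Real.sqrt N * (if a = i ∨ b = i then Real.cos θ else 1) else 0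

/-- The Sherrington-Kirkpatrick model. -/
def skModel (N : ℕ) (β h : ℝ) : LinModel (Cfg N) N where
  coupling a b := if a < b then β / Real.sqrt N else 0
  inter := pairSpin
  base σ := h * ∑ j, spin (σ j)

/-- The cavity interpolation: `θ = 0` is the SK model and `θ = π / 2` decouples the site `i`. -/
def cavModel (β h q : ℝ) (i : Fin N) (θ : ℝ) : LinModel (Cfg N) N where
  coupling := cavCoupling β q i θ
  inter := pairSpin
  base σ := h * ∑ j, spin (σ j)

theorem spin_mul_self (b : Bool) : spin b * spin b = 1 := by cases b <;> simp [spin]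

theorem abs_spin (b : Bool) : |spin b| = 1 := by cases b <;> simp [spin]

variable {ι κ : Type} [Fintype ι] [DecidableEq ι] [Fintype κ] [DecidableEq κ]

theorem negH_eq_skModel (β h : ℝ) (g : Fin N → Fin N → ℝ) :
    negH N β h g = (skModel N β h).ham g := by
  funext σ
  unfold LinModel.ham linHam negH skModel
  simp only
  congr 1
  rw [Finset.mul_sum]
  refine Finset.sum_congr rfl fun a _ => ?_
  rw [Finset.mul_sum]
  refine Finset.sum_congr rfl fun b _ => ?_
  unfold pairSpin
  by_cases hab : a < b
  · simp [hab, hab.ne]; ring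
  · simp [hab]

theorem cavModel_zero (β h q : ℝ) (i : Fin N) : cavModel β h q i 0 = skModel N β h := by
  unfold cavModel skModel
  congr 1
  funext a b
  unfold cavCoupling
  rcases lt_trichotomy a b with hab | hab | hab
  · simp [hab, hab.ne]
  · subst hab; simp
  · simp [hab.not_gt, hab.ne']

/-- The centred overlap of the replicas `x` and `y` without the site `i`, set to zero for `x = y`. -/
def cavOverlap (q : ℝ) (i : Fin N) (x y : κ) (τ : κ → Cfg N) : ℝ :=
  if x = y then 0 else (∑ j ∈ Finset.univ.erase i, spin (τ x j) * spin (τ y j)) / N - q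

theorem abs_cavOverlap_le {q : ℝ} (hq0 : 0 ≤ q) (hq1 : q ≤ 1) (i : Fin N) (x y : κ)
    (τ : κ → Cfg N) : |cavOverlap q i x y τ| ≤ 2 := by
  unfold cavOverlap
  have hN : (0 : ℝ) < N := by exact_mod_cast i.pos
  split_ifs
  · simp
  · have h1 : |∑ j ∈ Finset.univ.erase i, spin (τ x j) * spin (τ y j)| ≤ N := by
      refine (Finset.abs_sum_le_sum_abs _ _).trans ?_
      simp only [abs_mul, abs_spin, mul_one, Finset.sum_const, nsmul_eq_mul]
      exact_mod_cast (Finset.card_le_univ _).trans_eq (Fintype.card_fin N)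
    have h2 : |(∑ j ∈ Finset.univ.erase i, spin (τ x j) * spin (τ y j)) / N| ≤ 1 := by
      rw [abs_div, abs_of_pos hN, div_le_one hN]
      exact h1
    rw [abs_le] at h2 ⊢
    constructor <;> linarith

/-- The coefficients of `replicaCoeff`, extended by zero to one more replica. -/
def extCoeff (ι : Type) [Fintype ι] : Option (Option ι) → ℝ
  | some k => replicaCoeff ι k
  | none => 0

theorem sum_abs_replicaCoeff : ∑ k, |replicaCoeff ι k| = 2 * Fintype.card ι := by
  simp [Fintype.sum_option, replicaCoeff]; ring

theorem sum_abs_extCoeff : ∑ k, |extCoeff ι k| = 2 * Fintype.card ι := by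
  rw [Fintype.sum_option]
  simp only [extCoeff, abs_zero, zero_add]
  exact sum_abs_replicaCoeff

theorem sum_extCoeff_mul_replicaCoeff :
    ∑ k, extCoeff ι k * replicaCoeff (Option ι) k = 0 := by
  simp [Fintype.sum_option, extCoeff, replicaCoeff]

/-- The functional giving the derivative along the cavity path. -/
def cavDeriv (β h q : ℝ) (i : Fin N) (θ : ℝ) (f : (ι → Cfg N) → ℝ) : ℝ :=
  ∑ x, ∑ y, extCoeff ι x * replicaCoeff (Option ι) y *
    (cavModel β h q i θ).avg (fun τ : Option (Option ι) → Cfg N =>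
      f (fun l => τ (some (some l))) * (spin (τ x i) * spin (τ y i)) * cavOverlap q i x y τ)

/-- The derivative of `cavCoupling` in the angle. -/
def cavCouplingDeriv (β q : ℝ) (i : Fin N) (θ : ℝ) (a b : Fin N) : ℝ :=
  if a = b then (if a = i then β * Real.sqrt q * Real.cos θ else 0)
  else if a < b then β / Real.sqrt N * (if a = i ∨ b = i then -Real.sin θ else 0) else 0

theorem hasDerivAt_cavCoupling (β q : ℝ) (i : Fin N) (θ : ℝ) (a b : Fin N) :
    HasDerivAt (fun θ => cavCoupling β q i θ a b) (cavCouplingDeriv β q i θ a b) θ := by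
  unfold cavCoupling cavCouplingDeriv
  split_ifs
  · exact (Real.hasDerivAt_sin θ).const_mul _
  · exact hasDerivAt_const _ _
  · exact (Real.hasDerivAt_cos θ).const_mul _
  · simpa using hasDerivAt_const θ (β / Real.sqrt N * 1)
  · exact hasDerivAt_const _ _

theorem abs_cavCouplingDeriv_le (β q : ℝ) (i : Fin N) (θ : ℝ) (a b : Fin N) :
    |cavCouplingDeriv β q i θ a b| ≤ |β * Real.sqrt q| + |β / Real.sqrt N| := by
  have h1 := Real.abs_sin_le_one θ
  have h2 := Real.abs_cos_le_one θ
  have h3 := abs_nonneg (β * Real.sqrt q)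
  have h4 := abs_nonneg (β / Real.sqrt N)
  unfold cavCouplingDeriv
  split_ifs
  · rw [abs_mul]; nlinarith
  · simp only [abs_zero]; positivity
  · rw [abs_mul, abs_neg]; nlinarith
  · simp only [mul_zero, abs_zero]; positivity
  · simp only [abs_zero]; positivity

theorem sum_cavCoupling_mul_pairSpin (β : ℝ) {q : ℝ} (hq : 0 ≤ q) (i : Fin N) (θ : ℝ)
    (σ τ : Cfg N) :
    ∑ a, ∑ b, cavCouplingDeriv β q i θ a b * cavCoupling β q i θ a b *
        (pairSpin a b σ * pairSpin a b τ) =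
      -(Real.sin θ * Real.cos θ) * β ^ 2 * (spin (σ i) * spin (τ i) *
        ((∑ j ∈ Finset.univ.erase i, spin (σ j) * spin (τ j)) / N - q)) := by
  have hN : (0 : ℝ) < N := by exact_mod_cast i.pos
  set c : ℝ := Real.sin θ * Real.cos θ * β ^ 2 with hc
  set s : Fin N → ℝ := fun j => spin (σ j) * spin (τ j) with hs
  have h1 : ∀ a b, cavCouplingDeriv β q i θ a b * cavCoupling β q i θ a b *
        (pairSpin a b σ * pairSpin a b τ) =
      (if a = i then (if b = i then c * q * s i else if i < b then -c / N * (s i * s b) else 0)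
        else 0) + (if b = i then (if a < i then -c / N * (s i * s a) else 0) else 0) := by
    intro a b
    have e1 : (β * Real.sqrt q) * (β * Real.sqrt q) = β ^ 2 * q := by
      rw [mul_mul_mul_comm, Real.mul_self_sqrt hq]; ring
    have e2 : (β / Real.sqrt N) * (β / Real.sqrt N) = β ^ 2 / N := by
      rw [div_mul_div_comm, Real.mul_self_sqrt hN.le]; ring
    unfold cavCouplingDeriv cavCoupling pairSpin
    by_cases hab : a = b
    · subst hab
      by_cases ha : a = i
      · subst ha
        simp only [if_true, lt_irrefl, if_false, add_zero]
        calc _ = (β * Real.sqrt q) * (β * Real.sqrt q) * (Real.sin θ * Real.cos θ) *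
              (spin (σ a) * spin (τ a)) := by ring
          _ = _ := by rw [e1]; ring
      · simp [ha]
    · by_cases hlt : a < b
      · by_cases ha : a = i
        · subst ha
          have hb : b ≠ a := Ne.symm hab
          simp only [if_true, hab, if_false, hlt, hb, true_or, add_zero]
          calc _ = -((β / Real.sqrt N) * (β / Real.sqrt N)) * (Real.sin θ * Real.cos θ) *
              (s a * s b) := by ring
            _ = _ := by rw [e2]; ring
        · by_cases hb : b = i
          · subst hb
            simp only [if_true, hab, if_false, hlt, or_true, zero_add]
            calc _ = -((β / Real.sqrt N) * (β / Real.sqrt N)) * (Real.sin θ * Real.cos θ) *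
                (s b * s a) := by ring
              _ = _ := by rw [e2]; ring
          · simp [ha, hb, hab, hlt]
      · by_cases ha : a = i
        · subst ha
          have hb : b ≠ a := Ne.symm hab
          simp [hab, hlt, hb]
        · by_cases hb : b = i
          · subst hb
            simp [hab, hlt]
          · simp [ha, hb, hab, hlt]
  simp_rw [h1, Finset.sum_add_distrib, Finset.sum_ite_eq', Finset.mem_univ, if_true]
  rw [Finset.sum_comm (γ := Fin N)]
  simp_rw [Finset.sum_ite_eq', Finset.mem_univ, if_true]
  rw [← Finset.add_sum_erase _ _ (Finset.mem_univ i), if_pos rfl]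
  have h2 : ∑ a : Fin N, (if a < i then -c / N * (s i * s a) else 0) =
      ∑ a ∈ Finset.univ.erase i, (if a < i then -c / N * (s i * s a) else 0) := by
    rw [← Finset.add_sum_erase _ _ (Finset.mem_univ i)]; simp
  rw [h2, add_assoc, ← Finset.sum_add_distrib]
  have h3 : ∀ b ∈ Finset.univ.erase i, ((if b = i then c * q * s i else
      if i < b then -c / N * (s i * s b) else 0) + if b < i then -c / N * (s i * s b) else 0) =
      -c / N * s i * s b := by
    intro b hb
    have hb' := Finset.ne_of_mem_erase hb
    rcases lt_or_gt_of_ne hb' with h | h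
    · simp [hb', h, h.not_gt]; ring
    · simp [hb', h, h.not_gt]; ring
  rw [Finset.sum_congr rfl h3, ← Finset.mul_sum]
  ring

theorem hasDerivAt_cav (β h : ℝ) {q : ℝ} (hq : 0 ≤ q) (i : Fin N) (θ : ℝ) (f : (ι → Cfg N) → ℝ) :
    HasDerivAt (fun θ => (cavModel β h q i θ).avg f)
      (-(Real.sin θ * Real.cos θ) * β ^ 2 * cavDeriv β h q i θ f) θ := by
  have main := hasDerivAt_integral_gibbsAvg (hasDerivAt_cavCoupling β q i)
    (abs_cavCouplingDeriv_le β q i) pairSpin (fun σ : Cfg N => h * ∑ j, spin (σ j)) f θ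
  refine main.congr_deriv ?_
  set S := fun x y (τ : Option (Option ι) → Cfg N) =>
    (∑ j ∈ Finset.univ.erase i, spin (τ x j) * spin (τ y j)) / N - q with hS
  have hdiag : ∀ x τ, S x x τ = (∑ _j ∈ Finset.univ.erase i, (1 : ℝ)) / N - q := by
    intro x τ
    simp only [hS, spin_mul_self]
  have key : ∀ τ : Option (Option ι) → Cfg N,
      ∑ a, ∑ b, cavCouplingDeriv β q i θ a b * cavCoupling β q i θ a b *
        ((f (fun l => τ (some (some l))) * ∑ k, replicaCoeff ι k * pairSpin a b (τ (some k))) *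
          ∑ k, replicaCoeff (Option ι) k * pairSpin a b (τ k)) =
      ∑ x, ∑ y, (-(Real.sin θ * Real.cos θ) * β ^ 2) *
        (extCoeff ι x * replicaCoeff (Option ι) y *
        (f (fun l => τ (some (some l))) * (spin (τ x i) * spin (τ y i)) * S x y τ)) := by
    intro τ
    have e1 : ∀ a b, ∑ k, replicaCoeff ι k * pairSpin a b (τ (some k)) =
        ∑ x, extCoeff ι x * pairSpin a b (τ x) := by
      intro a b
      rw [Fintype.sum_option (fun x => extCoeff ι x * pairSpin a b (τ x))]
      simp [extCoeff]
    have e2 : ∀ a b, cavCouplingDeriv β q i θ a b * cavCoupling β q i θ a b *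
        ((f (fun l => τ (some (some l))) * ∑ k, replicaCoeff ι k * pairSpin a b (τ (some k))) *
          ∑ k, replicaCoeff (Option ι) k * pairSpin a b (τ k)) =
        ∑ x, ∑ y, (f (fun l => τ (some (some l))) * (extCoeff ι x * replicaCoeff (Option ι) y)) *
          (cavCouplingDeriv β q i θ a b * cavCoupling β q i θ a b *
            (pairSpin a b (τ x) * pairSpin a b (τ y))) := by
      intro a b
      rw [e1, mul_assoc (f _), Finset.sum_mul_sum, Finset.mul_sum, Finset.mul_sum]
      refine Finset.sum_congr rfl fun x _ => ?_
      rw [Finset.mul_sum, Finset.mul_sum]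
      exact Finset.sum_congr rfl fun y _ => by ring
    calc _ = ∑ a, ∑ b, ∑ x, ∑ y, (f (fun l => τ (some (some l))) *
          (extCoeff ι x * replicaCoeff (Option ι) y)) *
          (cavCouplingDeriv β q i θ a b * cavCoupling β q i θ a b *
            (pairSpin a b (τ x) * pairSpin a b (τ y))) :=
          Finset.sum_congr rfl fun a _ => Finset.sum_congr rfl fun b _ => e2 a b
      _ = ∑ a, ∑ x, ∑ b, ∑ y, (f (fun l => τ (some (some l))) *
          (extCoeff ι x * replicaCoeff (Option ι) y)) *
          (cavCouplingDeriv β q i θ a b * cavCoupling β q i θ a b *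
            (pairSpin a b (τ x) * pairSpin a b (τ y))) :=
          Finset.sum_congr rfl fun a _ => Finset.sum_comm
      _ = ∑ x, ∑ a, ∑ y, ∑ b, (f (fun l => τ (some (some l))) *
          (extCoeff ι x * replicaCoeff (Option ι) y)) *
          (cavCouplingDeriv β q i θ a b * cavCoupling β q i θ a b *
            (pairSpin a b (τ x) * pairSpin a b (τ y))) := by
          rw [Finset.sum_comm]
          exact Finset.sum_congr rfl fun x _ => Finset.sum_congr rfl fun a _ => Finset.sum_comm
      _ = _ := by
          refine Finset.sum_congr rfl fun x _ => ?_
          rw [Finset.sum_comm]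
          refine Finset.sum_congr rfl fun y _ => ?_
          simp_rw [← Finset.mul_sum]
          rw [sum_cavCoupling_mul_pairSpin β hq]
          ring
  have step1 : (∑ a, ∑ b, cavCouplingDeriv β q i θ a b * cavCoupling β q i θ a b *
      ∫ g, gibbsAvg ((cavModel β h q i θ).ham g)
        (fun τ : Option (Option ι) → Cfg N => (f (fun l => τ (some (some l))) *
          ∑ k, replicaCoeff ι k * pairSpin a b (τ (some k))) *
            ∑ k, replicaCoeff (Option ι) k * pairSpin a b (τ k)) ∂gaussN N) =
      (cavModel β h q i θ).avg (fun τ : Option (Option ι) → Cfg N => ∑ a, ∑ b,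
        cavCouplingDeriv β q i θ a b * cavCoupling β q i θ a b *
        ((f (fun l => τ (some (some l))) * ∑ k, replicaCoeff ι k * pairSpin a b (τ (some k))) *
          ∑ k, replicaCoeff (Option ι) k * pairSpin a b (τ k))) := by
    simp_rw [LinModel.avg_sum, LinModel.avg_const_mul]
    rfl
  refine step1.trans ?_
  rw [funext key]
  have key2 : ∀ τ : Option (Option ι) → Cfg N,
      ∑ x, ∑ y, (-(Real.sin θ * Real.cos θ) * β ^ 2) *
        (extCoeff ι x * replicaCoeff (Option ι) y *
        (f (fun l => τ (some (some l))) * (spin (τ x i) * spin (τ y i)) * S x y τ)) =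
      ∑ x, ∑ y, (-(Real.sin θ * Real.cos θ) * β ^ 2) *
        (extCoeff ι x * replicaCoeff (Option ι) y *
        (f (fun l => τ (some (some l))) * (spin (τ x i) * spin (τ y i)) *
          cavOverlap q i x y τ)) := by
    intro τ
    have e3 : ∀ x y, f (fun l => τ (some (some l))) * (spin (τ x i) * spin (τ y i)) * S x y τ =
        f (fun l => τ (some (some l))) * (spin (τ x i) * spin (τ y i)) * cavOverlap q i x y τ +
        if x = y then f (fun l => τ (some (some l))) *
          ((∑ _j ∈ Finset.univ.erase i, (1 : ℝ)) / N - q) else 0 := by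
      intro x y
      by_cases hxy : x = y
      · subst hxy
        simp only [hdiag, cavOverlap, if_true, spin_mul_self]
        ring
      · simp [cavOverlap, hxy, hS]
    simp_rw [e3, mul_add, Finset.sum_add_distrib]
    simp only [mul_ite, mul_zero, Finset.sum_ite_eq, Finset.mem_univ, if_true]
    rw [add_eq_left, ← Finset.mul_sum, ← Finset.sum_mul, sum_extCoeff_mul_replicaCoeff]
    ring
  rw [funext key2]
  unfold cavDeriv
  simp_rw [LinModel.avg_sum, LinModel.avg_const_mul, Finset.mul_sum]

end Cavity

section CavityBounds

variable {N : ℕ} {ι κ : Type} [Fintype ι] [DecidableEq ι] [Fintype κ] [DecidableEq κ]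

open LinModel

theorem abs_sum_sum_mul_le (c : ι → ℝ) (d : κ → ℝ) (a : ι → κ → ℝ) {M : ℝ}
    (ha : ∀ x y, |a x y| ≤ M) :
    |∑ x, ∑ y, c x * d y * a x y| ≤ (∑ x, |c x|) * (∑ y, |d y|) * M := by
  rw [Finset.sum_mul_sum, Finset.sum_mul]
  refine (Finset.abs_sum_le_sum_abs _ _).trans (Finset.sum_le_sum fun x _ => ?_)
  rw [Finset.sum_mul]
  refine (Finset.abs_sum_le_sum_abs _ _).trans (Finset.sum_le_sum fun y _ => ?_)
  rw [abs_mul, abs_mul]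
  exact mul_le_mul_of_nonneg_left (ha x y) (by positivity)

theorem abs_sum_extCoeff_le (a : Option (Option ι) → Option (Option ι) → ℝ) {M : ℝ}
    (ha : ∀ x y, |a x y| ≤ M) :
    |∑ x, ∑ y, extCoeff ι x * replicaCoeff (Option ι) y * a x y| ≤
      4 * Fintype.card ι * (Fintype.card ι + 1) * M := by
  refine (abs_sum_sum_mul_le _ _ _ ha).trans_eq ?_
  rw [sum_abs_extCoeff, sum_abs_replicaCoeff, Fintype.card_option]
  push_cast
  ring

theorem some_some_injective : Function.Injective (fun l : ι => some (some l)) :=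
  fun _ _ h => Option.some_injective _ (Option.some_injective _ h)

theorem avg_ext (m : LinModel (Cfg N) N) (f : (ι → Cfg N) → ℝ) :
    m.avg (fun τ : Option (Option ι) → Cfg N => f fun l => τ (some (some l))) = m.avg f :=
  avg_comp m _ some_some_injective f

theorem abs_cavDeriv_le (β h q : ℝ) (i : Fin N) (θ : ℝ) (f : (ι → Cfg N) → ℝ) {M : ℝ}
    (hM : ∀ x y, (cavModel β h q i θ).avg (fun τ : Option (Option ι) → Cfg N =>
      |f fun l => τ (some (some l))| * |cavOverlap q i x y τ|) ≤ M) :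
    |cavDeriv β h q i θ f| ≤ 4 * Fintype.card ι * (Fintype.card ι + 1) * M := by
  refine abs_sum_extCoeff_le _ fun x y => (abs_avg_le _ fun τ => ?_).trans (hM x y)
  rw [abs_mul, abs_mul, abs_mul, abs_spin, abs_spin, mul_one, mul_one]

theorem abs_sin_mul_cos_le (θ : ℝ) : |Real.sin θ * Real.cos θ| ≤ 1 / 2 := by
  rw [abs_le]
  have := Real.sin_sq_add_cos_sq θ
  constructor <;> nlinarith [sq_nonneg (Real.sin θ + Real.cos θ), sq_nonneg (Real.sin θ - Real.cos θ)]

theorem cavModel_avg_le_exp (β h : ℝ) {q : ℝ} (hq0 : 0 ≤ q) (hq1 : q ≤ 1) (i : Fin N)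
    {θ : ℝ} (hθ0 : 0 ≤ θ) (hθ1 : θ ≤ Real.pi / 2) {f : (ι → Cfg N) → ℝ} (hf : ∀ τ, 0 ≤ f τ) :
    (cavModel β h q i θ).avg f ≤
      Real.exp (8 * Fintype.card ι * (Fintype.card ι + 1) * β ^ 2) * (skModel N β h).avg f := by
  set L : ℝ := 4 * Fintype.card ι * (Fintype.card ι + 1) * β ^ 2 with hL
  have hL0 : 0 ≤ L := by positivity
  have hbound : ∀ θ, |cavDeriv β h q i θ f| ≤
      4 * Fintype.card ι * (Fintype.card ι + 1) * (2 * (cavModel β h q i θ).avg f) := by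
    intro θ
    refine abs_cavDeriv_le β h q i θ f fun x y => ?_
    rw [← avg_ext (cavModel β h q i θ) f, ← avg_const_mul]
    refine avg_mono _ fun τ => ?_
    rw [abs_of_nonneg (hf _), mul_comm]
    exact mul_le_mul_of_nonneg_right (abs_cavOverlap_le hq0 hq1 i x y τ) (hf _)
  have hanti : Antitone fun θ => (cavModel β h q i θ).avg f * Real.exp (-(L * θ)) := by
    refine antitone_of_hasDerivAt_nonpos (f' := fun θ =>
      (-(Real.sin θ * Real.cos θ) * β ^ 2 * cavDeriv β h q i θ f) * Real.exp (-(L * θ)) +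
      (cavModel β h q i θ).avg f * (Real.exp (-(L * θ)) * -(L * 1)))
      (fun θ => (hasDerivAt_cav β h hq0 i θ f).fun_mul
        (((hasDerivAt_id θ).const_mul L).fun_neg.exp)) fun θ => ?_
    have h1 : -(Real.sin θ * Real.cos θ) * β ^ 2 * cavDeriv β h q i θ f ≤
        L * (cavModel β h q i θ).avg f := by
      refine (le_abs_self _).trans ?_
      rw [abs_mul, abs_mul, abs_neg, abs_of_nonneg (sq_nonneg β)]
      calc _ ≤ 1 / 2 * β ^ 2 * (4 * Fintype.card ι * (Fintype.card ι + 1) *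
            (2 * (cavModel β h q i θ).avg f)) := by
            have := hbound θ
            have := abs_sin_mul_cos_le θ
            gcongr
        _ = _ := by rw [hL]; ring
    have h2 := Real.exp_pos (-(L * θ))
    show _ ≤ (0 : ℝ)
    nlinarith
  have h0 := hanti hθ0
  simp only [cavModel_zero, mul_zero, neg_zero, Real.exp_zero, mul_one] at h0
  rw [Real.exp_neg, ← div_eq_mul_inv, div_le_iff₀ (Real.exp_pos _), mul_comm] at h0
  refine h0.trans ?_
  have hsk : 0 ≤ (skModel N β h).avg f := avg_nonneg _ hf
  have h2 : L * θ ≤ 8 * Fintype.card ι * (Fintype.card ι + 1) * β ^ 2 := by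
    have : θ ≤ 2 := by linarith [Real.pi_le_four]
    calc L * θ ≤ L * 2 := mul_le_mul_of_nonneg_left this hL0
      _ = _ := by rw [hL]; ring
  gcongr

theorem abs_sub_le_of_abs_hasDerivAt_le {F F' : ℝ → ℝ} (hF : ∀ θ, HasDerivAt F (F' θ) θ) {C : ℝ}
    (hC : ∀ θ, 0 ≤ θ → θ ≤ Real.pi / 2 → |F' θ| ≤ C) {θ₁ θ₂ : ℝ} (h1 : 0 ≤ θ₁)
    (h1' : θ₁ ≤ Real.pi / 2) (h2 : 0 ≤ θ₂) (h2' : θ₂ ≤ Real.pi / 2) :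
    |F θ₁ - F θ₂| ≤ 2 * C := by
  have hC0 : 0 ≤ C := (abs_nonneg _).trans (hC θ₁ h1 h1')
  have := (convex_Icc (0 : ℝ) (Real.pi / 2)).norm_image_sub_le_of_norm_hasDerivWithin_le
    (f := F) (f' := F') (C := C) (fun x _ => (hF x).hasDerivWithinAt)
    (fun x hx => by simpa using hC x hx.1 hx.2) ⟨h2, h2'⟩ ⟨h1, h1'⟩
  simp only [Real.norm_eq_abs] at this
  refine this.trans ?_
  have h3 : |θ₁ - θ₂| ≤ 2 := by
    have := Real.pi_le_four
    rw [abs_le]; constructor <;> linarith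
  nlinarith

/-- The constant of the first order cavity comparison. -/
def cavConst (n : ℕ) (β : ℝ) : ℝ :=
  4 * n * (n + 1) * Real.exp (8 * (n + 2) * (n + 3) * β ^ 2)

theorem cavConst_nonneg (n : ℕ) (β : ℝ) : 0 ≤ cavConst n β := by
  unfold cavConst; positivity

theorem abs_cavModel_avg_sub_le (β h : ℝ) {q : ℝ} (hq0 : 0 ≤ q) (hq1 : q ≤ 1) (i : Fin N)
    {θ₁ θ₂ : ℝ} (h1 : 0 ≤ θ₁) (h1' : θ₁ ≤ Real.pi / 2) (h2 : 0 ≤ θ₂) (h2' : θ₂ ≤ Real.pi / 2)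
    (f : (ι → Cfg N) → ℝ) {M : ℝ}
    (hM : ∀ x y, (skModel N β h).avg (fun τ : Option (Option ι) → Cfg N =>
      |f fun l => τ (some (some l))| * |cavOverlap q i x y τ|) ≤ M) :
    |(cavModel β h q i θ₁).avg f - (cavModel β h q i θ₂).avg f| ≤
      β ^ 2 * cavConst (Fintype.card ι) β * M := by
  refine (abs_sub_le_of_abs_hasDerivAt_le (hasDerivAt_cav β h hq0 i · f)
    (C := 1 / 2 * β ^ 2 * (cavConst (Fintype.card ι) β * M))
    (fun θ hθ hθ' => ?_) h1 h1' h2 h2').trans_eq (by ring)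
  rw [abs_mul, abs_mul, abs_neg, abs_of_nonneg (sq_nonneg β)]
  have h3 := abs_sin_mul_cos_le θ
  have h4 : |cavDeriv β h q i θ f| ≤ cavConst (Fintype.card ι) β * M := by
    have := abs_cavDeriv_le β h q i θ f (M := Real.exp (8 * (Fintype.card ι + 2) *
      (Fintype.card ι + 3) * β ^ 2) * M) fun x y => ?_
    · unfold cavConst
      linarith
    · refine (cavModel_avg_le_exp β h hq0 hq1 i hθ hθ' fun τ => by positivity).trans ?_
      rw [Fintype.card_option, Fintype.card_option]
      have := hM x y
      have e : (8 * ((Fintype.card ι + 1 + 1 : ℕ) : ℝ) * (((Fintype.card ι + 1 + 1 : ℕ) : ℝ) + 1) *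
        β ^ 2) = 8 * (Fintype.card ι + 2) * (Fintype.card ι + 3) * β ^ 2 := by push_cast; ring
      rw [e]
      gcongr
  gcongr

theorem abs_avg_sub_cav_sub_cavDeriv_le {β : ℝ} (hβ : |β| ≤ 1) (h : ℝ) {q : ℝ} (hq0 : 0 ≤ q)
    (hq1 : q ≤ 1) (i : Fin N) (f : (ι → Cfg N) → ℝ) {M : ℝ}
    (hM : ∀ x y z w, (skModel N β h).avg
      (fun τ : Option (Option (Option (Option ι))) → Cfg N =>
        |f fun l => τ (some (some (some (some l))))| *
          |cavOverlap q i (some (some x)) (some (some y)) τ| * |cavOverlap q i z w τ|) ≤ M) :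
    |(skModel N β h).avg f - (cavModel β h q i (Real.pi / 2)).avg f -
      β ^ 2 / 2 * cavDeriv β h q i (Real.pi / 2) f| ≤
      4 * Fintype.card ι * (Fintype.card ι + 1) * cavConst (Fintype.card ι + 2) 1 * M := by
  have hM0 : 0 ≤ M := le_trans (avg_nonneg _ fun τ => by positivity) (hM none none none none)
  have hβ1 : β ^ 2 ≤ 1 := by rw [← sq_abs]; exact pow_le_one₀ (abs_nonneg _) hβ
  have hpi := Real.pi_pos
  set C : ℝ := 4 * Fintype.card ι * (Fintype.card ι + 1) * (cavConst (Fintype.card ι + 2) 1 * M)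
    with hC
  have hcc : cavConst (Fintype.card ι + 2) β ≤ cavConst (Fintype.card ι + 2) 1 := by
    unfold cavConst
    simp only [one_pow]
    gcongr
  have hcc0 := cavConst_nonneg (Fintype.card ι + 2) β
  have hD : ∀ θ, 0 ≤ θ → θ ≤ Real.pi / 2 →
      |cavDeriv β h q i θ f - cavDeriv β h q i (Real.pi / 2) f| ≤ C := by
    intro θ hθ hθ'
    unfold cavDeriv
    simp_rw [← Finset.sum_sub_distrib, ← mul_sub]
    refine abs_sum_extCoeff_le _ fun x y => ?_
    refine (abs_cavModel_avg_sub_le β h hq0 hq1 i hθ hθ' (by positivity) le_rfl _ (M := M)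
      fun z w => ?_).trans ?_
    · refine le_trans (avg_mono _ fun τ => ?_) (hM x y z w)
      rw [abs_mul, abs_mul, abs_mul, abs_spin, abs_spin, mul_one, mul_one]
      refine le_of_eq ?_
      congr 2
      unfold cavOverlap
      simp
    · rw [Fintype.card_option, Fintype.card_option]
      calc _ ≤ 1 * cavConst (Fintype.card ι + 2) β * M := by gcongr
        _ ≤ _ := by rw [one_mul]; gcongr
  have := abs_sub_le_of_abs_hasDerivAt_le (F := fun θ => (cavModel β h q i θ).avg f +
      Real.sin θ ^ 2 * (β ^ 2 / 2 * cavDeriv β h q i (Real.pi / 2) f))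
    (F' := fun θ => -(Real.sin θ * Real.cos θ) * β ^ 2 * cavDeriv β h q i θ f +
      ((2 : ℕ) * Real.sin θ ^ (2 - 1) * Real.cos θ) *
        (β ^ 2 / 2 * cavDeriv β h q i (Real.pi / 2) f))
    (fun θ => (hasDerivAt_cav β h hq0 i θ f).add
      (((Real.hasDerivAt_sin θ).fun_pow 2).mul_const _)) (C := C / 2) (fun θ hθ hθ' => ?_)
    le_rfl (by positivity) (by positivity : 0 ≤ Real.pi / 2) le_rfl
  · simp only [cavModel_zero, Real.sin_zero, Real.sin_pi_div_two] at this
    calc _ = |(skModel N β h).avg f + 0 ^ 2 * (β ^ 2 / 2 * cavDeriv β h q i (Real.pi / 2) f) -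
          ((cavModel β h q i (Real.pi / 2)).avg f + 1 ^ 2 *
            (β ^ 2 / 2 * cavDeriv β h q i (Real.pi / 2) f))| := by congr 1; ring
      _ ≤ _ := by rw [hC] at this; linarith
  · have e : -(Real.sin θ * Real.cos θ) * β ^ 2 * cavDeriv β h q i θ f +
      ((2 : ℕ) * Real.sin θ ^ (2 - 1) * Real.cos θ) *
        (β ^ 2 / 2 * cavDeriv β h q i (Real.pi / 2) f) = -(Real.sin θ * Real.cos θ) * β ^ 2 *
        (cavDeriv β h q i θ f - cavDeriv β h q i (Real.pi / 2) f) := by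
      push_cast; ring
    rw [e, abs_mul, abs_mul, abs_neg, abs_of_nonneg (sq_nonneg β)]
    have h3 := abs_sin_mul_cos_le θ
    have h4 := hD θ hθ hθ'
    have hC0 : 0 ≤ C := (abs_nonneg _).trans h4
    calc _ ≤ 1 / 2 * 1 * C := by gcongr
      _ = _ := by ring

end CavityBounds

section Decoupling

variable {N : ℕ} {ι κ : Type} [Fintype ι] [DecidableEq ι] [Fintype κ] [DecidableEq κ]

open LinModel

theorem integrable_gibbsAvg_ham {A : Type} [Fintype A] [Nonempty A] (m : LinModel A N)
    (f : (ι → A) → ℝ) : Integrable (fun g => gibbsAvg (m.ham g) f) (gaussN N) :=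
  integrable_gibbsAvg_linHam _ _ _ f

/-- Exchange the spins at the site `i` with external spins. -/
def swapSite (ι : Type) (i : Fin N) : (ι → Cfg N) × (ι → Bool) ≃ (ι → Cfg N) × (ι → Bool) where
  toFun p := (fun l => Function.update (p.1 l) i (p.2 l), fun l => p.1 l i)
  invFun p := (fun l => Function.update (p.1 l) i (p.2 l), fun l => p.1 l i)
  left_inv p := by ext <;> simp
  right_inv p := by ext <;> simp

theorem gibbsAvg_site_mul (i : Fin N) (u : Bool → ℝ) {v : Cfg N → ℝ}
    (hv : ∀ σ b, v (Function.update σ i b) = v σ) (ψ : (ι → Bool) → ℝ) {f : (ι → Cfg N) → ℝ}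
    (hf : ∀ (τ : ι → Cfg N) (b : ι → Bool), f (fun l => Function.update (τ l) i (b l)) = f τ) :
    gibbsAvg (fun σ : Cfg N => u (σ i) + v σ) (fun τ => ψ (fun l => τ l i) * f τ) =
      gibbsAvg u ψ * gibbsAvg v f := by
  set H : Cfg N → ℝ := fun σ => u (σ i) + v σ with hH
  set z : Bool → ℝ := fun _ => 0 with hz
  have hZ : (∑ σ, Real.exp (H σ)) * ∑ b, Real.exp (z b) =
      (∑ σ, Real.exp (v σ)) * ∑ b, Real.exp (u b) := by
    rw [Fintype.sum_mul_sum, Fintype.sum_mul_sum, ← Fintype.sum_prod_type', ← Fintype.sum_prod_type']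
    let e : Cfg N × Bool ≃ Cfg N × Bool :=
      { toFun := fun p => (Function.update p.1 i p.2, p.1 i)
        invFun := fun p => (Function.update p.1 i p.2, p.1 i)
        left_inv := fun p => by ext <;> simp
        right_inv := fun p => by ext <;> simp }
    rw [← e.sum_comp fun p : Cfg N × Bool => Real.exp (v p.1) * Real.exp (u p.2)]
    refine Finset.sum_congr rfl fun p _ => ?_
    simp only [e, Equiv.coe_fn_mk, hv, hH, hz, Real.exp_zero, mul_one, Real.exp_add]
    ring
  have hw : ∀ σ b, gibbsWeight H σ * gibbsWeight z b = gibbsWeight v σ * gibbsWeight u (σ i) := by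
    intro σ b
    unfold gibbsWeight
    rw [div_mul_div_comm, div_mul_div_comm, hZ]
    congr 1
    simp only [hH, hz, Real.exp_zero, mul_one, Real.exp_add]
    ring
  have hwv : ∀ σ b, gibbsWeight v (Function.update σ i b) = gibbsWeight v σ := by
    intro σ b
    unfold gibbsWeight
    rw [hv]
  unfold gibbsAvg
  calc _ = ∑ τ : ι → Cfg N, ∑ b : ι → Bool, (ψ (fun l => τ l i) * f τ) *
        ∏ l, (gibbsWeight v (τ l) * gibbsWeight u (τ l i)) := by
        refine Finset.sum_congr rfl fun τ _ => ?_
        rw [← Finset.mul_sum]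
        congr 1
        conv_lhs => rw [← mul_one (∏ l, gibbsWeight H (τ l)), ← sum_prod_gibbsWeight (ι := ι) z,
          Finset.mul_sum]
        refine Finset.sum_congr rfl fun b _ => ?_
        rw [← Finset.prod_mul_distrib]
        exact Finset.prod_congr rfl fun l _ => hw _ _
    _ = ∑ p : (ι → Cfg N) × (ι → Bool), (ψ p.2 * f p.1) *
        ∏ l, (gibbsWeight v (p.1 l) * gibbsWeight u (p.2 l)) := by
        rw [← (swapSite ι i).sum_comp, Fintype.sum_prod_type]
        refine Finset.sum_congr rfl fun τ _ => Finset.sum_congr rfl fun b _ => ?_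
        simp only [swapSite, Equiv.coe_fn_mk, hf, hwv]
    _ = _ := by
        rw [mul_comm, Fintype.sum_mul_sum, Fintype.sum_prod_type]
        refine Finset.sum_congr rfl fun τ _ => Finset.sum_congr rfl fun b _ => ?_
        rw [Finset.prod_mul_distrib]
        ring

/-- A single spin in a Gaussian field of variance `β² q` and an external field `h`. -/
def siteModel (β h q : ℝ) : LinModel Bool 1 where
  coupling _ _ := β * Real.sqrt q
  inter _ _ := spin
  base b := h * spin b

theorem avg_decouple (β h q : ℝ) (i : Fin N) (ψ : (ι → Bool) → ℝ) {f : (ι → Cfg N) → ℝ}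
    (hf : ∀ (τ : ι → Cfg N) (b : ι → Bool), f (fun l => Function.update (τ l) i (b l)) = f τ) :
    (cavModel β h q i (Real.pi / 2)).avg (fun τ => ψ (fun l => τ l i) * f τ) =
      (siteModel β h q).avg ψ * (cavModel β h q i (Real.pi / 2)).avg f := by
  set u : ℝ → Bool → ℝ := fun y b => β * Real.sqrt q * y * spin b + h * spin b with hu
  set mv : LinModel (Cfg N) N :=
    { coupling := fun a b => if a = i ∨ b = i then 0 else cavCoupling β q i (Real.pi / 2) a b
      inter := pairSpin
      base := fun σ => h * ∑ j ∈ Finset.univ.erase i, spin (σ j) } with hmv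
  have hham : ∀ g, (cavModel β h q i (Real.pi / 2)).ham g =
      fun σ => u (g i i) (σ i) + mv.ham g σ := by
    intro g
    funext σ
    simp only [ham, linHam, cavModel, hmv, hu]
    have h1 : ∀ a b, cavCoupling β q i (Real.pi / 2) a b * g a b * pairSpin a b σ =
        (if a = i then (if b = i then β * Real.sqrt q * g i i * spin (σ i) else 0) else 0) +
        (if a = i ∨ b = i then 0 else cavCoupling β q i (Real.pi / 2) a b) * g a b *
          pairSpin a b σ := by
      intro a b
      by_cases ha : a = i
      · subst ha
        by_cases hb : b = a
        · subst hb; simp [cavCoupling, pairSpin]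
        · simp [cavCoupling, hb, Ne.symm hb]
      · by_cases hb : b = i
        · subst hb; simp [cavCoupling, ha]
        · simp [ha, hb]
    simp_rw [h1, Finset.sum_add_distrib]
    rw [← Finset.add_sum_erase _ (fun j => spin (σ j)) (Finset.mem_univ i)]
    simp
    ring
  have hv : ∀ g σ b, mv.ham g (Function.update σ i b) = mv.ham g σ := by
    intro g σ b
    simp only [ham, linHam, hmv]
    congr 1
    · refine Finset.sum_congr rfl fun a _ => Finset.sum_congr rfl fun c _ => ?_
      by_cases ha : a = i
      · simp [ha]
      · by_cases hc : c = i
        · simp [hc]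
        · simp [pairSpin, ha, hc]
    · congr 1
      exact Finset.sum_congr rfl fun j hj => by
        rw [Function.update_of_ne (Finset.ne_of_mem_erase hj)]
  have hv' : ∀ g y, mv.ham (setEntry g i i y) = mv.ham g := by
    intro g y
    funext σ
    simp only [ham, linHam, hmv]
    congr 1
    refine Finset.sum_congr rfl fun a _ => Finset.sum_congr rfl fun c _ => ?_
    by_cases ha : a = i
    · simp [ha]
    · simp [setEntry_apply, ha]
  have hsite : ∀ χ : (ι → Bool) → ℝ, (siteModel β h q).avg χ =
      ∫ y, gibbsAvg (u y) χ ∂gaussianReal 0 1 := by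
    intro χ
    unfold avg
    rw [integral_setEntry 0 0 (integrable_gibbsAvg_ham (siteModel β h q) χ)]
    have : ∀ (g : Fin 1 → Fin 1 → ℝ) y, (siteModel β h q).ham (setEntry g 0 0 y) = u y := by
      intro g y
      funext b
      simp [ham, linHam, siteModel, hu, setEntry_apply]
    simp [this]
  have main : ∀ χ : (ι → Bool) → ℝ, (cavModel β h q i (Real.pi / 2)).avg
      (fun τ => χ (fun l => τ l i) * f τ) = (siteModel β h q).avg χ * mv.avg f := by
    intro χ
    rw [hsite]
    unfold avg
    rw [integral_setEntry i i (integrable_gibbsAvg_ham (cavModel β h q i (Real.pi / 2)) _)]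
    simp_rw [hham, gibbsAvg_site_mul i _ (hv _) χ hf, hv', setEntry_apply, and_self, if_true]
    simp_rw [integral_mul_const]
    rw [integral_const_mul]
  rw [main]
  have h1 := main fun _ => 1
  rw [avg_const, one_mul] at h1
  simp only [one_mul] at h1
  rw [h1]

theorem continuous_siteModel_avg (β h : ℝ) (ψ : (ι → Bool) → ℝ) :
    Continuous fun q => (siteModel β h q).avg ψ := by
  obtain ⟨C, -, hC⟩ := exists_abs_le ψ
  unfold avg
  refine continuous_of_dominated (bound := fun _ => C)
    (fun q => (integrable_gibbsAvg_linHam _ _ _ ψ).aestronglyMeasurable)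
    (fun q => Filter.Eventually.of_forall fun g => by simpa using gibbsAvg_abs_le _ ψ hC)
    (integrable_const _) (Filter.Eventually.of_forall fun g => continuous_gibbsAvg (fun b => ?_) ψ)
  unfold ham linHam siteModel
  fun_prop

theorem gibbsAvg_mul_two {A : Type} [Fintype A] (H : A → ℝ) (φ : A → ℝ) :
    gibbsAvg H (fun v : Fin 2 → A => φ (v 0) * φ (v 1)) = (∑ a, φ a * gibbsWeight H a) ^ 2 := by
  unfold gibbsAvg
  rw [← (finTwoArrowEquiv A).symm.sum_comp, Fintype.sum_prod_type, sq, Fintype.sum_mul_sum]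
  refine Finset.sum_congr rfl fun a _ => Finset.sum_congr rfl fun b _ => ?_
  simp [Fin.prod_univ_two]
  ring

theorem siteModel_avg_mul_nonneg (β h q : ℝ) :
    0 ≤ (siteModel β h q).avg (fun v : Fin 2 → Bool => spin (v 0) * spin (v 1)) := by
  unfold avg
  refine integral_nonneg fun g => ?_
  rw [Pi.zero_apply, gibbsAvg_mul_two]
  positivity

theorem exists_overlap_fixedPoint (β h : ℝ) : ∃ q, 0 ≤ q ∧ q ≤ 1 ∧
    (siteModel β h q).avg (fun v : Fin 2 → Bool => spin (v 0) * spin (v 1)) = q := by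
  obtain ⟨q, hq, hfix⟩ := exists_mem_Icc_isFixedPt_of_mapsTo
    (f := fun q => (siteModel β h q).avg (fun v : Fin 2 → Bool => spin (v 0) * spin (v 1)))
    (continuous_siteModel_avg β h _).continuousOn zero_le_one fun q _ =>
      ⟨siteModel_avg_mul_nonneg β h q, (le_abs_self _).trans (abs_avg_le_const _ fun σs => by
        rw [abs_mul, abs_spin, abs_spin, mul_one])⟩
  exact ⟨q, hq.1, hq.2, hfix⟩

end Decoupling

section OverlapMoments

open LinModel

/-- The parameters for which the replica symmetric cavity method is carried out. -/
structure CavityParams (β h q : ℝ) : Prop where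
  abs_le : |β| ≤ 1 / 100
  nonneg : 0 ≤ q
  le_one : q ≤ 1
  fixed : (siteModel β h q).avg (fun v : Fin 2 → Bool => spin (v 0) * spin (v 1)) = q

theorem CavityParams.abs_le_one {β h q : ℝ} (hp : CavityParams β h q) : |β| ≤ 1 :=
  hp.abs_le.trans (by norm_num)

theorem CavityParams.sq_le {β h q : ℝ} (hp : CavityParams β h q) : β ^ 2 ≤ 1 / 10000 := by
  rw [← sq_abs]
  calc |β| ^ 2 ≤ (1 / 100) ^ 2 := by gcongr; exact hp.abs_le
    _ = _ := by norm_num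

theorem CavityParams.sq_mul_cavConst_two_le {β h q : ℝ} (hp : CavityParams β h q) :
    β ^ 2 * cavConst 2 β ≤ 1 / 100 := by
  have h1 := hp.sq_le
  have h2 : Real.exp (8 * ((2 : ℕ) + 2) * ((2 : ℕ) + 3) * β ^ 2) ≤ 3 := by
    refine le_trans (Real.exp_le_exp.2 ?_) (Real.exp_one_lt_d9.le.trans (by norm_num))
    push_cast
    linarith
  unfold cavConst
  calc _ ≤ 1 / 10000 * (4 * ((2 : ℕ) : ℝ) * ((2 : ℕ) + 1) * 3) := by gcongr
    _ ≤ _ := by norm_num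

theorem add_pow_le_three_mul {a b : ℝ} (ha : 0 ≤ a) (hb : 0 ≤ b) (m : ℕ) :
    (a + b) ^ m ≤ 3 * a ^ m + ((m + 1) * b) ^ m := by
  rcases le_or_gt (m * b) a with h | h
  · rcases Nat.eq_zero_or_pos m with rfl | hm
    · norm_num
    · have hm' : (0 : ℝ) < m := by exact_mod_cast hm
      have h1 : a + b ≤ a * Real.exp (1 / m) := by
        have h2 : b ≤ a / m := by rw [le_div_iff₀ hm']; linarith
        have h3 := Real.add_one_le_exp (1 / (m : ℝ))
        calc a + b ≤ a * (1 / m + 1) := by rw [mul_add, mul_one_div]; linarith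
          _ ≤ _ := mul_le_mul_of_nonneg_left h3 ha
      have h4 : Real.exp (1 / m) ^ m ≤ 3 := by
        rw [← Real.exp_nat_mul, mul_one_div, div_self hm'.ne']
        exact Real.exp_one_lt_d9.le.trans (by norm_num)
      calc (a + b) ^ m ≤ (a * Real.exp (1 / m)) ^ m := by gcongr
        _ = a ^ m * Real.exp (1 / m) ^ m := mul_pow _ _ _
        _ ≤ a ^ m * 3 := by gcongr
        _ ≤ _ := by nlinarith [pow_nonneg (by positivity : 0 ≤ ((m : ℝ) + 1) * b) m]
  · calc (a + b) ^ m ≤ ((m + 1) * b) ^ m := by gcongr; linarith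
      _ ≤ _ := by have := pow_nonneg ha m; linarith

theorem pow_mul_le_add {a b : ℝ} (ha : 0 ≤ a) (hb : 0 ≤ b) (m : ℕ) :
    a ^ m * b ≤ a ^ (m + 1) + b ^ (m + 1) := by
  rcases le_total a b with h | h
  · have : a ^ m * b ≤ b ^ m * b := by gcongr
    rw [pow_succ b]
    have := pow_nonneg ha (m + 1)
    linarith
  · have : a ^ m * b ≤ a ^ m * a := by gcongr
    rw [pow_succ a]
    have := pow_nonneg hb (m + 1)
    linarith

variable {N : ℕ} {ι κ : Type} [Fintype ι] [DecidableEq ι] [Fintype κ] [DecidableEq κ]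

theorem avg_pair {A : Type} [Fintype A] [Nonempty A] (m : LinModel A N) {x y : κ} (hxy : x ≠ y)
    (F : A → A → ℝ) : m.avg (fun τ : κ → A => F (τ x) (τ y)) =
      m.avg (fun τ : Fin 2 → A => F (τ 0) (τ 1)) := by
  have he : Function.Injective ![x, y] := by
    intro a b hab
    fin_cases a <;> fin_cases b <;> simp_all
  exact avg_comp m ![x, y] he fun τ : Fin 2 → A => F (τ 0) (τ 1)

/-- The centred overlap of two replicas. -/
def centredOverlap (q : ℝ) (x y : κ) (τ : κ → Cfg N) : ℝ := overlap N (τ x) (τ y) - q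

theorem cavOverlap_eq (q : ℝ) (i : Fin N) {x y : κ} (hxy : x ≠ y) (τ : κ → Cfg N) :
    cavOverlap q i x y τ = centredOverlap q x y τ - spin (τ x i) * spin (τ y i) / N := by
  unfold cavOverlap centredOverlap overlap
  rw [if_neg hxy, ← Finset.add_sum_erase _ _ (Finset.mem_univ i)]
  ring

theorem abs_centredOverlap_sub_le (q : ℝ) (i : Fin N) {x y : κ} (hxy : x ≠ y) (τ : κ → Cfg N) :
    |centredOverlap q x y τ - cavOverlap q i x y τ| ≤ 1 / N := by
  rw [cavOverlap_eq q i hxy, sub_sub_cancel, abs_div, abs_mul, abs_spin, abs_spin, Nat.abs_cast,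
    mul_one]

theorem cavOverlap_update (q : ℝ) (i : Fin N) (x y : κ) (τ : κ → Cfg N) (b : κ → Bool) :
    cavOverlap q i x y (fun l => Function.update (τ l) i (b l)) = cavOverlap q i x y τ := by
  unfold cavOverlap
  congr 3
  exact Finset.sum_congr rfl fun j hj => by
    simp only [Function.update_of_ne (Finset.ne_of_mem_erase hj)]

theorem avg_cavOverlap (m : LinModel (Cfg N) N) (q : ℝ) (i : Fin N) {x y : κ} (hxy : x ≠ y)
    (F : ℝ → ℝ) : m.avg (fun τ : κ → Cfg N => F (cavOverlap q i x y τ)) =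
      m.avg (fun τ : Fin 2 → Cfg N => F (cavOverlap q i 0 1 τ)) := by
  have := avg_pair m hxy fun σ σ' : Cfg N => F ((∑ j ∈ Finset.univ.erase i,
    spin (σ j) * spin (σ' j)) / N - q)
  simpa only [cavOverlap, if_neg hxy, if_neg (zero_ne_one : (0 : Fin 2) ≠ 1)] using this

theorem CavityParams.siteModel_avg_pair {β h q : ℝ} (hp : CavityParams β h q) {x y : κ}
    (hxy : x ≠ y) : (siteModel β h q).avg (fun v : κ → Bool => spin (v x) * spin (v y)) = q := by
  rw [avg_pair _ hxy fun a b => spin a * spin b, hp.fixed]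

theorem avg_cavOverlap_pow_le (m : LinModel (Cfg N) N) (q : ℝ) (i : Fin N) {x y : κ} (hxy : x ≠ y)
    (k : ℕ) : m.avg (fun τ : κ → Cfg N => |cavOverlap q i x y τ| ^ k) ≤
      3 * m.avg (fun τ : Fin 2 → Cfg N => |centredOverlap q 0 1 τ| ^ k) +
        ((k + 1) * (1 / N)) ^ k := by
  rw [avg_cavOverlap m q i hxy fun r => |r| ^ k, ← avg_const_mul,
    ← avg_const (ι := Fin 2) m (((k + 1) * (1 / N) : ℝ) ^ k), ← avg_add]
  refine avg_mono _ fun τ => ?_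
  refine le_trans ?_ (add_pow_le_three_mul (abs_nonneg _) (by positivity) k)
  have := abs_centredOverlap_sub_le q i (zero_ne_one : (0 : Fin 2) ≠ 1) τ
  gcongr
  rw [abs_sub_comm] at this
  linarith [abs_sub_abs_le_abs_sub (cavOverlap q i 0 1 τ) (centredOverlap q 0 1 τ)]

/-- One step of the induction for the moments of the overlap. -/
theorem avg_centredOverlap_succ_le {β h q : ℝ} (hp : CavityParams β h q) (i : Fin N) (k : ℕ) :
    |(skModel N β h).avg (fun τ : Fin 2 → Cfg N => (spin (τ 0 i) * spin (τ 1 i) - q) *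
        centredOverlap q 0 1 τ ^ (2 * k + 1))| ≤
      1 / 4 * (3 * (skModel N β h).avg (fun τ : Fin 2 → Cfg N =>
          |centredOverlap q 0 1 τ| ^ (2 * k + 2)) + ((2 * k + 3) * (1 / N)) ^ (2 * k + 2)) +
        2 * (2 * k + 1) * (1 / N) * (3 * (skModel N β h).avg (fun τ : Fin 2 → Cfg N =>
          |centredOverlap q 0 1 τ| ^ (2 * k)) + ((2 * k + 1) * (1 / N)) ^ (2 * k)) := by
  have h01 : (0 : Fin 2) ≠ 1 := zero_ne_one
  set sk := skModel N β h with hsk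
  set Y := 3 * sk.avg (fun τ : Fin 2 → Cfg N =>
          |centredOverlap q 0 1 τ| ^ (2 * k + 2)) + ((2 * k + 3) * (1 / N)) ^ (2 * k + 2) with hY
  set f : (Fin 2 → Cfg N) → ℝ := fun τ => (spin (τ 0 i) * spin (τ 1 i) - q) *
        cavOverlap q i 0 1 τ ^ (2 * k + 1) with hf
  have hψ : ∀ b c : Bool, |spin b * spin c - q| ≤ 2 := by
    intro b c
    have : |spin b * spin c| ≤ 1 := by rw [abs_mul, abs_spin, abs_spin, mul_one]
    have h2 : |q| ≤ 1 := by rw [abs_of_nonneg hp.nonneg]; exact hp.le_one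
    linarith [abs_sub (spin b * spin c) q]
  have hYx : ∀ {κ : Type} [Fintype κ] [DecidableEq κ] (x y : κ), x ≠ y →
      sk.avg (fun τ : κ → Cfg N => |cavOverlap q i x y τ| ^ (2 * k + 2)) ≤ Y := by
    intro κ _ _ x y hxy
    refine (avg_cavOverlap_pow_le sk q i hxy (2 * k + 2)).trans_eq ?_
    rw [hY]
    push_cast
    ring
  have hY0 : 0 ≤ Y := le_trans (avg_nonneg _ fun τ => by positivity) (hYx _ _ h01)
  have hcav : |sk.avg f| ≤ 1 / 4 * Y := by
    have hM : ∀ x y : Option (Option (Fin 2)), sk.avg (fun τ : Option (Option (Fin 2)) → Cfg N =>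
        |f fun l => τ (some (some l))| * |cavOverlap q i x y τ|) ≤ 4 * Y := by
      intro x y
      by_cases hxy : x = y
      · simp only [cavOverlap, hxy, if_true, abs_zero, mul_zero, avg_const]
        positivity
      · have hss : (some (some 0) : Option (Option (Fin 2))) ≠ some (some 1) := by simp
        calc _ ≤ sk.avg (fun τ : Option (Option (Fin 2)) → Cfg N =>
              2 * (|cavOverlap q i (some (some 0)) (some (some 1)) τ| ^ (2 * k + 2) +
                |cavOverlap q i x y τ| ^ (2 * k + 2))) := by
              refine avg_mono _ fun τ => ?_
              have e : cavOverlap q i 0 1 (fun l => τ (some (some l))) =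
                cavOverlap q i (some (some 0)) (some (some 1)) τ := by
                unfold cavOverlap; simp
              simp only [hf, abs_mul, abs_pow, e]
              have h1 := hψ (τ (some (some 0)) i) (τ (some (some 1)) i)
              have h2 := pow_mul_le_add (abs_nonneg (cavOverlap q i (some (some 0)) (some (some 1)) τ))
                (abs_nonneg (cavOverlap q i x y τ)) (2 * k + 1)
              rw [mul_assoc]
              gcongr
          _ ≤ 2 * (Y + Y) := by
              rw [avg_const_mul, avg_add]
              have h1 := hYx _ _ hss
              have h2 := hYx _ _ hxy
              gcongr
          _ = 4 * Y := by ring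
    have hpi := Real.pi_pos
    have h1 := abs_cavModel_avg_sub_le β h hp.nonneg hp.le_one i le_rfl (by positivity)
      (by positivity) (le_refl (Real.pi / 2)) f hM
    rw [cavModel_zero] at h1
    have h2 : (cavModel β h q i (Real.pi / 2)).avg f = 0 := by
      rw [hf, avg_decouple β h q i (fun v : Fin 2 → Bool => spin (v 0) * spin (v 1) - q)
        (f := fun τ => cavOverlap q i 0 1 τ ^ (2 * k + 1))
        (fun τ b => by rw [cavOverlap_update]), avg_sub, avg_const, hp.fixed, sub_self, zero_mul]
    rw [h2, sub_zero, Fintype.card_fin] at h1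
    refine h1.trans ?_
    have := hp.sq_mul_cavConst_two_le
    nlinarith
  have hdiff : |sk.avg (fun τ : Fin 2 → Cfg N => (spin (τ 0 i) * spin (τ 1 i) - q) *
        centredOverlap q 0 1 τ ^ (2 * k + 1)) - sk.avg f| ≤
      2 * (2 * k + 1) * (1 / N) * (3 * sk.avg (fun τ : Fin 2 → Cfg N =>
          |centredOverlap q 0 1 τ| ^ (2 * k)) + ((2 * k + 1) * (1 / N)) ^ (2 * k)) := by
    rw [← avg_sub, ← avg_const_mul, ← avg_const (ι := Fin 2) sk (((2 * k + 1) * (1 / N) : ℝ) ^ (2 * k)),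
      ← avg_add, ← avg_const_mul]
    refine abs_avg_le _ fun τ => ?_
    rw [hf, ← mul_sub, abs_mul]
    have h1 := abs_pow_sub_pow_le (centredOverlap q 0 1 τ) (cavOverlap q i 0 1 τ) (2 * k + 1)
    have h2 := abs_centredOverlap_sub_le q i h01 τ
    have h3 : max |centredOverlap q 0 1 τ| |cavOverlap q i 0 1 τ| ≤
        |centredOverlap q 0 1 τ| + 1 / N := by
      refine max_le (by simp) ?_
      rw [abs_sub_comm] at h2
      linarith [abs_sub_abs_le_abs_sub (cavOverlap q i 0 1 τ) (centredOverlap q 0 1 τ)]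
    have h4 := add_pow_le_three_mul (abs_nonneg (centredOverlap q 0 1 τ))
      (by positivity : (0 : ℝ) ≤ 1 / N) (2 * k)
    push_cast at h4
    calc _ ≤ 2 * (1 / N * ((2 * k + 1 : ℕ) : ℝ) *
          (|centredOverlap q 0 1 τ| + 1 / N) ^ (2 * k + 1 - 1)) := by
          refine mul_le_mul (hψ _ _) (h1.trans ?_) (abs_nonneg _) (by norm_num)
          gcongr
      _ ≤ 2 * (1 / N * ((2 * k + 1 : ℕ) : ℝ) * (3 * |centredOverlap q 0 1 τ| ^ (2 * k) +
          ((2 * k + 1) * (1 / N)) ^ (2 * k))) := by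
          rw [Nat.add_sub_cancel]
          gcongr
      _ = _ := by push_cast; ring
  have := abs_sub_abs_le_abs_sub (sk.avg (fun τ : Fin 2 → Cfg N => (spin (τ 0 i) * spin (τ 1 i) - q) *
        centredOverlap q 0 1 τ ^ (2 * k + 1))) (sk.avg f)
  linarith

theorem exists_avg_centredOverlap_pow_le (k : ℕ) : ∃ K : ℝ, 0 ≤ K ∧
    ∀ (N : ℕ) (β h q : ℝ), 0 < N → CavityParams β h q →
      (skModel N β h).avg (fun τ : Fin 2 → Cfg N => |centredOverlap q 0 1 τ| ^ (2 * k)) ≤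
        K * (1 / N) ^ k := by
  induction k with
  | zero => exact ⟨1, zero_le_one, fun N β h q _ _ => by simp [avg_const]⟩
  | succ k ih =>
    obtain ⟨K, hK, ih⟩ := ih
    refine ⟨4 * ((2 * k + 3) ^ (2 * k + 2) +
      2 * (2 * k + 1) * (3 * K + (2 * k + 1) ^ (2 * k))), by positivity, fun N β h q hN hp => ?_⟩
    have hN' : (0 : ℝ) < N := by exact_mod_cast hN
    set sk := skModel N β h with hsk
    set X := sk.avg (fun τ : Fin 2 → Cfg N => |centredOverlap q 0 1 τ| ^ (2 * k + 2)) with hX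
    set Y := sk.avg (fun τ : Fin 2 → Cfg N => |centredOverlap q 0 1 τ| ^ (2 * k)) with hY
    have hX0 : 0 ≤ X := avg_nonneg _ fun τ => by positivity
    have hYle := ih N β h q hN hp
    set s : ℝ := 1 / N with hs
    have hs0 : 0 < s := by positivity
    have hs1 : s ≤ 1 := by
      rw [hs, div_le_one hN']
      exact_mod_cast hN
    set B := 1 / 4 * (3 * X + ((2 * k + 3) * s) ^ (2 * k + 2)) +
        2 * (2 * k + 1) * s * (3 * Y + ((2 * k + 1) * s) ^ (2 * k)) with hB
    have hexp : X = s * ∑ i : Fin N, sk.avg (fun τ : Fin 2 → Cfg N =>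
        (spin (τ 0 i) * spin (τ 1 i) - q) * centredOverlap q 0 1 τ ^ (2 * k + 1)) := by
      rw [← avg_sum, ← avg_const_mul, hX]
      congr 1
      funext τ
      rw [← Finset.sum_mul, Finset.sum_sub_distrib, Finset.sum_const, Finset.card_univ,
        Fintype.card_fin, nsmul_eq_mul, ← mul_assoc, mul_sub, ← mul_assoc, hs,
        one_div_mul_cancel hN'.ne', one_mul]
      rw [show 2 * k + 2 = 2 * (k + 1) by ring, pow_mul, sq_abs, ← pow_mul,
        show 2 * (k + 1) = (2 * k + 1) + 1 by ring, pow_succ, mul_comm]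
      congr 1
      unfold centredOverlap overlap
      ring
    have hXB : X ≤ B := by
      calc X ≤ s * ∑ i : Fin N, B := by
            rw [hexp]
            refine mul_le_mul_of_nonneg_left (Finset.sum_le_sum fun i _ => ?_) hs0.le
            exact (le_abs_self _).trans (avg_centredOverlap_succ_le hp i k)
        _ = B := by
            rw [Finset.sum_const, Finset.card_univ, Fintype.card_fin, nsmul_eq_mul, ← mul_assoc, hs,
              one_div_mul_cancel hN'.ne', one_mul]
    have hp1 : s ^ (2 * k + 2) ≤ s ^ (k + 1) := pow_le_pow_of_le_one hs0.le hs1 (by omega)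
    have hp2 : s ^ (2 * k) ≤ s ^ k := pow_le_pow_of_le_one hs0.le hs1 (by omega)
    have hB' : B ≤ 3 / 4 * X + 1 / 4 * ((2 * k + 3) ^ (2 * k + 2) * s ^ (k + 1)) +
        2 * (2 * k + 1) * s * (3 * (K * s ^ k) + (2 * k + 1) ^ (2 * k) * s ^ k) := by
      rw [hB, mul_pow, mul_pow]
      have : 1 / 4 * (3 * X + (2 * k + 3 : ℝ) ^ (2 * k + 2) * s ^ (2 * k + 2)) ≤
        3 / 4 * X + 1 / 4 * ((2 * k + 3) ^ (2 * k + 2) * s ^ (k + 1)) := by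
        have : (2 * k + 3 : ℝ) ^ (2 * k + 2) * s ^ (2 * k + 2) ≤
          (2 * k + 3) ^ (2 * k + 2) * s ^ (k + 1) := by gcongr
        linarith
      gcongr
    show X ≤ _
    have e : 2 * (2 * k + 1) * s * (3 * (K * s ^ k) + (2 * k + 1) ^ (2 * k) * s ^ k) =
      2 * (2 * k + 1) * (3 * K + (2 * k + 1 : ℝ) ^ (2 * k)) * s ^ (k + 1) := by ring
    rw [e] at hB'
    have h5 : 0 ≤ (2 * k + 3 : ℝ) ^ (2 * k + 2) * s ^ (k + 1) := by positivity
    linarith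

end OverlapMoments

section PairSums

open LinModel

variable {N : ℕ} {ι κ : Type} [Fintype ι] [DecidableEq ι] [Fintype κ] [DecidableEq κ]

theorem exists_avg_scaled_cavOverlap_pow_le (k : ℕ) : ∃ K : ℝ, 0 ≤ K ∧
    ∀ (N : ℕ) (β h q : ℝ), CavityParams β h q → ∀ (i : Fin N) {κ : Type} [Fintype κ]
      [DecidableEq κ] (x y : κ), (skModel N β h).avg (fun τ : κ → Cfg N =>
        (Real.sqrt N * |cavOverlap q i x y τ|) ^ (2 * k)) ≤ K := by
  obtain ⟨K, hK, hK'⟩ := exists_avg_centredOverlap_pow_le k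
  refine ⟨3 * K + (2 * k + 1) ^ (2 * k) + 1, by positivity, fun N β h q hp i κ _ _ x y => ?_⟩
  have hN : 0 < N := i.pos
  have hN' : (0 : ℝ) < N := by exact_mod_cast hN
  by_cases hxy : x = y
  · simp only [cavOverlap, hxy, if_true, abs_zero, mul_zero, avg_const]
    refine (pow_le_one₀ le_rfl zero_le_one).trans ?_
    have : (0 : ℝ) ≤ 3 * K + (2 * k + 1) ^ (2 * k) := by positivity
    linarith
  · have h1 := avg_cavOverlap_pow_le (skModel N β h) q i hxy (2 * k)
    have h2 := hK' N β h q hN hp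
    have hs : Real.sqrt N ^ (2 * k) = (N : ℝ) ^ k := by rw [pow_mul, Real.sq_sqrt hN'.le]
    simp only [mul_pow, hs, avg_const_mul]
    have h3 : (N : ℝ) ^ k * (1 / N) ^ k = 1 := by
      rw [← mul_pow, mul_one_div_cancel hN'.ne', one_pow]
    have h4 : (1 / N : ℝ) ^ k ≤ 1 := by
      refine pow_le_one₀ (by positivity) ?_
      rw [div_le_one hN']
      exact_mod_cast hN
    calc _ ≤ (N : ℝ) ^ k * (3 * (K * (1 / N) ^ k) + ((2 * k + 1) * (1 / N)) ^ (2 * k)) := by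
          refine mul_le_mul_of_nonneg_left (h1.trans ?_) (by positivity)
          push_cast
          gcongr
      _ = 3 * K * ((N : ℝ) ^ k * (1 / N) ^ k) +
          (2 * k + 1) ^ (2 * k) * ((N : ℝ) ^ k * (1 / N) ^ k) * (1 / N) ^ k := by
          rw [mul_pow _ (1 / (N : ℝ)), pow_mul' (1 / (N : ℝ)), sq]
          ring
      _ ≤ 3 * K + (2 * k + 1) ^ (2 * k) * 1 * 1 := by
          rw [h3, mul_one]
          gcongr
      _ ≤ _ := by linarith

/-- The weighted sum of the differences of the spins of two replicas. -/
def pairSum (t : Fin N → ℝ) (x y : κ) (τ : κ → Cfg N) : ℝ :=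
  ∑ i, t i * (spin (τ x i) - spin (τ y i))

/-- The weighted sum of the differences of the spins of two replicas away from the site `i`. -/
def pairSumErase (t : Fin N → ℝ) (i : Fin N) (x y : κ) (τ : κ → Cfg N) : ℝ :=
  ∑ j ∈ Finset.univ.erase i, t j * (spin (τ x j) - spin (τ y j))

theorem pairSum_eq_add_erase (t : Fin N → ℝ) (i : Fin N) (x y : κ) (τ : κ → Cfg N) :
    pairSum t x y τ = pairSumErase t i x y τ + t i * (spin (τ x i) - spin (τ y i)) := by
  rw [pairSum, pairSumErase, Finset.sum_erase_add _ _ (Finset.mem_univ i)]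

theorem pairSumErase_update (t : Fin N → ℝ) (i : Fin N) (x y : κ) (τ : κ → Cfg N)
    (b : κ → Bool) :
    pairSumErase t i x y (fun l => Function.update (τ l) i (b l)) = pairSumErase t i x y τ := by
  unfold pairSumErase
  exact Finset.sum_congr rfl fun j hj => by
    simp only [Function.update_of_ne (Finset.ne_of_mem_erase hj)]

theorem abs_spin_sub_le (b c : Bool) : |spin b - spin c| ≤ 2 := by
  have := abs_sub (spin b) (spin c)
  rw [abs_spin, abs_spin] at this
  linarith

theorem abs_pairSumErase_sub_le (t : Fin N → ℝ) (i : Fin N) (x y : κ) (τ : κ → Cfg N) :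
    |pairSum t x y τ - pairSumErase t i x y τ| ≤ 2 * |t i| := by
  rw [pairSum_eq_add_erase t i, add_sub_cancel_left, abs_mul, mul_comm]
  exact mul_le_mul_of_nonneg_right (abs_spin_sub_le _ _) (abs_nonneg _)

theorem abs_le_one_of_sum_sq {t : Fin N → ℝ} (ht : ∑ i, t i ^ 2 = 1) (i : Fin N) : |t i| ≤ 1 := by
  rw [← sq_le_one_iff_abs_le_one, ← ht]
  exact Finset.single_le_sum (f := fun i => t i ^ 2) (fun j _ => sq_nonneg (t j))
    (Finset.mem_univ i)

theorem sum_abs_le_sqrt {t : Fin N → ℝ} (ht : ∑ i, t i ^ 2 = 1) :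
    ∑ i, |t i| ≤ Real.sqrt N := by
  refine Real.le_sqrt_of_sq_le ?_
  have := sq_sum_le_card_mul_sum_sq (s := Finset.univ) (f := fun i => |t i|)
  simpa [ht] using this

theorem abs_pairSumErase_le {t : Fin N → ℝ} (ht : ∑ i, t i ^ 2 = 1) (i : Fin N) (x y : κ)
    (τ : κ → Cfg N) : |pairSumErase t i x y τ| ≤ |pairSum t x y τ| + 2 := by
  have h1 := abs_pairSumErase_sub_le t i x y τ
  have h2 := abs_le_one_of_sum_sq ht i
  rw [abs_sub_comm] at h1
  linarith [abs_sub_abs_le_abs_sub (pairSumErase t i x y τ) (pairSum t x y τ)]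

theorem exists_avg_pairSum_succ_le (k : ℕ) : ∃ K : ℝ, 0 ≤ K ∧
    ∀ (N : ℕ) (β h q : ℝ) (t : Fin N → ℝ), CavityParams β h q → ∑ i, t i ^ 2 = 1 → ∀ i : Fin N,
      |(skModel N β h).avg (fun τ : Fin 2 → Cfg N => (spin (τ 0 i) - spin (τ 1 i)) *
        pairSum t 0 1 τ ^ (2 * k + 1))| ≤
        1 / Real.sqrt N * (1 / 4 * (skModel N β h).avg (fun τ : Fin 2 → Cfg N =>
          |pairSum t 0 1 τ| ^ (2 * k + 2)) + K) + |t i| * K * (1 +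
        (skModel N β h).avg (fun τ : Fin 2 → Cfg N => |pairSum t 0 1 τ| ^ (2 * k))) := by
  obtain ⟨K, hK, hK'⟩ := exists_avg_scaled_cavOverlap_pow_le (k + 1)
  refine ⟨(2 * (2 * k + 3)) ^ (2 * k + 2) + K +
    4 * (2 * k + 1) * (3 + (2 * (2 * k + 1)) ^ (2 * k)), by positivity,
    fun N β h q t hp ht i => ?_⟩
  have hN : (0 : ℝ) < N := by exact_mod_cast i.pos
  have hsN : 0 < Real.sqrt N := Real.sqrt_pos.2 hN
  set sk := skModel N β h with hsk
  set X := sk.avg (fun τ : Fin 2 → Cfg N => |pairSum t 0 1 τ| ^ (2 * k + 2)) with hX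
  set X' := sk.avg (fun τ : Fin 2 → Cfg N => |pairSum t 0 1 τ| ^ (2 * k)) with hX'
  have hX0 : 0 ≤ X := avg_nonneg _ fun τ => by positivity
  have hX'0 : 0 ≤ X' := avg_nonneg _ fun τ => by positivity
  set f : (Fin 2 → Cfg N) → ℝ := fun τ => (spin (τ 0 i) - spin (τ 1 i)) *
    pairSumErase t i 0 1 τ ^ (2 * k + 1) with hf
  have hcav : |sk.avg f| ≤ 1 / Real.sqrt N * (1 / 4 * X + (2 * (2 * k + 3)) ^ (2 * k + 2) + K) := by
    have hM : ∀ x y : Option (Option (Fin 2)), sk.avg (fun τ : Option (Option (Fin 2)) → Cfg N =>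
        |f fun l => τ (some (some l))| * |cavOverlap q i x y τ|) ≤
        2 / Real.sqrt N * (3 * X + (2 * (2 * k + 3)) ^ (2 * k + 2) + K) := by
      intro x y
      calc _ ≤ sk.avg (fun τ : Option (Option (Fin 2)) → Cfg N => 2 / Real.sqrt N *
            (3 * |pairSum t 0 1 fun l => τ (some (some l))| ^ (2 * k + 2) +
              (2 * (2 * k + 3)) ^ (2 * k + 2) +
              (Real.sqrt N * |cavOverlap q i x y τ|) ^ (2 * k + 2))) := by
            refine avg_mono _ fun τ => ?_
            set τ' : Fin 2 → Cfg N := fun l => τ (some (some l)) with hτ'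
            have h1 := abs_spin_sub_le (τ' 0 i) (τ' 1 i)
            have h2 := abs_pairSumErase_le ht i 0 1 τ'
            have h3 := pow_mul_le_add (abs_nonneg (pairSumErase t i 0 1 τ'))
              (by positivity : 0 ≤ Real.sqrt N * |cavOverlap q i x y τ|) (2 * k + 1)
            have h4 := add_pow_le_three_mul (abs_nonneg (pairSum t 0 1 τ')) zero_le_two (2 * k + 2)
            have h5 : |pairSumErase t i 0 1 τ'| ^ (2 * k + 2) ≤
              (|pairSum t 0 1 τ'| + 2) ^ (2 * k + 2) := by gcongr
            push_cast at h4
            rw [show (2 * (k : ℝ) + 2 + 1) * 2 = 2 * (2 * k + 3) by ring] at h4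
            simp only [hf, abs_mul, abs_pow]
            calc _ ≤ 2 * |pairSumErase t i 0 1 τ'| ^ (2 * k + 1) * |cavOverlap q i x y τ| := by
                  gcongr
              _ = 2 / Real.sqrt N * (|pairSumErase t i 0 1 τ'| ^ (2 * k + 1) *
                  (Real.sqrt N * |cavOverlap q i x y τ|)) := by field_simp
              _ ≤ _ := by
                  gcongr
                  linarith
        _ ≤ _ := by
            have h1 : sk.avg (fun τ : Option (Option (Fin 2)) → Cfg N =>
              |pairSum t 0 1 fun l => τ (some (some l))| ^ (2 * k + 2)) = X :=
              avg_ext sk fun τ : Fin 2 → Cfg N => |pairSum t 0 1 τ| ^ (2 * k + 2)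
            have h2 := hK' N β h q hp i x y
            rw [show 2 * (k + 1) = 2 * k + 2 by ring] at h2
            rw [avg_const_mul, avg_add, avg_add, avg_const_mul, avg_const, h1]
            gcongr
    have hpi := Real.pi_pos
    have h1 := abs_cavModel_avg_sub_le β h hp.nonneg hp.le_one i le_rfl (by positivity)
      (by positivity) (le_refl (Real.pi / 2)) f hM
    rw [cavModel_zero] at h1
    have h2 : (cavModel β h q i (Real.pi / 2)).avg f = 0 := by
      have e : (siteModel β h q).avg (fun v : Fin 2 → Bool => spin (v 0) - spin (v 1)) = 0 := by
        rw [avg_sub, sub_eq_zero]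
        exact avg_comp (siteModel β h q) ![0] (fun a b _ => Subsingleton.elim a b)
          (fun v : Fin 1 → Bool => spin (v 0)) |>.trans (avg_comp (siteModel β h q) ![1]
          (fun a b _ => Subsingleton.elim a b) (fun v : Fin 1 → Bool => spin (v 0))).symm
      rw [hf, avg_decouple β h q i (fun v : Fin 2 → Bool => spin (v 0) - spin (v 1))
        (f := fun τ => pairSumErase t i 0 1 τ ^ (2 * k + 1))
        (fun τ b => by rw [pairSumErase_update]), e, zero_mul]
    rw [h2, sub_zero, Fintype.card_fin] at h1
    refine h1.trans ?_
    have h3 := hp.sq_mul_cavConst_two_le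
    have h4 : (0 : ℝ) ≤ (2 * (2 * k + 3)) ^ (2 * k + 2) := by positivity
    calc _ ≤ 1 / 100 * (2 / Real.sqrt N * (3 * X + (2 * (2 * k + 3)) ^ (2 * k + 2) + K)) := by
          gcongr
      _ = 1 / Real.sqrt N * (1 / 50 * (3 * X + (2 * (2 * k + 3)) ^ (2 * k + 2) + K)) := by ring
      _ ≤ _ := by
          gcongr
          linarith
  have hdiff : |sk.avg (fun τ : Fin 2 → Cfg N => (spin (τ 0 i) - spin (τ 1 i)) *
        pairSum t 0 1 τ ^ (2 * k + 1)) - sk.avg f| ≤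
      |t i| * (4 * (2 * k + 1)) * (3 * X' + (2 * (2 * k + 1)) ^ (2 * k)) := by
    rw [← avg_sub, ← avg_const (ι := Fin 2) sk ((2 * (2 * k + 1) : ℝ) ^ (2 * k)), hX',
      ← avg_const_mul, ← avg_add, ← avg_const_mul]
    refine abs_avg_le _ fun τ => ?_
    rw [hf, ← mul_sub, abs_mul]
    have h1 := abs_pow_sub_pow_le (pairSum t 0 1 τ) (pairSumErase t i 0 1 τ) (2 * k + 1)
    have h2 := abs_pairSumErase_sub_le t i 0 1 τ
    have h3 : max |pairSum t 0 1 τ| |pairSumErase t i 0 1 τ| ≤ |pairSum t 0 1 τ| + 2 :=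
      max_le (by linarith) (abs_pairSumErase_le ht i 0 1 τ)
    have h4 := add_pow_le_three_mul (abs_nonneg (pairSum t 0 1 τ)) zero_le_two (2 * k)
    push_cast at h4
    rw [mul_comm _ (2 : ℝ)] at h4
    calc _ ≤ 2 * (2 * |t i| * ((2 * k + 1 : ℕ) : ℝ) *
          (|pairSum t 0 1 τ| + 2) ^ (2 * k + 1 - 1)) := by
          refine mul_le_mul (abs_spin_sub_le _ _) (h1.trans ?_) (abs_nonneg _) (by norm_num)
          gcongr
      _ ≤ 2 * (2 * |t i| * ((2 * k + 1 : ℕ) : ℝ) * (3 * |pairSum t 0 1 τ| ^ (2 * k) +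
          (2 * (2 * k + 1)) ^ (2 * k))) := by
          rw [Nat.add_sub_cancel]
          gcongr
      _ = _ := by push_cast; ring
  have h1 := abs_sub_abs_le_abs_sub (sk.avg (fun τ : Fin 2 → Cfg N => (spin (τ 0 i) - spin (τ 1 i)) *
        pairSum t 0 1 τ ^ (2 * k + 1))) (sk.avg f)
  set P : ℝ := (2 * (2 * k + 3)) ^ (2 * k + 2)
  set P' : ℝ := (2 * (2 * k + 1)) ^ (2 * k)
  have hP : 0 ≤ P := by positivity
  have hP' : 0 ≤ P' := by positivity
  set T : ℝ := 4 * (2 * k + 1) with hT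
  have hT0 : 0 ≤ T := by positivity
  have h2 : 1 / Real.sqrt N * (1 / 4 * X + P + K) ≤
      1 / Real.sqrt N * (1 / 4 * X + (P + K + T * (3 + P'))) := by
    have : 0 ≤ T * (3 + P') := by positivity
    exact mul_le_mul_of_nonneg_left (by linarith) (by positivity)
  have h3 : |t i| * T * (3 * X' + P') ≤ |t i| * (P + K + T * (3 + P')) * (1 + X') := by
    have : T * (3 * X' + P') ≤ (P + K + T * (3 + P')) * (1 + X') := by
      have e1 : 0 ≤ (P + K) * (1 + X') := by positivity
      have e2 : 0 ≤ T * (3 + P' * X') := by positivity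
      nlinarith
    rw [mul_assoc |t i| T, mul_assoc |t i| (_ + _)]
    exact mul_le_mul_of_nonneg_left this (abs_nonneg _)
  linarith

theorem exists_avg_abs_pairSum_pow_le (k : ℕ) : ∃ K : ℝ, 0 ≤ K ∧
    ∀ (N : ℕ) (β h q : ℝ) (t : Fin N → ℝ), CavityParams β h q → ∑ i, t i ^ 2 = 1 →
      (skModel N β h).avg (fun τ : Fin 2 → Cfg N => |pairSum t 0 1 τ| ^ (2 * k)) ≤ K := by
  induction k with
  | zero => exact ⟨1, zero_le_one, fun N β h q t _ _ => by simp [avg_const]⟩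
  | succ k ih =>
    obtain ⟨K, hK, ih⟩ := ih
    obtain ⟨L, hL, hL'⟩ := exists_avg_pairSum_succ_le k
    refine ⟨4 / 3 * (L + L * (1 + K)), by positivity, fun N β h q t hp ht => ?_⟩
    set sk := skModel N β h with hsk
    set X := sk.avg (fun τ : Fin 2 → Cfg N => |pairSum t 0 1 τ| ^ (2 * k + 2)) with hX
    have hX0 : 0 ≤ X := avg_nonneg _ fun τ => by positivity
    have hexp : X = ∑ i : Fin N, t i * sk.avg (fun τ : Fin 2 → Cfg N =>
        (spin (τ 0 i) - spin (τ 1 i)) * pairSum t 0 1 τ ^ (2 * k + 1)) := by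
      simp_rw [← avg_const_mul]
      rw [← avg_sum, hX]
      congr 1
      funext τ
      rw [show 2 * k + 2 = 2 * (k + 1) by ring, pow_mul, sq_abs, ← pow_mul,
        show 2 * (k + 1) = (2 * k + 1) + 1 by ring, pow_succ, mul_comm]
      change (∑ i, t i * (spin (τ 0 i) - spin (τ 1 i))) * _ = _
      rw [Finset.sum_mul]
      exact Finset.sum_congr rfl fun i _ => by ring
    have hbound : ∀ i : Fin N, t i * sk.avg (fun τ : Fin 2 → Cfg N =>
        (spin (τ 0 i) - spin (τ 1 i)) * pairSum t 0 1 τ ^ (2 * k + 1)) ≤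
        |t i| * (1 / Real.sqrt N * (1 / 4 * X + L)) + t i ^ 2 * (L * (1 + K)) := by
      intro i
      refine (le_abs_self _).trans ?_
      rw [abs_mul]
      refine (mul_le_mul_of_nonneg_left (hL' N β h q t hp ht i) (abs_nonneg _)).trans ?_
      rw [mul_add, ← sq_abs (t i), sq, mul_assoc |t i| |t i|, ← mul_assoc |t i| L]
      have := ih N β h q t hp ht
      gcongr
    have hN : 0 < Real.sqrt N := by
      refine Real.sqrt_pos.2 (Nat.cast_pos.2 (Nat.pos_of_ne_zero ?_))
      rintro rfl
      simp at ht
    have h1 : X ≤ (∑ i, |t i|) * (1 / Real.sqrt N * (1 / 4 * X + L)) + L * (1 + K) := by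
      calc X ≤ ∑ i, (|t i| * (1 / Real.sqrt N * (1 / 4 * X + L)) + t i ^ 2 * (L * (1 + K))) := by
            conv_lhs => rw [hexp]
            exact Finset.sum_le_sum fun i _ => hbound i
        _ = _ := by rw [Finset.sum_add_distrib, ← Finset.sum_mul, ← Finset.sum_mul, ht, one_mul]
    have h2 : (∑ i, |t i|) * (1 / Real.sqrt N * (1 / 4 * X + L)) ≤ 1 / 4 * X + L := by
      calc _ ≤ Real.sqrt N * (1 / Real.sqrt N * (1 / 4 * X + L)) := by
            gcongr
            exact sum_abs_le_sqrt ht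
        _ = _ := by field_simp
    show X ≤ _
    linarith

end PairSums

section Expansion

open LinModel

theorem abs_prod_add_sub_prod_le {R : Type} [DecidableEq R] (s : Finset R) (x y B : R → ℝ) {η : ℝ}
    (hη : 0 ≤ η) (hy : ∀ r, |y r| ≤ η) (hx : ∀ r, |x r| ≤ B r) (hxy : ∀ r, |x r + y r| ≤ B r)
    (hB : ∀ r, 1 ≤ B r) :
    |∏ r ∈ s, (x r + y r) - ∏ r ∈ s, x r| ≤ η * s.card * ∏ r ∈ s, B r := by
  induction s using Finset.induction_on with
  | empty => simp
  | insert a s ha ih =>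
    rw [Finset.prod_insert ha, Finset.prod_insert ha, Finset.prod_insert ha,
      Finset.card_insert_of_notMem ha]
    set P := ∏ r ∈ s, (x r + y r)
    set X := ∏ r ∈ s, x r with hX
    set Y := ∏ r ∈ s, B r with hY
    have hXY : |X| ≤ Y := by
      rw [hX, hY, Finset.abs_prod]
      exact Finset.prod_le_prod (fun r _ => abs_nonneg _) fun r _ => hx r
    have hY0 : 0 ≤ Y := (abs_nonneg _).trans hXY
    have hBa := hB a
    calc |(x a + y a) * P - x a * X| = |(x a + y a) * (P - X) + y a * X| := by congr 1; ring
      _ ≤ |x a + y a| * |P - X| + |y a| * |X| := by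
          rw [← abs_mul, ← abs_mul]; exact abs_add_le _ _
      _ ≤ B a * (η * s.card * Y) + η * (B a * Y) := by
          have h1 : Y ≤ B a * Y := le_mul_of_one_le_left hY0 hBa
          have h2 := hxy a
          have h3 := hy a
          have h4 := hXY.trans h1
          gcongr
      _ = _ := by push_cast; ring

theorem abs_prod_add_sub_prod_sub_sum_le {R : Type} [DecidableEq R] (s : Finset R)
    (x y B : R → ℝ) {η : ℝ}
    (hη : 0 ≤ η) (hy : ∀ r, |y r| ≤ η) (hx : ∀ r, |x r| ≤ B r) (hxy : ∀ r, |x r + y r| ≤ B r)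
    (hB : ∀ r, 1 ≤ B r) :
    |∏ r ∈ s, (x r + y r) - ∏ r ∈ s, x r - ∑ r ∈ s, y r * ∏ j ∈ s.erase r, x j| ≤
      η ^ 2 * s.card ^ 2 * ∏ r ∈ s, B r := by
  induction s using Finset.induction_on with
  | empty => simp
  | insert a s ha ih =>
    have h0 := abs_prod_add_sub_prod_le s x y B hη hy hx hxy hB
    have hsum : ∑ r ∈ s, y r * ∏ j ∈ (insert a s).erase r, x j =
        x a * ∑ r ∈ s, y r * ∏ j ∈ s.erase r, x j := by
      rw [Finset.mul_sum]
      refine Finset.sum_congr rfl fun r hr => ?_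
      have : r ≠ a := fun h => ha (h ▸ hr)
      rw [Finset.erase_insert_of_ne this.symm, Finset.prod_insert (by simp [ha])]
      ring
    rw [Finset.prod_insert ha, Finset.prod_insert ha, Finset.prod_insert ha,
      Finset.card_insert_of_notMem ha, Finset.sum_insert ha, Finset.erase_insert ha, hsum]
    set P := ∏ r ∈ s, (x r + y r)
    set X := ∏ r ∈ s, x r with hX
    set Y := ∏ r ∈ s, B r with hY
    set Z := ∑ r ∈ s, y r * ∏ j ∈ s.erase r, x j
    have hY0 : 0 ≤ Y := Finset.prod_nonneg fun r _ => zero_le_one.trans (hB r)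
    have hBa := hB a
    calc |(x a + y a) * P - x a * X - (y a * X + x a * Z)| =
          |x a * (P - X - Z) + y a * (P - X)| := by congr 1; ring
      _ ≤ |x a| * |P - X - Z| + |y a| * |P - X| := by
          rw [← abs_mul, ← abs_mul]; exact abs_add_le _ _
      _ ≤ B a * (η ^ 2 * s.card ^ 2 * Y) + η * (η * s.card * (B a * Y)) := by
          have h1 : Y ≤ B a * Y := le_mul_of_one_le_left hY0 hBa
          have h2 := hx a
          have h3 := hy a
          have h4 : |P - X| ≤ η * s.card * (B a * Y) := h0.trans (by gcongr)
          gcongr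
      _ ≤ _ := by
          have : 0 ≤ η ^ 2 * (s.card + 1) * (B a * Y) := by positivity
          push_cast
          linarith

variable {N : ℕ} {ι κ R : Type} [Fintype ι] [DecidableEq ι] [Fintype κ] [DecidableEq κ]
  [Fintype R]

/-- A weight dominating products of pair sums. -/
def pairWeight (t : Fin N → ℝ) (p m : R → κ) (τ : κ → Cfg N) : ℝ :=
  ∏ r, (|pairSum t (p r) (m r) τ| + 3)

theorem one_le_pairWeight (t : Fin N → ℝ) (p m : R → κ) (τ : κ → Cfg N) :
    1 ≤ pairWeight t p m τ := by
  unfold pairWeight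
  rw [← Finset.prod_const_one (s := (Finset.univ : Finset R))]
  refine Finset.prod_le_prod (fun _ _ => zero_le_one) fun r _ => ?_
  have := abs_nonneg (pairSum t (p r) (m r) τ)
  linarith

/-- A uniform bound for weighted averages of products of two overlaps. -/
def WeightBound (R : Type) [Fintype R] (β h q : ℝ) (t : Fin N → ℝ) (i : Fin N) (K : ℝ) : Prop :=
  0 ≤ K ∧ ∀ (κ : Type) [Fintype κ] [DecidableEq κ] (p m : R → κ), (∀ r, p r ≠ m r) →
    ∀ x y z w : κ, (skModel N β h).avg (fun τ : κ → Cfg N => pairWeight t p m τ *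
      (1 + Real.sqrt N * |cavOverlap q i x y τ|) * (1 + Real.sqrt N * |cavOverlap q i z w τ|)) ≤ K

theorem prod_le_one_add_sum_pow {a : R → ℝ} (ha : ∀ r, 0 ≤ a r) :
    ∏ r, a r ≤ 1 + ∑ r, a r ^ Fintype.card R := by
  rcases isEmpty_or_nonempty R with hR | hR
  · simp
  · obtain ⟨r, -, hr⟩ := Finset.exists_max_image Finset.univ a Finset.univ_nonempty
    have h1 : ∏ r, a r ≤ a r ^ Fintype.card R := by
      rw [Fintype.card, ← Finset.prod_const]
      exact Finset.prod_le_prod (fun j _ => ha j) fun j hj => hr j hj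
    have h2 : a r ^ Fintype.card R ≤ ∑ r, a r ^ Fintype.card R :=
      Finset.single_le_sum (f := fun r => a r ^ Fintype.card R)
        (fun j _ => pow_nonneg (ha j) _) (Finset.mem_univ r)
    linarith

theorem exists_weightBound (R : Type) [Fintype R] : ∃ K : ℝ,
    ∀ (N : ℕ) (β h q : ℝ) (t : Fin N → ℝ) (i : Fin N), CavityParams β h q → ∑ i, t i ^ 2 = 1 →
      WeightBound R β h q t i K := by
  classical
  set n := Fintype.card R with hn
  obtain ⟨K₁, hK₁, hK₁'⟩ := exists_avg_abs_pairSum_pow_le n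
  obtain ⟨K₂, hK₂, hK₂'⟩ := exists_avg_scaled_cavOverlap_pow_le 2
  refine ⟨1 + n * (3 * K₁ + ((2 * n + 1) * 3) ^ (2 * n)) +
    ((3 * K₂ + 5 ^ 4) + (3 * K₂ + 5 ^ 4)), fun N β h q t i hp ht => ⟨by positivity, ?_⟩⟩
  intro κ _ _ p m hpm x y z w
  set sk := skModel N β h with hsk
  have hQ : ∀ x y : κ, sk.avg (fun τ : κ → Cfg N =>
      (1 + Real.sqrt N * |cavOverlap q i x y τ|) ^ 4) ≤ 3 * K₂ + 5 ^ 4 := by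
    intro x y
    calc _ ≤ sk.avg (fun τ : κ → Cfg N =>
          3 * (Real.sqrt N * |cavOverlap q i x y τ|) ^ (2 * 2) + 5 ^ 4) := by
          refine avg_mono _ fun τ => ?_
          have := add_pow_le_three_mul (by positivity : 0 ≤ Real.sqrt N * |cavOverlap q i x y τ|)
            zero_le_one 4
          norm_num at this ⊢
          rw [add_comm]
          exact this
      _ ≤ _ := by
          rw [avg_add, avg_const_mul, avg_const]
          have := hK₂' N β h q hp i x y
          gcongr
  have hS : ∀ r, sk.avg (fun τ : κ → Cfg N => (|pairSum t (p r) (m r) τ| + 3) ^ (2 * n)) ≤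
      3 * K₁ + ((2 * n + 1) * 3) ^ (2 * n) := by
    intro r
    calc _ ≤ sk.avg (fun τ : κ → Cfg N =>
          3 * |pairSum t (p r) (m r) τ| ^ (2 * n) + ((2 * n + 1) * 3) ^ (2 * n)) := by
          refine avg_mono _ fun τ => ?_
          have := add_pow_le_three_mul (abs_nonneg (pairSum t (p r) (m r) τ))
            (by norm_num : (0 : ℝ) ≤ 3) (2 * n)
          push_cast at this
          exact this
      _ ≤ _ := by
          rw [avg_add, avg_const_mul, avg_const]
          have : sk.avg (fun τ : κ → Cfg N => |pairSum t (p r) (m r) τ| ^ (2 * n)) ≤ K₁ :=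
            (avg_pair sk (hpm r) fun σ σ' : Cfg N =>
              |∑ i, t i * (spin (σ i) - spin (σ' i))| ^ (2 * n)).trans_le (hK₁' N β h q t hp ht)
          gcongr
  calc _ ≤ sk.avg (fun τ : κ → Cfg N =>
        (1 + ∑ r, (|pairSum t (p r) (m r) τ| + 3) ^ (2 * n)) +
          ((1 + Real.sqrt N * |cavOverlap q i x y τ|) ^ 4 +
            (1 + Real.sqrt N * |cavOverlap q i z w τ|) ^ 4)) := by
        refine avg_mono _ fun τ => ?_
        have h1 := prod_le_one_add_sum_pow (a := fun r => (|pairSum t (p r) (m r) τ| + 3) ^ 2)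
          fun r => by positivity
        simp only [← pow_mul, Finset.prod_pow] at h1
        rw [← pairWeight] at h1
        refine le_trans ?_ (add_le_add_left h1 _)
        set a := pairWeight t p m τ
        set b := 1 + Real.sqrt N * |cavOverlap q i x y τ|
        set c := 1 + Real.sqrt N * |cavOverlap q i z w τ|
        nlinarith [sq_nonneg (a - b * c), sq_nonneg (b ^ 2 - c ^ 2), sq_nonneg a,
          sq_nonneg (b * c)]
    _ ≤ _ := by
        rw [avg_add, avg_add, avg_add, avg_const, avg_sum]
        have h1 := Finset.sum_le_sum fun r (_ : r ∈ Finset.univ) => hS r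
        rw [Finset.sum_const, Finset.card_univ, ← hn, nsmul_eq_mul] at h1
        have h2 := hQ x y
        have h3 := hQ z w
        linarith

/-- The product of the pair sums over the set `s`. -/
def pairProd (t : Fin N → ℝ) (p m : R → κ) (s : Finset R) (τ : κ → Cfg N) : ℝ :=
  ∏ r ∈ s, pairSum t (p r) (m r) τ

/-- The product over the set `s` of the pair sums away from the site `i`. -/
def pairProdErase (t : Fin N → ℝ) (i : Fin N) (p m : R → κ) (s : Finset R) (τ : κ → Cfg N) : ℝ :=
  ∏ r ∈ s, pairSumErase t i (p r) (m r) τ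

theorem pairProdErase_update (t : Fin N → ℝ) (i : Fin N) (p m : R → κ) (s : Finset R)
    (τ : κ → Cfg N) (b : κ → Bool) :
    pairProdErase t i p m s (fun l => Function.update (τ l) i (b l)) =
      pairProdErase t i p m s τ := by
  unfold pairProdErase
  simp only [pairSumErase_update]

theorem prod_weight_le (t : Fin N → ℝ) (p m : R → κ) (s : Finset R) (τ : κ → Cfg N) :
    ∏ r ∈ s, (|pairSum t (p r) (m r) τ| + 3) ≤ pairWeight t p m τ := by
  refine Finset.prod_le_prod_of_subset_of_one_le (Finset.subset_univ s)
    (fun r _ => by positivity) fun r _ _ => ?_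
  have := abs_nonneg (pairSum t (p r) (m r) τ)
  linarith

theorem abs_pairProdErase_le {t : Fin N → ℝ} (ht : ∑ i, t i ^ 2 = 1) (i : Fin N) (p m : R → κ)
    (s : Finset R) (τ : κ → Cfg N) : |pairProdErase t i p m s τ| ≤ pairWeight t p m τ := by
  refine le_trans ?_ (prod_weight_le t p m s τ)
  rw [pairProdErase, Finset.abs_prod]
  refine Finset.prod_le_prod (fun _ _ => abs_nonneg _) fun r _ => ?_
  exact (abs_pairSumErase_le ht i _ _ τ).trans (by linarith)

theorem abs_pairProd_sub_le [DecidableEq R] {t : Fin N → ℝ} (ht : ∑ i, t i ^ 2 = 1) (i : Fin N) (p m : R → κ)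
    (s : Finset R) (τ : κ → Cfg N) : |pairProd t p m s τ - pairProdErase t i p m s τ| ≤
      2 * |t i| * Fintype.card R * pairWeight t p m τ := by
  have h1 := abs_prod_add_sub_prod_le s (fun r => pairSumErase t i (p r) (m r) τ)
    (fun r => t i * (spin (τ (p r) i) - spin (τ (m r) i)))
    (fun r => |pairSum t (p r) (m r) τ| + 3) (η := 2 * |t i|) (by positivity)
    (fun r => by rw [abs_mul, mul_comm]; gcongr; exact abs_spin_sub_le _ _)
    (fun r => (abs_pairSumErase_le ht i _ _ τ).trans (by linarith))
    (fun r => by rw [← pairSum_eq_add_erase]; linarith)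
    (fun r => by have := abs_nonneg (pairSum t (p r) (m r) τ); linarith)
  simp only [← pairSum_eq_add_erase] at h1
  refine h1.trans ?_
  have h2 := prod_weight_le t p m s τ
  have h3 : (s.card : ℝ) ≤ Fintype.card R := by exact_mod_cast s.card_le_univ
  gcongr

theorem abs_pairProd_sub_sub_sum_le [DecidableEq R] {t : Fin N → ℝ} (ht : ∑ i, t i ^ 2 = 1) (i : Fin N)
    (p m : R → κ) (τ : κ → Cfg N) :
    |pairProd t p m Finset.univ τ - pairProdErase t i p m Finset.univ τ -
      ∑ r, t i * (spin (τ (p r) i) - spin (τ (m r) i)) *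
        pairProdErase t i p m (Finset.univ.erase r) τ| ≤
      (2 * |t i|) ^ 2 * Fintype.card R ^ 2 * pairWeight t p m τ := by
  have h1 := abs_prod_add_sub_prod_sub_sum_le Finset.univ
    (fun r => pairSumErase t i (p r) (m r) τ)
    (fun r => t i * (spin (τ (p r) i) - spin (τ (m r) i)))
    (fun r => |pairSum t (p r) (m r) τ| + 3) (η := 2 * |t i|) (by positivity)
    (fun r => by rw [abs_mul, mul_comm]; gcongr; exact abs_spin_sub_le _ _)
    (fun r => (abs_pairSumErase_le ht i _ _ τ).trans (by linarith))
    (fun r => by rw [← pairSum_eq_add_erase]; linarith)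
    (fun r => by have := abs_nonneg (pairSum t (p r) (m r) τ); linarith)
  simp only [← pairSum_eq_add_erase] at h1
  exact h1

end Expansion

section CavityExpansion

open LinModel

theorem cavConst_le {n : ℕ} {β : ℝ} (hβ : |β| ≤ 1) : cavConst n β ≤ cavConst n 1 := by
  have : β ^ 2 ≤ 1 ^ 2 := by rw [one_pow, ← sq_abs]; exact pow_le_one₀ (abs_nonneg _) hβ
  unfold cavConst
  gcongr

theorem CavityParams.sq_mul_cavConst_le {β h q : ℝ} (hp : CavityParams β h q) (n : ℕ) :
    β ^ 2 * cavConst n β ≤ cavConst n 1 := by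
  have h1 := cavConst_le (n := n) hp.abs_le_one
  have h2 : β ^ 2 ≤ 1 := hp.sq_le.trans (by norm_num)
  have h3 := cavConst_nonneg n β
  nlinarith

variable {N : ℕ} {ι κ R : Type} [Fintype ι] [DecidableEq ι] [Fintype κ] [DecidableEq κ]
  [Fintype R]

/-- The centred overlap, set to zero on the diagonal. -/
def offOverlap (q : ℝ) (x y : κ) (τ : κ → Cfg N) : ℝ :=
  if x = y then 0 else centredOverlap q x y τ

theorem abs_offOverlap_sub_le (q : ℝ) (i : Fin N) (x y : κ) (τ : κ → Cfg N) :
    |cavOverlap q i x y τ - offOverlap q x y τ| ≤ 1 / N := by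
  unfold offOverlap
  split_ifs with hxy
  · simp [cavOverlap, hxy]
  · rw [abs_sub_comm]
    exact abs_centredOverlap_sub_le q i hxy τ

theorem abs_pairProd_le (t : Fin N → ℝ) (p m : R → κ) (s : Finset R) (τ : κ → Cfg N) :
    |pairProd t p m s τ| ≤ pairWeight t p m τ := by
  refine le_trans ?_ (prod_weight_le t p m s τ)
  rw [pairProd, Finset.abs_prod]
  exact Finset.prod_le_prod (fun _ _ => abs_nonneg _) fun r _ => by linarith

theorem abs_cavOverlap_le_scaled (q : ℝ) (i : Fin N) (x y : κ) (τ : κ → Cfg N) :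
    |cavOverlap q i x y τ| ≤ 1 / Real.sqrt N * (1 + Real.sqrt N * |cavOverlap q i x y τ|) := by
  have hN : (0 : ℝ) < Real.sqrt N := Real.sqrt_pos.2 (by exact_mod_cast i.pos)
  rw [mul_add, ← mul_assoc, one_div_mul_cancel hN.ne', one_mul]
  have : 0 ≤ 1 / Real.sqrt N * 1 := by positivity
  linarith

namespace WeightBound

variable {β h q K : ℝ} {t : Fin N → ℝ} {i : Fin N}

theorem avg_weight_le (hW : WeightBound R β h q t i K) {p m : R → κ} (hpm : ∀ r, p r ≠ m r) :
    (skModel N β h).avg (fun τ : κ → Cfg N => pairWeight t p m τ) ≤ K := by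
  rcases isEmpty_or_nonempty R with hR | ⟨⟨r⟩⟩
  · have h1 := hW.2 (Fin 1) (fun r => isEmptyElim r) (fun r => isEmptyElim r)
      (fun r => isEmptyElim r) 0 0 0 0
    simpa [pairWeight, cavOverlap, avg_const] using h1
  · have h1 := hW.2 κ p m hpm (p r) (p r) (p r) (p r)
    simpa [cavOverlap] using h1

theorem avg_weight_mul_le (hW : WeightBound R β h q t i K) {p m : R → κ} (hpm : ∀ r, p r ≠ m r)
    (x y : κ) : (skModel N β h).avg (fun τ : κ → Cfg N => pairWeight t p m τ *
      (1 + Real.sqrt N * |cavOverlap q i x y τ|)) ≤ K := by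
  have h1 := hW.2 κ p m hpm x y x x
  simpa [cavOverlap] using h1

theorem abs_avg_mul_pairProdErase_sub_le (hW : WeightBound R β h q t i K)
    (hp : CavityParams β h q) (ht : ∑ i, t i ^ 2 = 1) {p m : R → ι} (hpm : ∀ r, p r ≠ m r)
    {φ : (ι → Bool) → ℝ} {c : ℝ} (hc : 0 ≤ c) (hφ : ∀ v, |φ v| ≤ c) (s : Finset R) :
    |(skModel N β h).avg (fun τ : ι → Cfg N => φ (fun l => τ l i) * pairProdErase t i p m s τ) -
      (siteModel β h q).avg φ *
        (cavModel β h q i (Real.pi / 2)).avg (fun τ => pairProdErase t i p m s τ)| ≤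
      cavConst (Fintype.card ι) 1 * (c * K) * (1 / Real.sqrt N) := by
  have hpi := Real.pi_pos
  have h1 := abs_cavModel_avg_sub_le β h hp.nonneg hp.le_one i le_rfl (by positivity)
    (by positivity) (le_refl (Real.pi / 2))
    (fun τ : ι → Cfg N => φ (fun l => τ l i) * pairProdErase t i p m s τ)
    (M := c * (1 / Real.sqrt N) * K) (fun x y => by
      refine le_trans ?_ (mul_le_mul_of_nonneg_left (hW.avg_weight_mul_le
        (p := fun r => some (some (p r))) (m := fun r => some (some (m r)))
        (fun r h => hpm r (some_some_injective h)) x y) (by positivity))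
      rw [← avg_const_mul]
      refine avg_mono _ fun τ => ?_
      have h2 := abs_cavOverlap_le_scaled q i x y τ
      have h3 := abs_pairProdErase_le ht i p m s (fun l => τ (some (some l)))
      change _ ≤ pairWeight t (fun r => some (some (p r))) (fun r => some (some (m r))) τ at h3
      have h4 := hφ fun l => τ (some (some l)) i
      have h5 : 0 ≤ pairWeight t (fun r => some (some (p r))) (fun r => some (some (m r))) τ :=
        (abs_nonneg _).trans h3
      rw [abs_mul]
      calc _ ≤ c * pairWeight t (fun r => some (some (p r))) (fun r => some (some (m r))) τ *
            (1 / Real.sqrt N * (1 + Real.sqrt N * |cavOverlap q i x y τ|)) := by gcongr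
        _ = _ := by ring)
  rw [cavModel_zero, avg_decouple β h q i φ (fun τ b => pairProdErase_update t i p m s τ b)] at h1
  refine h1.trans ?_
  have h2 := hp.sq_mul_cavConst_le (Fintype.card ι)
  have h3 := hW.1
  calc _ ≤ cavConst (Fintype.card ι) 1 * (c * (1 / Real.sqrt N) * K) := by gcongr
    _ = _ := by ring

theorem abs_avg_pairProd_sub_le (hW : WeightBound R β h q t i K) (ht : ∑ i, t i ^ 2 = 1)
    {p m : R → ι} (hpm : ∀ r, p r ≠ m r) (s : Finset R) :
    |(skModel N β h).avg (fun τ : ι → Cfg N => pairProd t p m s τ) -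
      (skModel N β h).avg (fun τ : ι → Cfg N => pairProdErase t i p m s τ)| ≤
      2 * |t i| * Fintype.card R * K := by
  classical
  rw [← avg_sub]
  refine (abs_avg_le _ fun τ => abs_pairProd_sub_le ht i p m s τ).trans ?_
  rw [avg_const_mul]
  have := hW.avg_weight_le hpm
  gcongr

theorem abs_avg_mul_pairProdErase_sub_avg_le (hW : WeightBound R β h q t i K)
    (hp : CavityParams β h q) (ht : ∑ i, t i ^ 2 = 1) {p m : R → ι} (hpm : ∀ r, p r ≠ m r)
    {φ : (ι → Bool) → ℝ} (hφ : ∀ v, |φ v| ≤ 4) (s : Finset R) :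
    |(skModel N β h).avg (fun τ : ι → Cfg N => φ (fun l => τ l i) * pairProdErase t i p m s τ) -
      (siteModel β h q).avg φ *
        (skModel N β h).avg (fun τ : ι → Cfg N => pairProd t p m s τ)| ≤
      8 * K * (cavConst (Fintype.card ι) 1 + Fintype.card R) * (|t i| + 1 / Real.sqrt N) := by
  have h1 := hW.abs_avg_mul_pairProdErase_sub_le hp ht hpm (by norm_num : (0 : ℝ) ≤ 4) hφ s
  have h2 := hW.abs_avg_mul_pairProdErase_sub_le hp ht hpm (φ := fun _ => 1) zero_le_one
    (fun _ => by simp) s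
  have h3 := hW.abs_avg_pairProd_sub_le ht hpm s
  simp only [avg_const, one_mul] at h2
  have h4 : |(siteModel β h q).avg φ| ≤ 4 := abs_avg_le_const _ hφ
  have hC := cavConst_nonneg (Fintype.card ι) 1
  have hK := hW.1
  set e := (siteModel β h q).avg φ
  set C := cavConst (Fintype.card ι) 1
  set a := (skModel N β h).avg (fun τ : ι → Cfg N => φ (fun l => τ l i) * pairProdErase t i p m s τ)
  set b := (cavModel β h q i (Real.pi / 2)).avg (fun τ => pairProdErase t i p m s τ)
  set c := (skModel N β h).avg (fun τ : ι → Cfg N => pairProdErase t i p m s τ)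
  set d := (skModel N β h).avg (fun τ : ι → Cfg N => pairProd t p m s τ)
  calc |a - e * d| = |(a - e * b) + e * ((b - c) + (c - d))| := by congr 1; ring
    _ ≤ |a - e * b| + |e| * (|b - c| + |c - d|) := by
        refine (abs_add_le _ _).trans ?_
        rw [abs_mul]
        have := abs_add_le (b - c) (c - d)
        gcongr
    _ ≤ C * (4 * K) * (1 / Real.sqrt N) +
        4 * (C * K * (1 / Real.sqrt N) + 2 * |t i| * Fintype.card R * K) := by
        rw [abs_sub_comm b c, abs_sub_comm c d]
        gcongr
    _ = 8 * K * (C * (1 / Real.sqrt N) + Fintype.card R * |t i|) := by ring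
    _ ≤ 8 * K * (C * (|t i| + 1 / Real.sqrt N) + Fintype.card R * (|t i| + 1 / Real.sqrt N)) := by
        have h5 := abs_nonneg (t i)
        have h6 : 0 ≤ 1 / Real.sqrt N := by positivity
        gcongr <;> linarith
    _ = _ := by ring

theorem abs_cav_sub_avg_pairProd_mul_le (hW : WeightBound R β h q t i K)
    (hp : CavityParams β h q) (ht : ∑ i, t i ^ 2 = 1) {p m : R → ι} (hpm : ∀ r, p r ≠ m r)
    (x y : ι) :
    |(cavModel β h q i (Real.pi / 2)).avg
        (fun τ : ι → Cfg N => pairProdErase t i p m Finset.univ τ * cavOverlap q i x y τ) -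
      (skModel N β h).avg
        (fun τ : ι → Cfg N => pairProd t p m Finset.univ τ * offOverlap q x y τ)| ≤
      K * (cavConst (Fintype.card ι) 1 + 2 * Fintype.card R + 1) * (t i ^ 2 + 1 / N) := by
  have hpi := Real.pi_pos
  have hN : (0 : ℝ) < N := by exact_mod_cast i.pos
  set s := 1 / Real.sqrt N with hs
  have hs0 : 0 ≤ s := by positivity
  have hs2 : s * s = 1 / N := by
    rw [hs, div_mul_div_comm, Real.mul_self_sqrt hN.le, one_mul]
  have h1 := abs_cavModel_avg_sub_le β h hp.nonneg hp.le_one i (by positivity)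
    (le_refl (Real.pi / 2)) le_rfl (by positivity)
    (fun τ : ι → Cfg N => pairProdErase t i p m Finset.univ τ * cavOverlap q i x y τ)
    (M := s * s * K) (fun z w => by
      refine le_trans ?_ (mul_le_mul_of_nonneg_left (hW.2 _
        (fun r => some (some (p r))) (fun r => some (some (m r)))
        (fun r h => hpm r (some_some_injective h)) (some (some x)) (some (some y)) z w)
        (by positivity))
      rw [← avg_const_mul]
      refine avg_mono _ fun τ => ?_
      have h2 := abs_cavOverlap_le_scaled q i z w τ
      have h2' := abs_cavOverlap_le_scaled q i (some (some x)) (some (some y)) τ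
      have h3 := abs_pairProdErase_le ht i p m Finset.univ (fun l => τ (some (some l)))
      change _ ≤ pairWeight t (fun r => some (some (p r))) (fun r => some (some (m r))) τ at h3
      have h5 : 0 ≤ pairWeight t (fun r => some (some (p r))) (fun r => some (some (m r))) τ :=
        (abs_nonneg _).trans h3
      have e : cavOverlap q i x y (fun l => τ (some (some l))) =
        cavOverlap q i (some (some x)) (some (some y)) τ := by unfold cavOverlap; simp
      rw [abs_mul, e]
      calc _ ≤ pairWeight t (fun r => some (some (p r))) (fun r => some (some (m r))) τ *
            (s * (1 + Real.sqrt N * |cavOverlap q i (some (some x)) (some (some y)) τ|)) *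
            (s * (1 + Real.sqrt N * |cavOverlap q i z w τ|)) := by gcongr
        _ = _ := by ring)
  rw [cavModel_zero] at h1
  have h2 : |(skModel N β h).avg
        (fun τ : ι → Cfg N => pairProdErase t i p m Finset.univ τ * cavOverlap q i x y τ) -
      (skModel N β h).avg
        (fun τ : ι → Cfg N => pairProd t p m Finset.univ τ * offOverlap q x y τ)| ≤
      (2 * |t i| * Fintype.card R * s) * K + s * s * K := by
    rw [← avg_sub]
    calc _ ≤ (skModel N β h).avg (fun τ : ι → Cfg N => (2 * |t i| * Fintype.card R * s) *
          (pairWeight t p m τ * (1 + Real.sqrt N * |cavOverlap q i x y τ|)) +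
          s * s * pairWeight t p m τ) := by
          refine abs_avg_le _ fun τ => ?_
          classical
          have e1 := abs_pairProd_sub_le ht i p m Finset.univ τ
          have e2 := abs_cavOverlap_le_scaled q i x y τ
          have e3 := abs_pairProd_le t p m Finset.univ τ
          have e4 := abs_offOverlap_sub_le q i x y τ
          have e5 := one_le_pairWeight t p m τ
          rw [← hs2] at e4
          set F := pairProd t p m Finset.univ τ
          set F' := pairProdErase t i p m Finset.univ τ
          set Q := cavOverlap q i x y τ
          set Q' := offOverlap q x y τ
          set W := pairWeight t p m τ
          calc |F' * Q - F * Q'| = |(F' - F) * Q + F * (Q - Q')| := by congr 1; ring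
            _ ≤ |F - F'| * |Q| + |F| * |Q - Q'| := by
                rw [abs_sub_comm F, ← abs_mul, ← abs_mul]; exact abs_add_le _ _
            _ ≤ 2 * |t i| * Fintype.card R * W * (s * (1 + Real.sqrt N * |Q|)) + W * (s * s) := by
                gcongr
            _ = _ := by ring
      _ ≤ _ := by
          rw [avg_add, avg_const_mul, avg_const_mul]
          have := hW.avg_weight_le hpm
          have := hW.avg_weight_mul_le hpm x y
          gcongr
  have h3 := hp.sq_mul_cavConst_le (Fintype.card ι)
  have hC := cavConst_nonneg (Fintype.card ι) 1
  have hK := hW.1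
  have h4 : |t i| * s ≤ t i ^ 2 + 1 / N := by
    rw [← hs2, ← sq_abs]
    nlinarith [sq_nonneg (|t i| - s), sq_nonneg (|t i| + s)]
  have h5 : s * s ≤ t i ^ 2 + 1 / N := by rw [hs2]; linarith [sq_nonneg (t i)]
  set E := t i ^ 2 + 1 / (N : ℝ)
  have hE : 0 ≤ E := by positivity
  set C := cavConst (Fintype.card ι) 1
  calc _ ≤ β ^ 2 * cavConst (Fintype.card ι) β * (s * s * K) +
        ((2 * |t i| * Fintype.card R * s) * K + s * s * K) :=
        (abs_sub_le _ _ _).trans (add_le_add h1 h2)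
    _ = β ^ 2 * cavConst (Fintype.card ι) β * (s * s * K) +
        (2 * Fintype.card R * K * (|t i| * s) + s * s * K) := by ring
    _ ≤ C * (E * K) + (2 * Fintype.card R * K * E + E * K) := by gcongr
    _ = _ := by ring

end WeightBound

end CavityExpansion

section Expansion

open LinModel

variable {N : ℕ} {ι R : Type} [Fintype ι] [DecidableEq ι] [Fintype R]

/-- The contribution to the cavity expansion coming from the overlaps. -/
def overlapTerm (β h q : ℝ) (t : Fin N → ℝ) (p m : R → ι) (ψ : (ι → Bool) → ℝ) : ℝ :=
  ∑ x, ∑ y, extCoeff ι x * replicaCoeff (Option ι) y *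
    ((siteModel β h q).avg (fun v : Option (Option ι) → Bool =>
        ψ (fun l => v (some (some l))) * (spin (v x) * spin (v y))) *
      (skModel N β h).avg (fun τ : Option (Option ι) → Cfg N =>
        pairProd t (fun r => some (some (p r))) (fun r => some (some (m r))) Finset.univ τ *
          offOverlap q x y τ))

namespace WeightBound

variable {β h q K : ℝ} {t : Fin N → ℝ} {i : Fin N}

theorem abs_avg_mul_pairProdErase_sub_overlapTerm_le (hW : WeightBound R β h q t i K)
    (hp : CavityParams β h q) (ht : ∑ i, t i ^ 2 = 1) {p m : R → ι} (hpm : ∀ r, p r ≠ m r)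
    {ψ : (ι → Bool) → ℝ} (hψ : ∀ v, |ψ v| ≤ 2) (hψ0 : (siteModel β h q).avg ψ = 0) :
    |(skModel N β h).avg
        (fun τ : ι → Cfg N => ψ (fun l => τ l i) * pairProdErase t i p m Finset.univ τ) -
      β ^ 2 / 2 * overlapTerm β h q t p m ψ| ≤
      8 * K * Fintype.card ι * (Fintype.card ι + 1) * (2 * cavConst (Fintype.card ι + 2) 1 +
        2 * Fintype.card R + 1) * (t i ^ 2 + 1 / N) := by
  have hN : (0 : ℝ) < N := by exact_mod_cast i.pos
  set s := 1 / Real.sqrt N with hs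
  have hs0 : 0 ≤ s := by positivity
  have hs2 : s * s = 1 / N := by
    rw [hs, div_mul_div_comm, Real.mul_self_sqrt hN.le, one_mul]
  set n : ℝ := (Fintype.card ι : ℝ) with hn
  set C := cavConst (Fintype.card ι + 2) 1 with hC
  have hC0 : 0 ≤ C := cavConst_nonneg _ _
  have hK := hW.1
  set f : (ι → Cfg N) → ℝ := fun τ => ψ (fun l => τ l i) * pairProdErase t i p m Finset.univ τ
    with hf
  have h1 := abs_avg_sub_cav_sub_cavDeriv_le hp.abs_le_one h hp.nonneg hp.le_one i f
    (M := 2 * (s * s) * K) (fun x y z w => by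
      have hinj : Function.Injective fun l : ι => some (some (some (some l))) := fun a b hab => by
        simpa using hab
      refine le_trans ?_ (mul_le_mul_of_nonneg_left (hW.2 _
        (fun r => some (some (some (some (p r))))) (fun r => some (some (some (some (m r)))))
        (fun r h => hpm r (hinj h)) (some (some x)) (some (some y)) z w) (by positivity))
      rw [← avg_const_mul]
      refine avg_mono _ fun τ => ?_
      have h2 := abs_cavOverlap_le_scaled q i z w τ
      have h2' := abs_cavOverlap_le_scaled q i (some (some x)) (some (some y)) τ
      have h3 := abs_pairProdErase_le ht i p m Finset.univ
        (fun l => τ (some (some (some (some l)))))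
      change _ ≤ pairWeight t (fun r => some (some (some (some (p r)))))
        (fun r => some (some (some (some (m r))))) τ at h3
      have h4 := hψ fun l => τ (some (some (some (some l)))) i
      have h5 := (abs_nonneg _).trans h3
      rw [hf, abs_mul]
      calc _ ≤ 2 * pairWeight t (fun r => some (some (some (some (p r)))))
            (fun r => some (some (some (some (m r))))) τ *
            (s * (1 + Real.sqrt N * |cavOverlap q i (some (some x)) (some (some y)) τ|)) *
            (s * (1 + Real.sqrt N * |cavOverlap q i z w τ|)) := by gcongr
        _ = _ := by ring)
  have h2 : (cavModel β h q i (Real.pi / 2)).avg f = 0 := by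
    rw [hf, avg_decouple β h q i ψ (fun τ b => pairProdErase_update t i p m Finset.univ τ b), hψ0,
      zero_mul]
  rw [h2, sub_zero] at h1
  have h3 : |cavDeriv β h q i (Real.pi / 2) f - overlapTerm β h q t p m ψ| ≤
      4 * n * (n + 1) * (2 * (K * (C + 2 * Fintype.card R + 1) * (t i ^ 2 + 1 / N))) := by
    unfold cavDeriv overlapTerm
    simp_rw [← Finset.sum_sub_distrib, ← mul_sub]
    refine abs_sum_extCoeff_le _ fun x y => ?_
    have e : (cavModel β h q i (Real.pi / 2)).avg (fun τ : Option (Option ι) → Cfg N =>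
        f (fun l => τ (some (some l))) * (spin (τ x i) * spin (τ y i)) * cavOverlap q i x y τ) =
        (siteModel β h q).avg (fun v : Option (Option ι) → Bool =>
          ψ (fun l => v (some (some l))) * (spin (v x) * spin (v y))) *
        (cavModel β h q i (Real.pi / 2)).avg (fun τ : Option (Option ι) → Cfg N =>
          pairProdErase t i (fun r => some (some (p r))) (fun r => some (some (m r)))
            Finset.univ τ * cavOverlap q i x y τ) := by
      rw [← avg_decouple β h q i _ (fun τ b => by rw [pairProdErase_update, cavOverlap_update])]
      congr 1
      funext τ
      simp only [hf]
      change ψ (fun l => τ (some (some l)) i) * pairProdErase t i (fun r => some (some (p r)))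
        (fun r => some (some (m r))) Finset.univ τ * _ * _ = _
      ring
    rw [e, ← mul_sub, abs_mul]
    have h4 := hW.abs_cav_sub_avg_pairProd_mul_le hp ht (p := fun r => some (some (p r)))
      (m := fun r => some (some (m r))) (fun r h => hpm r (some_some_injective h)) x y
    have h5 : |(siteModel β h q).avg (fun v : Option (Option ι) → Bool =>
          ψ (fun l => v (some (some l))) * (spin (v x) * spin (v y)))| ≤ 2 :=
      abs_avg_le_const _ fun v => by
        rw [abs_mul, abs_mul, abs_spin, abs_spin, mul_one, mul_one]
        exact hψ _
    rw [Fintype.card_option, Fintype.card_option] at h4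
    gcongr
  have h4 : β ^ 2 / 2 ≤ 1 := by linarith [hp.sq_le]
  have h5 : s * s ≤ t i ^ 2 + 1 / N := by rw [hs2]; linarith [sq_nonneg (t i)]
  set E := t i ^ 2 + 1 / (N : ℝ)
  have hE : 0 ≤ E := by positivity
  set D := cavDeriv β h q i (Real.pi / 2) f
  set D' := overlapTerm β h q t p m ψ
  set a := (skModel N β h).avg f
  calc |a - β ^ 2 / 2 * D'| = |(a - β ^ 2 / 2 * D) + β ^ 2 / 2 * (D - D')| := by congr 1; ring
    _ ≤ |a - β ^ 2 / 2 * D| + β ^ 2 / 2 * |D - D'| := by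
        refine (abs_add_le _ _).trans ?_
        rw [abs_mul, abs_of_nonneg (by positivity : 0 ≤ β ^ 2 / 2)]
    _ ≤ 4 * n * (n + 1) * C * (2 * E * K) +
        1 * (4 * n * (n + 1) * (2 * (K * (C + 2 * Fintype.card R + 1) * E))) := by
        refine add_le_add (h1.trans ?_) (by gcongr)
        gcongr
    _ = _ := by ring

theorem abs_avg_mul_pairProd_sub_le [DecidableEq R] (hW : WeightBound R β h q t i K)
    (hp : CavityParams β h q) (ht : ∑ i, t i ^ 2 = 1) {p m : R → ι} (hpm : ∀ r, p r ≠ m r)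
    {ψ : (ι → Bool) → ℝ} (hψ : ∀ v, |ψ v| ≤ 2) (hψ0 : (siteModel β h q).avg ψ = 0) :
    |(skModel N β h).avg
        (fun τ : ι → Cfg N => ψ (fun l => τ l i) * pairProd t p m Finset.univ τ) -
      t i * (∑ r, (siteModel β h q).avg (fun v => ψ v * (spin (v (p r)) - spin (v (m r)))) *
        (skModel N β h).avg (fun τ : ι → Cfg N => pairProd t p m (Finset.univ.erase r) τ)) -
      β ^ 2 / 2 * overlapTerm β h q t p m ψ| ≤
      (8 * Fintype.card R ^ 2 * K + Fintype.card R * (2 * (8 * K *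
          (cavConst (Fintype.card ι) 1 + Fintype.card R))) +
        8 * K * Fintype.card ι * (Fintype.card ι + 1) * (2 * cavConst (Fintype.card ι + 2) 1 +
        2 * Fintype.card R + 1)) * (t i ^ 2 + 1 / N) := by
  have hN : (0 : ℝ) < N := by exact_mod_cast i.pos
  set s := 1 / Real.sqrt N with hs
  have hs0 : 0 ≤ s := by positivity
  have hs2 : s * s = 1 / N := by
    rw [hs, div_mul_div_comm, Real.mul_self_sqrt hN.le, one_mul]
  set sk := skModel N β h with hsk
  set φ : R → (ι → Bool) → ℝ := fun r v => ψ v * (spin (v (p r)) - spin (v (m r))) with hφ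
  have hφ4 : ∀ r v, |φ r v| ≤ 4 := by
    intro r v
    rw [hφ, abs_mul]
    have h1 := hψ v
    have h2 := abs_spin_sub_le (v (p r)) (v (m r))
    calc _ ≤ (2 : ℝ) * 2 := by gcongr
      _ = 4 := by norm_num
  have hK := hW.1
  have h1 := hW.abs_avg_mul_pairProdErase_sub_overlapTerm_le hp ht hpm hψ hψ0
  have h2 : |sk.avg (fun τ : ι → Cfg N => ψ (fun l => τ l i) * pairProd t p m Finset.univ τ) -
      sk.avg (fun τ : ι → Cfg N => ψ (fun l => τ l i) * pairProdErase t i p m Finset.univ τ) -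
      t i * ∑ r, sk.avg (fun τ : ι → Cfg N => φ r (fun l => τ l i) *
        pairProdErase t i p m (Finset.univ.erase r) τ)| ≤
      8 * t i ^ 2 * Fintype.card R ^ 2 * K := by
    rw [← avg_sum, ← avg_const_mul, ← avg_sub, ← avg_sub]
    refine (abs_avg_le sk (f' := fun τ => 8 * t i ^ 2 * Fintype.card R ^ 2 * pairWeight t p m τ)
      fun τ => ?_).trans ?_
    · have e1 := abs_pairProd_sub_sub_sum_le ht i p m τ
      have e2 := hψ fun l => τ l i
      rw [mul_pow, sq_abs] at e1
      calc _ = |ψ fun l => τ l i| * |pairProd t p m Finset.univ τ -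
            pairProdErase t i p m Finset.univ τ -
            ∑ r, t i * (spin (τ (p r) i) - spin (τ (m r) i)) *
              pairProdErase t i p m (Finset.univ.erase r) τ| := by
            rw [← abs_mul, mul_sub, mul_sub, Finset.mul_sum, Finset.mul_sum]
            congr 2
            exact Finset.sum_congr rfl fun r _ => by rw [hφ]; ring
        _ ≤ 2 * (2 ^ 2 * t i ^ 2 * Fintype.card R ^ 2 * pairWeight t p m τ) := by gcongr
        _ = _ := by ring
    · rw [avg_const_mul]
      have := hW.avg_weight_le hpm
      gcongr
  have hst : |t i| * (|t i| + s) ≤ 2 * (t i ^ 2 + 1 / N) := by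
    rw [← hs2, ← sq_abs]
    nlinarith [sq_nonneg (|t i| - s), sq_nonneg (|t i| + s)]
  set C₁ := 8 * K * (cavConst (Fintype.card ι) 1 + Fintype.card R) with hC₁
  have hC₁0 : 0 ≤ C₁ := by have := cavConst_nonneg (Fintype.card ι) 1; positivity
  have h3 : |t i * (∑ r, sk.avg (fun τ : ι → Cfg N => φ r (fun l => τ l i) *
        pairProdErase t i p m (Finset.univ.erase r) τ)) -
      t i * (∑ r, (siteModel β h q).avg (φ r) *
        sk.avg (fun τ : ι → Cfg N => pairProd t p m (Finset.univ.erase r) τ))| ≤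
      Fintype.card R * (2 * C₁) * (t i ^ 2 + 1 / N) := by
    rw [← mul_sub, ← Finset.sum_sub_distrib, abs_mul]
    calc _ ≤ |t i| * ∑ _r : R, C₁ * (|t i| + s) := by
          gcongr
          refine (Finset.abs_sum_le_sum_abs _ _).trans (Finset.sum_le_sum fun r _ => ?_)
          exact hW.abs_avg_mul_pairProdErase_sub_avg_le hp ht hpm (hφ4 r) _
      _ = Fintype.card R * C₁ * (|t i| * (|t i| + s)) := by
          rw [Finset.sum_const, Finset.card_univ, nsmul_eq_mul]; ring
      _ ≤ Fintype.card R * C₁ * (2 * (t i ^ 2 + 1 / N)) := by gcongr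
      _ = _ := by ring
  have h4 : 8 * t i ^ 2 * Fintype.card R ^ 2 * K ≤
      8 * Fintype.card R ^ 2 * K * (t i ^ 2 + 1 / N) := by
    have : 0 ≤ 8 * (Fintype.card R : ℝ) ^ 2 * K * (1 / N) := by positivity
    linarith
  rw [abs_le] at *
  constructor <;> linarith [h1.1, h1.2, h2.1, h2.2, h3.1, h3.2]

end WeightBound

theorem exists_expansion (ι R : Type) [Fintype ι] [DecidableEq ι] [Fintype R] [DecidableEq R] :
    ∃ K : ℝ, 0 ≤ K ∧ ∀ (N : ℕ) (β h q : ℝ) (t : Fin N → ℝ) (i : Fin N), CavityParams β h q →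
      ∑ i, t i ^ 2 = 1 → ∀ p m : R → ι, (∀ r, p r ≠ m r) → ∀ ψ : (ι → Bool) → ℝ,
      (∀ v, |ψ v| ≤ 2) → (siteModel β h q).avg ψ = 0 →
      |(skModel N β h).avg
          (fun τ : ι → Cfg N => ψ (fun l => τ l i) * pairProd t p m Finset.univ τ) -
        t i * (∑ r, (siteModel β h q).avg (fun v => ψ v * (spin (v (p r)) - spin (v (m r)))) *
          (skModel N β h).avg (fun τ : ι → Cfg N => pairProd t p m (Finset.univ.erase r) τ)) -
        β ^ 2 / 2 * overlapTerm β h q t p m ψ| ≤ K * (t i ^ 2 + 1 / N) := by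
  obtain ⟨K, hK⟩ := exists_weightBound R
  have h1 := cavConst_nonneg (Fintype.card ι) 1
  have h2 := cavConst_nonneg (Fintype.card ι + 2) 1
  refine ⟨8 * Fintype.card R ^ 2 * |K| + Fintype.card R * (2 * (8 * |K| *
      (cavConst (Fintype.card ι) 1 + Fintype.card R))) + 8 * |K| * Fintype.card ι *
      (Fintype.card ι + 1) * (2 * cavConst (Fintype.card ι + 2) 1 + 2 * Fintype.card R + 1),
    by positivity, fun N β h q t i hp ht p m hpm ψ hψ hψ0 => ?_⟩
  have hW := hK N β h q t i hp ht
  rw [abs_of_nonneg hW.1]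
  exact hW.abs_avg_mul_pairProd_sub_le hp ht hpm hψ hψ0

end Expansion

section LinearSystem

open LinModel

theorem sum_eq_add_add_ite {O : Type*} [Fintype O] [DecidableEq O] {P M : O} (hPM : P ≠ M)
    (g : O → ℝ) : ∑ x, g x = g P + g M + ∑ x, if x = P ∨ x = M then 0 else g x := by
  rw [← Finset.add_sum_erase _ _ (Finset.mem_univ P),
    ← Finset.add_sum_erase _ _ (Finset.mem_erase.2 ⟨hPM.symm, Finset.mem_univ M⟩), add_assoc]
  congr 2
  rw [← Finset.sum_filter_of_ne (s := Finset.univ) (p := fun x => x ≠ P ∧ x ≠ M)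
    (fun x _ hx => by rw [← not_or]; exact fun h => hx (if_pos h))]
  refine Finset.sum_congr ?_ fun x hx => ?_
  · ext x; simp [and_comm]
  · rw [if_neg]
    simp only [Finset.mem_filter] at hx
    rw [not_or]
    exact hx.2

theorem sum_sum_eq_of_antisymm {O : Type*} [Fintype O] [DecidableEq O] {P M : O} (hPM : P ≠ M)
    {c d : O → ℝ} (hcP : c P = 1) (hcM : c M = 1) (hdP : d P = 1) (hdM : d M = 1)
    {e a : O → O → ℝ} (he : ∀ x y, e x y = e y x) (ha : ∀ x y, a x y = a y x)
    (hout : ∀ x y, ¬(x = P ∨ x = M) → ¬(y = P ∨ y = M) → e x y = 0)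
    (hin : ∀ x y, (x = P ∨ x = M) → (y = P ∨ y = M) → e x y = 0)
    (hanti : ∀ y, ¬(y = P ∨ y = M) → e M y = -e P y) :
    ∑ x, ∑ y, c x * d y * (e x y * a x y) =
      ∑ y, if y = P ∨ y = M then 0 else (c y + d y) * (e P y * (a P y - a M y)) := by
  have hrow : ∀ x, (x = P ∨ x = M) → ∑ y, c x * d y * (e x y * a x y) =
      ∑ y, if y = P ∨ y = M then 0 else c x * d y * (e x y * a x y) := by
    intro x hx
    rw [sum_eq_add_add_ite hPM, hin x P hx (Or.inl rfl), hin x M hx (Or.inr rfl)]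
    simp
  have hrow' : ∀ x, ¬(x = P ∨ x = M) → ∑ y, c x * d y * (e x y * a x y) =
      c x * (e P x * (a P x - a M x)) := by
    intro x hx
    rw [sum_eq_add_add_ite hPM, Finset.sum_eq_zero, hdP, hdM, he x P, he x M, hanti x hx, ha x P,
      ha x M]
    · ring
    · intro y _
      split_ifs with hy
      · rfl
      · rw [hout x y hx hy]; simp
  rw [sum_eq_add_add_ite hPM, hrow P (Or.inl rfl), hrow M (Or.inr rfl), ← Finset.sum_add_distrib,
    ← Finset.sum_add_distrib]
  refine Finset.sum_congr rfl fun y _ => ?_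
  split_ifs with hy
  · simp
  · rw [hrow' y hy, hanti y hy, hcP, hcM]
    ring

variable {N : ℕ} {κ R : Type} [Fintype κ] [DecidableEq κ] [Fintype R]

theorem avg_eq_zero_of_comp_neg {A : Type} [Fintype A] [Nonempty A] (m : LinModel A N)
    {e : κ → κ} (he : Function.Injective e) {f : (κ → A) → ℝ}
    (hf : ∀ τ, f (fun l => τ (e l)) = -f τ) : m.avg f = 0 := by
  have h1 := avg_comp m e he f
  simp only [hf, avg_neg] at h1
  linarith

theorem centredOverlap_comm (q : ℝ) (x y : κ) (τ : κ → Cfg N) :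
    centredOverlap q x y τ = centredOverlap q y x τ := by
  unfold centredOverlap overlap
  simp only [mul_comm]

theorem offOverlap_comm (q : ℝ) (x y : κ) (τ : κ → Cfg N) :
    offOverlap q x y τ = offOverlap q y x τ := by
  unfold offOverlap
  simp only [centredOverlap_comm q x y, eq_comm]

/-- The weighted average of the difference of two overlaps. -/
def overlapDiff (β h q : ℝ) (t : Fin N → ℝ) (p m : R → κ) (p₀ m₀ c : κ) : ℝ :=
  (skModel N β h).avg (fun τ : κ → Cfg N => pairProd t p m Finset.univ τ *
    (centredOverlap q p₀ c τ - centredOverlap q m₀ c τ))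

theorem overlapDiff_comp {κ' : Type} [Fintype κ'] [DecidableEq κ'] {e : κ → κ'}
    (he : Function.Injective e) (β h q : ℝ) (t : Fin N → ℝ) (p m : R → κ) (p₀ m₀ c : κ) :
    overlapDiff β h q t (fun r => e (p r)) (fun r => e (m r)) (e p₀) (e m₀) (e c) =
      overlapDiff β h q t p m p₀ m₀ c :=
  avg_comp (skModel N β h) e he fun τ : κ → Cfg N => pairProd t p m Finset.univ τ *
    (centredOverlap q p₀ c τ - centredOverlap q m₀ c τ)

/-- The site average multiplying the difference of overlaps with the replica `y`. -/
def siteCoeff (β h q : ℝ) (χ : (κ → Bool) → ℝ) (p₀ m₀ : κ) (y : Option (Option κ)) : ℝ :=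
  (siteModel β h q).avg (fun v : Option (Option κ) → Bool =>
    (1 - spin (v (some (some p₀))) * spin (v (some (some m₀)))) *
      χ (fun l => v (some (some l))) * spin (v y))

theorem overlapTerm_eq (β h q : ℝ) (t : Fin N → ℝ) (p m : R → κ) {p₀ m₀ : κ} (hpm : p₀ ≠ m₀)
    {χ : (κ → Bool) → ℝ} (hχ : ∀ v, χ (fun l => v (Equiv.swap p₀ m₀ l)) = χ v) :
    overlapTerm β h q t p m (fun v => (spin (v p₀) - spin (v m₀)) * χ v) =
      ∑ y, if y = some (some p₀) ∨ y = some (some m₀) then 0 else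
        (extCoeff κ y + replicaCoeff (Option κ) y) * (siteCoeff β h q χ p₀ m₀ y *
          overlapDiff β h q t (fun r => some (some (p r))) (fun r => some (some (m r)))
            (some (some p₀)) (some (some m₀)) y) := by
  set P : Option (Option κ) := some (some p₀) with hP
  set M : Option (Option κ) := some (some m₀) with hM
  have hPM : P ≠ M := fun h => hpm (by simpa [hP, hM] using h)
  set ψ : (Option (Option κ) → Bool) → ℝ := fun v =>
    (spin (v P) - spin (v M)) * χ (fun l => v (some (some l))) with hψ
  have hψs : ∀ v, ψ (fun l => v (Equiv.swap P M l)) = -ψ v := by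
    intro v
    have : (fun l : κ => v (Equiv.swap P M (some (some l)))) =
        fun l => (fun l' => v (some (some l'))) (Equiv.swap p₀ m₀ l) := by
      funext l
      rw [some_some_injective.swap_apply p₀ m₀ l]
    simp only [hψ, this, Equiv.swap_apply_left, Equiv.swap_apply_right]
    linear_combination (spin (v M) - spin (v P)) * hχ fun l => v (some (some l))
  have hinj : Function.Injective (Equiv.swap P M) := (Equiv.swap P M).injective
  have hin : ∀ x y, (x = P ∨ x = M) → (y = P ∨ y = M) → ∀ v : Option (Option κ) → Bool,
      spin (v (Equiv.swap P M x)) * spin (v (Equiv.swap P M y)) = spin (v x) * spin (v y) := by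
    rintro x y (rfl | rfl) (rfl | rfl) v <;>
      simp [spin_mul_self, mul_comm]
  have hout : ∀ x, ¬(x = P ∨ x = M) → Equiv.swap P M x = x := fun x hx =>
    Equiv.swap_apply_of_ne_of_ne (fun h => hx (Or.inl h)) fun h => hx (Or.inr h)
  rw [overlapTerm, sum_sum_eq_of_antisymm hPM (by rfl) (by rfl) (by rfl) (by rfl)]
  · refine Finset.sum_congr rfl fun y _ => ?_
    split_ifs with hy
    · rfl
    · rw [← avg_sub]
      congr 2
      · unfold siteCoeff
        congr 1
        funext v
        have := spin_mul_self (v P)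
        linear_combination (χ fun l => v (some (some l))) * spin (v y) * this
      · unfold overlapDiff
        congr 1
        funext τ
        rw [← mul_sub, offOverlap, offOverlap, if_neg fun h => hy (Or.inl h.symm),
          if_neg fun h => hy (Or.inr h.symm)]
  · intro x y
    congr 1
    funext v
    rw [mul_comm (spin (v x))]
  · intro x y
    simp only [offOverlap_comm q x y]
  · intro x y hx hy
    refine avg_eq_zero_of_comp_neg _ hinj fun v => ?_
    change ψ (fun l => v (Equiv.swap P M l)) * _ = -(ψ v * _)
    simp only [hψs, hout x hx, hout y hy, neg_mul]
  · intro x y hx hy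
    refine avg_eq_zero_of_comp_neg _ hinj fun v => ?_
    change ψ (fun l => v (Equiv.swap P M l)) * _ = -(ψ v * _)
    simp only [hψs, hin x y hx hy, neg_mul]
  · intro y hy
    rw [← avg_comp (siteModel β h q) _ hinj, ← avg_neg]
    congr 1
    funext v
    change ψ (fun l => v (Equiv.swap P M l)) * _ = -(ψ v * _)
    simp only [hψs, hout y hy, Equiv.swap_apply_right, neg_mul]

end LinearSystem

section PairConfigurations

open LinModel

variable {N : ℕ} {κ R : Type} [Fintype κ] [DecidableEq κ] [Fintype R] [DecidableEq R]

/-- A family of pairs of replicas, each of which is equal to or disjoint from the pair `(p₀, m₀)`,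
together with a replica `b` that none of the pairs uses. -/
structure PairConfig (p m : R → κ) (p₀ m₀ b : κ) : Prop where
  ne : p₀ ≠ m₀
  ne_apply : ∀ r, p r ≠ m r
  fresh_left : ∀ r, p r ≠ b
  fresh_right : ∀ r, m r ≠ b
  ne_left : b ≠ p₀
  ne_right : b ≠ m₀
  same_or_disjoint : ∀ r, p r = p₀ ∧ m r = m₀ ∨
    (p r ≠ p₀ ∧ p r ≠ m₀) ∧ m r ≠ p₀ ∧ m r ≠ m₀

/-- The site average of `(1 - σ⁰σ¹)σ²`. -/
def siteThree (β h q : ℝ) : ℝ :=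
  (siteModel β h q).avg fun v : Fin 3 → Bool => (1 - spin (v 0) * spin (v 1)) * spin (v 2)

/-- The site average of `(1 - σ⁰σ¹)σ²σ³`. -/
def siteFour (β h q : ℝ) : ℝ :=
  (siteModel β h q).avg fun v : Fin 4 → Bool =>
    (1 - spin (v 0) * spin (v 1)) * spin (v 2) * spin (v 3)

theorem abs_one_sub_spin_mul_spin_le (a b : Bool) : |1 - spin a * spin b| ≤ 2 := by
  cases a <;> cases b <;> norm_num [spin]

theorem abs_siteThree_le (β h q : ℝ) : |siteThree β h q| ≤ 2 :=
  abs_avg_le_const _ fun v => by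
    rw [abs_mul, abs_spin, mul_one]
    exact abs_one_sub_spin_mul_spin_le _ _

theorem abs_siteFour_le (β h q : ℝ) : |siteFour β h q| ≤ 2 :=
  abs_avg_le_const _ fun v => by
    rw [abs_mul, abs_mul, abs_spin, abs_spin, mul_one, mul_one]
    exact abs_one_sub_spin_mul_spin_le _ _

theorem siteThree_eq (β h q : ℝ) {x y z : κ} (hxy : x ≠ y) (hxz : x ≠ z) (hyz : y ≠ z) :
    (siteModel β h q).avg
      (fun v : κ → Bool => (1 - spin (v x) * spin (v y)) * spin (v z)) = siteThree β h q := by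
  have he : Function.Injective ![x, y, z] := by
    intro a b hab
    fin_cases a <;> fin_cases b <;> simp_all
  exact avg_comp (siteModel β h q) _ he
    fun v : Fin 3 → Bool => (1 - spin (v 0) * spin (v 1)) * spin (v 2)

theorem siteFour_eq (β h q : ℝ) {x y z w : κ} (hxy : x ≠ y) (hxz : x ≠ z) (hyz : y ≠ z)
    (hxw : x ≠ w) (hyw : y ≠ w) (hzw : z ≠ w) :
    (siteModel β h q).avg
      (fun v : κ → Bool => (1 - spin (v x) * spin (v y)) * spin (v z) * spin (v w)) =
      siteFour β h q := by
  have he : Function.Injective ![x, y, z, w] := by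
    intro a b hab
    fin_cases a <;> fin_cases b <;> simp_all
  exact avg_comp (siteModel β h q) _ he
    fun v : Fin 4 → Bool => (1 - spin (v 0) * spin (v 1)) * spin (v 2) * spin (v 3)

theorem CavityParams.siteModel_avg_one_sub {β h q : ℝ} (hp : CavityParams β h q) {x y : κ}
    (hxy : x ≠ y) :
    (siteModel β h q).avg (fun v : κ → Bool => 1 - spin (v x) * spin (v y)) = 1 - q := by
  rw [avg_sub (f := fun _ => (1 : ℝ)), avg_const, hp.siteModel_avg_pair hxy]

theorem PairConfig.half_overlapTerm {p m : R → κ} {p₀ m₀ b : κ} (hc : PairConfig p m p₀ m₀ b)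
    (β h q : ℝ) (t : Fin N → ℝ) {χ : (κ → Bool) → ℝ}
    (hχ : ∀ v, χ (fun l => v (Equiv.swap p₀ m₀ l)) = χ v)
    (hn : siteCoeff β h q χ p₀ m₀ none = siteCoeff β h q χ p₀ m₀ (some none)) :
    β ^ 2 / 2 * overlapTerm β h q t p m (fun v => (spin (v p₀) - spin (v m₀)) * χ v) =
      β ^ 2 * (∑ c ∈ ({p₀, m₀} : Finset κ)ᶜ, siteCoeff β h q χ p₀ m₀ (some (some c)) *
          overlapDiff β h q t p m p₀ m₀ c -
        Fintype.card κ * (siteCoeff β h q χ p₀ m₀ none * overlapDiff β h q t p m p₀ m₀ b)) := by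
  have hfresh : ∀ z : Option (Option κ), (∀ c : κ, z ≠ some (some c)) →
      overlapDiff β h q t (fun r => some (some (p r))) (fun r => some (some (m r)))
        (some (some p₀)) (some (some m₀)) z = overlapDiff β h q t p m p₀ m₀ b := by
    intro z hz
    have he : Function.Injective fun l : κ => if l = b then z else some (some l) := by
      intro l l' hl
      dsimp only at hl
      split_ifs at hl with h1 h2 h2
      · rw [h1, h2]
      · exact absurd hl (hz l')
      · exact absurd hl.symm (hz l)
      · simpa using hl
    rw [← overlapDiff_comp he]
    simp only [if_neg (hc.fresh_left _), if_neg (hc.fresh_right _), if_neg hc.ne_left.symm,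
      if_neg hc.ne_right.symm, if_true]
  have hsame : ∀ c : κ,
      overlapDiff β h q t (fun r => some (some (p r))) (fun r => some (some (m r)))
        (some (some p₀)) (some (some m₀)) (some (some c)) =
      overlapDiff β h q t p m p₀ m₀ c := fun c => overlapDiff_comp some_some_injective ..
  have hS : ∀ g : κ → ℝ, ∑ c ∈ ({p₀, m₀} : Finset κ)ᶜ, g c =
      ∑ c, if c = p₀ ∨ c = m₀ then 0 else g c := by
    intro g
    have h1 : ({p₀, m₀} : Finset κ)ᶜ = Finset.univ.filter fun c => ¬(c = p₀ ∨ c = m₀) := by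
      ext c
      simp
    rw [h1, Finset.sum_filter]
    exact Finset.sum_congr rfl fun c _ => ite_not _ _ _
  rw [overlapTerm_eq β h q t p m hc.ne hχ, Fintype.sum_option, Fintype.sum_option, hS]
  simp only [hsame, hfresh none (by simp), hfresh (some none) (by simp), Option.some.injEq,
    reduceCtorEq, or_self, if_false, extCoeff, replicaCoeff, Fintype.card_option, ← hn]
  have h2 : ∑ c, (if c = p₀ ∨ c = m₀ then 0 else (1 + 1 : ℝ) *
      (siteCoeff β h q χ p₀ m₀ (some (some c)) * overlapDiff β h q t p m p₀ m₀ c)) =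
      2 * ∑ c, (if c = p₀ ∨ c = m₀ then 0 else
        siteCoeff β h q χ p₀ m₀ (some (some c)) * overlapDiff β h q t p m p₀ m₀ c) := by
    rw [Finset.mul_sum]
    refine Finset.sum_congr rfl fun c _ => ?_
    split_ifs <;> ring
  rw [h2]
  push_cast
  ring

/-- The sum of the moments in which one of the pairs equal to `(p₀, m₀)` is omitted. -/
def contractionSum (β h : ℝ) (t : Fin N → ℝ) (p m : R → κ) (p₀ : κ) : ℝ :=
  ∑ r with p r = p₀, (skModel N β h).avg
    (fun τ : κ → Cfg N => pairProd t p m (Finset.univ.erase r) τ)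

variable (κ R) in
theorem exists_site_expansion : ∃ K : ℝ, 0 ≤ K ∧ ∀ (N : ℕ) (β h q : ℝ) (t : Fin N → ℝ)
    (i : Fin N), CavityParams β h q → ∑ i, t i ^ 2 = 1 → ∀ (p m : R → κ) (p₀ m₀ b : κ),
    PairConfig p m p₀ m₀ b → ∀ χ : (κ → Bool) → ℝ, (∀ v, |χ v| ≤ 1) →
    (∀ v, χ (fun l => v (Equiv.swap p₀ m₀ l)) = χ v) →
    siteCoeff β h q χ p₀ m₀ none = siteCoeff β h q χ p₀ m₀ (some none) →
    |(skModel N β h).avg (fun τ : κ → Cfg N => (spin (τ p₀ i) - spin (τ m₀ i)) *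
        χ (fun l => τ l i) * pairProd t p m Finset.univ τ) -
      t i * (2 * (siteModel β h q).avg (fun v => (1 - spin (v p₀) * spin (v m₀)) * χ v) *
        contractionSum β h t p m p₀) -
      β ^ 2 * (∑ c ∈ ({p₀, m₀} : Finset κ)ᶜ, siteCoeff β h q χ p₀ m₀ (some (some c)) *
          overlapDiff β h q t p m p₀ m₀ c -
        Fintype.card κ * (siteCoeff β h q χ p₀ m₀ none * overlapDiff β h q t p m p₀ m₀ b))| ≤
      K * (t i ^ 2 + 1 / N) := by
  obtain ⟨K, hK0, hK⟩ := exists_expansion κ R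
  refine ⟨K, hK0, fun N β h q t i hp ht p m p₀ m₀ b hc χ hχ1 hχ hn => ?_⟩
  have hinj := (Equiv.swap p₀ m₀).injective
  refine le_trans (le_of_eq ?_) (hK N β h q t i hp ht p m hc.ne_apply
    (fun v => (spin (v p₀) - spin (v m₀)) * χ v) (fun v => ?_) ?_)
  · rw [hc.half_overlapTerm β h q t hχ hn]
    congr 4
    rw [contractionSum, Finset.mul_sum, Finset.sum_filter]
    refine Finset.sum_congr rfl fun r _ => ?_
    rcases hc.same_or_disjoint r with ⟨h1, h2⟩ | ⟨⟨h1, h2⟩, h3, h4⟩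
    · rw [if_pos h1, h1, h2, ← (siteModel β h q).avg_const_mul 2]
      refine congrArg (· * _) (congrArg (siteModel β h q).avg (funext fun v => ?_))
      linear_combination (-χ v) * spin_mul_self (v p₀) - χ v * spin_mul_self (v m₀)
    · rw [if_neg h1, avg_eq_zero_of_comp_neg _ hinj, zero_mul]
      intro v
      simp only [hχ, Equiv.swap_apply_left, Equiv.swap_apply_right,
        Equiv.swap_apply_of_ne_of_ne h1 h2, Equiv.swap_apply_of_ne_of_ne h3 h4]
      ring
  · rw [abs_mul]
    exact (mul_le_mul (abs_spin_sub_le _ _) (hχ1 v) (abs_nonneg _) (by norm_num)).trans_eq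
      (mul_one 2)
  · refine avg_eq_zero_of_comp_neg _ hinj fun v => ?_
    simp only [hχ, Equiv.swap_apply_left, Equiv.swap_apply_right]
    ring

theorem abs_add_div_le_of_linear_system {S : Finset κ} {n : ℕ} (hS : S.card + 2 = n) {u : κ → ℝ}
    {b : κ} (hb : b ∈ S) {a D Y δ : ℝ} (hden : 1 / 2 ≤ 1 - a + 2 * D)
    (hu : ∀ c ∈ S, |u c - Y - (a * u c + D * (∑ c ∈ S, u c - n * u b))| ≤ δ) :
    |∑ c ∈ S, u c - n * u b + 2 * Y / (1 - a + 2 * D)| ≤ 4 * n * δ := by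
  set W := ∑ c ∈ S, u c - n * u b with hW
  set den := 1 - a + 2 * D with hd
  have hden0 : 0 < den := by linarith
  have hcard : (S.card : ℝ) + 2 = n := by exact_mod_cast hS
  have h1 : ∑ c ∈ S, (u c - Y - (a * u c + D * W)) - n * (u b - Y - (a * u b + D * W)) =
      den * W + 2 * Y := by
    simp only [Finset.sum_sub_distrib, Finset.sum_add_distrib, Finset.sum_const, nsmul_eq_mul,
      ← Finset.mul_sum]
    rw [hd]
    linear_combination (-(Y + D * W)) * hcard - (1 - a) * hW
  have h2 : |∑ c ∈ S, (u c - Y - (a * u c + D * W))| ≤ S.card * δ := by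
    refine (Finset.abs_sum_le_sum_abs _ _).trans ?_
    refine (Finset.sum_le_sum hu).trans_eq ?_
    simp
  have h3 := hu b hb
  have hδ : 0 ≤ δ := (abs_nonneg _).trans h3
  have h4 : |den * W + 2 * Y| ≤ 2 * n * δ := by
    rw [← h1]
    refine (abs_sub _ _).trans ?_
    rw [abs_mul, Nat.abs_cast]
    have h5 : (n : ℝ) * |u b - Y - (a * u b + D * W)| ≤ n * δ :=
      mul_le_mul_of_nonneg_left h3 n.cast_nonneg
    nlinarith
  have h6 : W + 2 * Y / den = (den * W + 2 * Y) / den := by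
    field_simp
  rw [h6, abs_div, abs_of_pos hden0, div_le_iff₀ hden0]
  have : 0 ≤ n * δ := mul_nonneg n.cast_nonneg hδ
  nlinarith

end PairConfigurations

section PairSumMoments

open LinModel

variable {N : ℕ} {κ R : Type} [Fintype κ] [DecidableEq κ] [Fintype R] [DecidableEq R]

/-- The denominator that appears when the linear system for the overlaps is solved. -/
def systemDet (β h q : ℝ) : ℝ :=
  1 - β ^ 2 * (1 - q - siteFour β h q) + 2 * (β ^ 2 * siteFour β h q)

/-- The leading order of the second moment of `pairSum t`. -/
def limitVar (β h q : ℝ) (t : Fin N → ℝ) : ℝ :=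
  2 * (1 - q) - 4 * β ^ 2 * siteThree β h q ^ 2 * ((∑ i, t i) ^ 2 / N) / systemDet β h q

theorem CavityParams.half_le_systemDet {β h q : ℝ} (hp : CavityParams β h q) :
    1 / 2 ≤ systemDet β h q := by
  have h1 := hp.sq_le
  have h2 := _root_.abs_le.1 (abs_siteFour_le β h q)
  have h3 := hp.nonneg
  have h4 := sq_nonneg β
  have h5 : β ^ 2 * (1 - q - 3 * siteFour β h q) ≤ β ^ 2 * 7 :=
    mul_le_mul_of_nonneg_left (by linarith) h4
  unfold systemDet
  linarith

theorem CavityParams.abs_limitVar_le {β h q : ℝ} (hp : CavityParams β h q) {t : Fin N → ℝ}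
    (ht : ∑ i, t i ^ 2 = 1) : |limitVar β h q t| ≤ 3 := by
  have h1 := hp.half_le_systemDet
  have h2 : siteThree β h q ^ 2 ≤ 4 := by
    have := sq_le_sq' (_root_.abs_le.1 (abs_siteThree_le β h q)).1 (_root_.abs_le.1 (abs_siteThree_le β h q)).2
    linarith
  have h3 : (∑ i, t i) ^ 2 / N ≤ 1 := by
    refine div_le_one_of_le₀ ?_ N.cast_nonneg
    have := sq_sum_le_card_mul_sum_sq (s := Finset.univ) (f := t)
    simpa [ht] using this
  have h4 : 4 * β ^ 2 * siteThree β h q ^ 2 * ((∑ i, t i) ^ 2 / N) / systemDet β h q ≤ 1 := by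
    refine div_le_one_of_le₀ ?_ (by linarith)
    calc 4 * β ^ 2 * siteThree β h q ^ 2 * ((∑ i, t i) ^ 2 / N)
        ≤ 4 * (1 / 10000) * 4 * 1 := by
          have := hp.sq_le
          gcongr
      _ ≤ _ := by linarith
  have h5 : 0 ≤ 4 * β ^ 2 * siteThree β h q ^ 2 * ((∑ i, t i) ^ 2 / N) / systemDet β h q :=
    div_nonneg (by positivity) (by linarith)
  have h6 := hp.nonneg
  have h7 := hp.le_one
  unfold limitVar
  rw [_root_.abs_le]
  constructor <;> linarith

theorem overlapDiff_eq_sum (β h q : ℝ) (t : Fin N → ℝ) (p m : R → κ) (p₀ m₀ c : κ) :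
    overlapDiff β h q t p m p₀ m₀ c = (∑ i, (skModel N β h).avg (fun τ : κ → Cfg N =>
      (spin (τ p₀ i) - spin (τ m₀ i)) * spin (τ c i) * pairProd t p m Finset.univ τ)) / N := by
  rw [div_eq_inv_mul, ← avg_sum, ← avg_const_mul, overlapDiff]
  congr 1
  funext τ
  rw [← Finset.sum_mul]
  simp only [sub_mul, Finset.sum_sub_distrib, centredOverlap, overlap]
  ring

variable (κ R) in
theorem exists_abs_site_system_le : ∃ K : ℝ, 0 ≤ K ∧ ∀ (N : ℕ) (β h q : ℝ) (t : Fin N → ℝ)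
    (i : Fin N), CavityParams β h q → ∑ i, t i ^ 2 = 1 → ∀ (p m : R → κ) (p₀ m₀ b : κ),
    PairConfig p m p₀ m₀ b → ∀ c ∈ ({p₀, m₀} : Finset κ)ᶜ,
    |(skModel N β h).avg (fun τ : κ → Cfg N => (spin (τ p₀ i) - spin (τ m₀ i)) *
        spin (τ c i) * pairProd t p m Finset.univ τ) -
      t i * (2 * siteThree β h q * contractionSum β h t p m p₀) -
      (β ^ 2 * (1 - q - siteFour β h q) * overlapDiff β h q t p m p₀ m₀ c +
        β ^ 2 * siteFour β h q * (∑ c ∈ ({p₀, m₀} : Finset κ)ᶜ, overlapDiff β h q t p m p₀ m₀ c -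
        Fintype.card κ * overlapDiff β h q t p m p₀ m₀ b))| ≤ K * (t i ^ 2 + 1 / N) := by
  obtain ⟨K, hK0, hK⟩ := exists_site_expansion κ R
  refine ⟨K, hK0, fun N β h q t i hp ht p m p₀ m₀ b hc c hcS => ?_⟩
  have hcp : c ≠ p₀ ∧ c ≠ m₀ := by simpa using hcS
  have h1 : ∀ y : Option (Option κ), y ≠ some (some p₀) → y ≠ some (some m₀) →
      y ≠ some (some c) →
      siteCoeff β h q (fun v => spin (v c)) p₀ m₀ y = siteFour β h q := fun y hyp hym hyc =>
    siteFour_eq β h q (by simpa using hc.ne) (by simpa using hcp.1.symm)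
      (by simpa using hcp.2.symm) hyp.symm hym.symm hyc.symm
  have h2 : siteCoeff β h q (fun v => spin (v c)) p₀ m₀ (some (some c)) = 1 - q := by
    rw [← hp.siteModel_avg_one_sub (x := (some (some p₀) : Option (Option κ)))
      (y := some (some m₀)) (by simpa using hc.ne)]
    unfold siteCoeff
    congr 1
    funext v
    rw [mul_assoc, spin_mul_self, mul_one]
  have h3 : ∑ c' ∈ ({p₀, m₀} : Finset κ)ᶜ,
      siteCoeff β h q (fun v => spin (v c)) p₀ m₀ (some (some c')) *
        overlapDiff β h q t p m p₀ m₀ c' =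
      (1 - q - siteFour β h q) * overlapDiff β h q t p m p₀ m₀ c +
        siteFour β h q * ∑ c ∈ ({p₀, m₀} : Finset κ)ᶜ, overlapDiff β h q t p m p₀ m₀ c := by
    rw [← Finset.add_sum_erase _ _ hcS, ← Finset.add_sum_erase _ _ hcS, h2, mul_add,
      Finset.mul_sum, ← add_assoc]
    congr 1
    · ring
    · refine Finset.sum_congr rfl fun c' hc' => ?_
      have hc'' : c' ≠ c ∧ c' ≠ p₀ ∧ c' ≠ m₀ := by simpa using hc'
      rw [h1 _ (by simpa using hc''.2.1) (by simpa using hc''.2.2) (by simpa using hc''.1)]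
  have h4 := hK N β h q t i hp ht p m p₀ m₀ b hc (fun v => spin (v c))
    (fun v => (abs_spin _).le)
    (fun v => by simp only [Equiv.swap_apply_of_ne_of_ne hcp.1 hcp.2])
    (by rw [h1 _ (by simp) (by simp) (by simp), h1 _ (by simp) (by simp) (by simp)])
  rw [h3, h1 none (by simp) (by simp) (by simp), siteThree_eq β h q hc.ne hcp.1.symm hcp.2.symm]
    at h4
  refine le_trans (le_of_eq ?_) h4
  congr 1
  ring

variable (κ R) in
theorem exists_abs_overlapDiff_sum_add_le : ∃ K : ℝ, 0 ≤ K ∧ ∀ (N : ℕ) (β h q : ℝ)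
    (t : Fin N → ℝ), CavityParams β h q → ∑ i, t i ^ 2 = 1 → ∀ (p m : R → κ) (p₀ m₀ b : κ),
    PairConfig p m p₀ m₀ b →
    |∑ c ∈ ({p₀, m₀} : Finset κ)ᶜ, overlapDiff β h q t p m p₀ m₀ c -
        Fintype.card κ * overlapDiff β h q t p m p₀ m₀ b +
      2 * (2 * siteThree β h q * contractionSum β h t p m p₀ * ((∑ i, t i) / N)) /
        systemDet β h q| ≤ K / N := by
  obtain ⟨K, hK0, hK⟩ := exists_abs_site_system_le κ R
  refine ⟨4 * Fintype.card κ * (2 * K), by positivity,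
    fun N β h q t hp ht p m p₀ m₀ b hc => ?_⟩
  have hN : (0 : ℝ) < N := by
    rcases Nat.eq_zero_or_pos N with rfl | hN
    · simp at ht
    · exact_mod_cast hN
  have hcard : (({p₀, m₀} : Finset κ)ᶜ).card + 2 = Fintype.card κ := by
    rw [← Finset.card_pair hc.ne, Finset.card_compl_add_card]
  refine (abs_add_div_le_of_linear_system hcard (b := b) (δ := 2 * K / N)
    (by simpa using ⟨hc.ne_left, hc.ne_right⟩) hp.half_le_systemDet fun c hcS => ?_).trans_eq
    (by ring)
  set G := contractionSum β h t p m p₀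
  set u := overlapDiff β h q t p m p₀ m₀ with hu
  set Z := β ^ 2 * (1 - q - siteFour β h q) * u c + β ^ 2 * siteFour β h q *
    (∑ c ∈ ({p₀, m₀} : Finset κ)ᶜ, u c - Fintype.card κ * u b) with hZ
  have h1 : u c - 2 * siteThree β h q * G * ((∑ i, t i) / N) - Z =
      (∑ i, ((skModel N β h).avg (fun τ : κ → Cfg N => (spin (τ p₀ i) - spin (τ m₀ i)) *
        spin (τ c i) * pairProd t p m Finset.univ τ) -
      t i * (2 * siteThree β h q * G) - Z)) / N := by
    rw [hu, overlapDiff_eq_sum]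
    simp only [Finset.sum_sub_distrib, ← Finset.sum_mul, Finset.sum_const, Finset.card_univ,
      Fintype.card_fin, nsmul_eq_mul]
    field_simp
  rw [h1, abs_div, Nat.abs_cast, div_le_div_iff_of_pos_right hN]
  refine (Finset.abs_sum_le_sum_abs _ _).trans ((Finset.sum_le_sum fun i _ =>
    hK N β h q t i hp ht p m p₀ m₀ b hc c hcS).trans_eq ?_)
  rw [← Finset.mul_sum, Finset.sum_add_distrib, ht, Finset.sum_const, Finset.card_univ,
    Fintype.card_fin, nsmul_eq_mul]
  field_simp
  norm_num

variable (κ R) in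
theorem exists_abs_avg_pairSum_mul_sub_le : ∃ K : ℝ, 0 ≤ K ∧ ∀ (N : ℕ) (β h q : ℝ)
    (t : Fin N → ℝ) (μ : ℝ), CavityParams β h q → ∑ i, t i ^ 2 = 1 → (∀ i, |t i| ≤ μ) →
    ∀ (p m : R → κ) (p₀ m₀ b : κ), PairConfig p m p₀ m₀ b →
    |(skModel N β h).avg (fun τ : κ → Cfg N =>
        pairSum t p₀ m₀ τ * pairProd t p m Finset.univ τ) -
      limitVar β h q t * contractionSum β h t p m p₀| ≤ K * μ := by
  obtain ⟨K₁, hK₁0, hK₁⟩ := exists_site_expansion κ R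
  obtain ⟨K₂, hK₂0, hK₂⟩ := exists_abs_overlapDiff_sum_add_le κ R
  refine ⟨2 * (K₁ + K₂), by positivity, fun N β h q t μ hp ht hμ p m p₀ m₀ b hc => ?_⟩
  have hN : (0 : ℝ) < N := by
    rcases Nat.eq_zero_or_pos N with rfl | hN
    · simp at ht
    · exact_mod_cast hN
  set G := contractionSum β h t p m p₀
  set u := overlapDiff β h q t p m p₀ m₀
  set B := siteThree β h q with hB
  set W := ∑ c ∈ ({p₀, m₀} : Finset κ)ᶜ, u c - Fintype.card κ * u b with hW
  set V := 2 * (2 * B * G * ((∑ i, t i) / N)) / systemDet β h q with hV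
  set E : Fin N → ℝ := fun i => (skModel N β h).avg (fun τ : κ → Cfg N =>
    (spin (τ p₀ i) - spin (τ m₀ i)) * pairProd t p m Finset.univ τ) with hE
  have hcoeff : ∀ y : Option (Option κ), y ≠ some (some p₀) → y ≠ some (some m₀) →
      siteCoeff β h q (fun _ : κ → Bool => 1) p₀ m₀ y = B := fun y hyp hym => by
    rw [hB, ← siteThree_eq β h q (x := (some (some p₀) : Option (Option κ)))
      (y := some (some m₀)) (z := y) (by simpa using hc.ne) hyp.symm hym.symm]
    simp only [siteCoeff, mul_one]
  have hWV : |W + V| ≤ K₂ / N := hK₂ N β h q t hp ht p m p₀ m₀ b hc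
  have hsite : ∀ i, |E i - t i * (2 * (1 - q) * G) - β ^ 2 * (B * W)| ≤
      K₁ * (t i ^ 2 + 1 / N) := by
    intro i
    have h1 := hK₁ N β h q t i hp ht p m p₀ m₀ b hc (fun _ => 1) (fun _ => by simp)
      (fun _ => rfl)
      (by rw [hcoeff _ (by simp) (by simp), hcoeff _ (by simp) (by simp)])
    simp only [mul_one, hcoeff none (by simp) (by simp), hp.siteModel_avg_one_sub hc.ne] at h1
    rw [Finset.sum_congr rfl fun c (hcS : c ∈ ({p₀, m₀} : Finset κ)ᶜ) =>
      (by rw [hcoeff _ (by simpa using (by simpa using hcS : c ≠ p₀ ∧ c ≠ m₀).1)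
        (by simpa using (by simpa using hcS : c ≠ p₀ ∧ c ≠ m₀).2)] :
        siteCoeff β h q (fun _ : κ → Bool => 1) p₀ m₀ (some (some c)) * u c = B * u c),
      ← Finset.mul_sum] at h1
    refine le_trans (le_of_eq ?_) h1
    congr 1
    rw [hW, hE]
    ring
  have hsite' : ∀ i, |E i - t i * (2 * (1 - q) * G) + β ^ 2 * B * V| ≤
      (K₁ + K₂) * (t i ^ 2 + 1 / N) := by
    intro i
    have h1 : |β ^ 2 * B * (W + V)| ≤ K₂ * (t i ^ 2 + 1 / N) := by
      rw [abs_mul, abs_mul, abs_of_nonneg (sq_nonneg β)]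
      calc β ^ 2 * |B| * |W + V| ≤ 1 / 10000 * 2 * (K₂ / N) := by
            have := hp.sq_le
            have := abs_siteThree_le β h q
            gcongr
        _ ≤ 1 * (K₂ / N) := by gcongr; norm_num
        _ = K₂ * (0 + 1 / N) := by ring
        _ ≤ _ := by gcongr; positivity
    calc |E i - t i * (2 * (1 - q) * G) + β ^ 2 * B * V|
        = |(E i - t i * (2 * (1 - q) * G) - β ^ 2 * (B * W)) + β ^ 2 * B * (W + V)| := by
          congr 1; ring
      _ ≤ _ := abs_add_le _ _
      _ ≤ K₁ * (t i ^ 2 + 1 / N) + K₂ * (t i ^ 2 + 1 / N) := add_le_add (hsite i) h1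
      _ = _ := by ring
  have hsum : (skModel N β h).avg (fun τ : κ → Cfg N =>
      pairSum t p₀ m₀ τ * pairProd t p m Finset.univ τ) = ∑ i, t i * E i := by
    simp only [hE, ← avg_const_mul, ← avg_sum]
    congr 1
    funext τ
    rw [pairSum, Finset.sum_mul]
    exact Finset.sum_congr rfl fun i _ => mul_assoc _ _ _
  have hmain : ∑ i, t i * E i - limitVar β h q t * G =
      ∑ i, t i * (E i - t i * (2 * (1 - q) * G) + β ^ 2 * B * V) := by
    have h1 : ∀ i, t i * (E i - t i * (2 * (1 - q) * G) + β ^ 2 * B * V) =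
        t i * E i - t i ^ 2 * (2 * (1 - q) * G) + t i * (β ^ 2 * B * V) := fun i => by ring
    simp only [h1, Finset.sum_add_distrib, Finset.sum_sub_distrib, ← Finset.sum_mul, ht]
    rw [limitVar, hV]
    ring
  rw [hsum, hmain]
  have hμ0 : ∀ i, 0 ≤ μ := fun i => (abs_nonneg _).trans (hμ i)
  calc |∑ i, t i * (E i - t i * (2 * (1 - q) * G) + β ^ 2 * B * V)|
      ≤ ∑ i, |t i * (E i - t i * (2 * (1 - q) * G) + β ^ 2 * B * V)| :=
        Finset.abs_sum_le_sum_abs _ _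
    _ ≤ ∑ i, μ * ((K₁ + K₂) * (t i ^ 2 + 1 / N)) := Finset.sum_le_sum fun i _ => by
        rw [abs_mul]
        exact mul_le_mul (hμ i) (hsite' i) (abs_nonneg _) (hμ0 i)
    _ = _ := by
        rw [← Finset.mul_sum, ← Finset.mul_sum, Finset.sum_add_distrib, ht, Finset.sum_const,
          Finset.card_univ, Fintype.card_fin, nsmul_eq_mul]
        field_simp
        norm_num

end PairSumMoments

section MomentRecursion

open LinModel

variable {N : ℕ} {L : Type} [Fintype L] [DecidableEq L]

/-- The joint moment of the sums attached to disjoint pairs of replicas. -/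
def pairMoment (β h : ℝ) (t : Fin N → ℝ) (k : L → ℕ) : ℝ :=
  (skModel N β h).avg fun τ : L × Fin 2 → Cfg N => ∏ l, pairSum t (l, 0) (l, 1) τ ^ k l

theorem avg_pairProd_eq_pairMoment {R : Type} [Fintype R] (β h : ℝ) (t : Fin N → ℝ) (f : R → L)
    (s : Finset R) :
    (skModel N β h).avg (fun τ : Option (L × Fin 2) → Cfg N =>
      pairProd t (fun r => some (f r, 0)) (fun r => some (f r, 1)) s τ) =
      pairMoment β h t fun l => #{r ∈ s | f r = l} := by
  refine Eq.trans (congrArg _ (funext fun τ => ?_)) (avg_comp (skModel N β h) some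
    (Option.some_injective _) fun τ : L × Fin 2 → Cfg N =>
      ∏ l, pairSum t (l, 0) (l, 1) τ ^ #{r ∈ s | f r = l})
  simp only [pairProd, ← Finset.prod_const]
  exact (Finset.prod_fiberwise' s f fun l => pairSum t (some (l, 0)) (some (l, 1)) τ).symm

theorem exists_abs_pairMoment_update_sub_le (k : L → ℕ) (l₀ : L) : ∃ K : ℝ, 0 ≤ K ∧
    ∀ (N : ℕ) (β h q : ℝ) (t : Fin N → ℝ) (μ : ℝ), CavityParams β h q → ∑ i, t i ^ 2 = 1 →
    (∀ i, |t i| ≤ μ) →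
    |pairMoment β h t (Function.update k l₀ (k l₀ + 1)) - limitVar β h q t *
      (k l₀ * pairMoment β h t (Function.update k l₀ (k l₀ - 1)))| ≤ K * μ := by
  obtain ⟨K, hK0, hK⟩ := exists_abs_avg_pairSum_mul_sub_le (Option (L × Fin 2)) (Σ l, Fin (k l))
  refine ⟨K, hK0, fun N β h q t μ hp ht hμ => ?_⟩
  have hcard : ∀ l, #{r : Σ l, Fin (k l) | r.1 = l} = k l := by
    intro l
    rw [← Fintype.card_subtype, Fintype.card_congr (Equiv.sigmaSubtype l), Fintype.card_fin]
  have hc : PairConfig (fun r : Σ l, Fin (k l) => some (r.1, (0 : Fin 2)))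
      (fun r => some (r.1, (1 : Fin 2))) (some (l₀, 0)) (some (l₀, 1)) none := by
    refine ⟨by simp, by simp, by simp, by simp, by simp, by simp, fun r => ?_⟩
    by_cases hr : r.1 = l₀ <;> simp [hr]
  have h1 : (skModel N β h).avg (fun τ : Option (L × Fin 2) → Cfg N =>
      pairSum t (some (l₀, 0)) (some (l₀, 1)) τ *
        pairProd t (fun r : Σ l, Fin (k l) => some (r.1, (0 : Fin 2)))
          (fun r => some (r.1, (1 : Fin 2))) Finset.univ τ) =
      pairMoment β h t (Function.update k l₀ (k l₀ + 1)) := by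
    have h2 := avg_pairProd_eq_pairMoment β h t
      (fun r : Option (Σ l, Fin (k l)) => r.elim l₀ Sigma.fst) Finset.univ
    have h3 : (fun l => #{r : Option (Σ l, Fin (k l)) | r.elim l₀ Sigma.fst = l}) =
        Function.update k l₀ (k l₀ + 1) := by
      funext l
      have h4 : ∑ r : Σ l, Fin (k l), (if r.1 = l then 1 else 0) = k l := by
        rw [← Finset.card_filter, hcard]
      rw [Finset.card_filter, Fintype.sum_option]
      change (if l₀ = l then 1 else 0) +
        ∑ r : Σ l, Fin (k l), (if r.1 = l then 1 else 0) = _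
      rw [h4]
      rcases eq_or_ne l l₀ with rfl | hl
      · simp [add_comm]
      · simp [hl, hl.symm]
    rw [← h3, ← h2]
    congr 1
    funext τ
    rw [pairProd, pairProd, Fintype.prod_option]
    rfl
  have h2 : contractionSum β h t (fun r : Σ l, Fin (k l) => some (r.1, (0 : Fin 2)))
      (fun r => some (r.1, (1 : Fin 2))) (some (l₀, 0)) =
      k l₀ * pairMoment β h t (Function.update k l₀ (k l₀ - 1)) := by
    have h3 : ∀ r : Σ l, Fin (k l), r.1 = l₀ →
        (skModel N β h).avg (fun τ : Option (L × Fin 2) → Cfg N =>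
          pairProd t (fun r : Σ l, Fin (k l) => some (r.1, (0 : Fin 2)))
            (fun r => some (r.1, (1 : Fin 2))) (Finset.univ.erase r) τ) =
        pairMoment β h t (Function.update k l₀ (k l₀ - 1)) := by
      intro r hr
      rw [avg_pairProd_eq_pairMoment β h t Sigma.fst]
      congr 1
      funext l
      rw [Finset.filter_erase]
      rcases eq_or_ne l l₀ with rfl | hl
      · rw [Finset.card_erase_of_mem (by simpa using hr), hcard, Function.update_self]
      · rw [Finset.erase_eq_of_notMem (by simpa [hr] using hl.symm), hcard,
          Function.update_of_ne hl]
    rw [contractionSum, Finset.sum_congr rfl fun r hr => h3 r (by simpa using hr),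
      Finset.sum_const, nsmul_eq_mul, ← hcard l₀]
    simp
  rw [← h1, ← h2]
  exact hK N β h q t μ hp ht hμ _ _ _ _ _ hc

theorem exists_abs_pairMoment_two_mul_sub_le (r : L → ℕ) : ∃ K : ℝ, 0 ≤ K ∧
    ∀ (N : ℕ) (β h q : ℝ) (t : Fin N → ℝ) (μ : ℝ), CavityParams β h q → ∑ i, t i ^ 2 = 1 →
    (∀ i, |t i| ≤ μ) →
    |pairMoment β h t (fun l => 2 * r l) -
      limitVar β h q t ^ (∑ l, r l) * ∏ l, gaussMoment (2 * r l)| ≤ K * μ := by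
  induction hn : ∑ l, r l generalizing r with
  | zero =>
    have hr : ∀ l, r l = 0 := by simpa using hn
    refine ⟨0, le_rfl, fun N β h q t μ _ _ _ => ?_⟩
    simp [pairMoment, hr, gaussMoment_zero, avg_const]
  | succ n ih =>
    obtain ⟨l₀, -, hl₀⟩ : ∃ l ∈ Finset.univ, r l ≠ 0 := by
      refine Finset.exists_ne_zero_of_sum_ne_zero (f := r) ?_
      omega
    obtain ⟨s, hs⟩ := Nat.exists_eq_succ_of_ne_zero hl₀
    set r' := Function.update r l₀ s with hr'
    have hsum : ∑ l, r' l = n := by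
      rw [hr', Finset.sum_update_of_mem (Finset.mem_univ l₀)]
      rw [← Finset.add_sum_erase _ _ (Finset.mem_univ l₀), ← Finset.sdiff_singleton_eq_erase] at hn
      omega
    have hprod : ∏ l, gaussMoment (2 * r l) = (2 * s + 1) * ∏ l, gaussMoment (2 * r' l) := by
      rw [← Finset.mul_prod_erase _ _ (Finset.mem_univ l₀),
        ← Finset.mul_prod_erase _ (fun l => gaussMoment (2 * r' l)) (Finset.mem_univ l₀), hs,
        show 2 * s.succ = 2 * s + 2 by omega, gaussMoment_add_two, hr', Function.update_self,
        mul_assoc]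
      push_cast
      congr 2
      refine Finset.prod_congr rfl fun l hl => ?_
      rw [Function.update_of_ne (Finset.ne_of_mem_erase hl)]
    obtain ⟨K₁, hK₁0, hK₁⟩ := exists_abs_pairMoment_update_sub_le
      (Function.update (fun l => 2 * r l) l₀ (2 * s + 1)) l₀
    obtain ⟨K₂, hK₂0, hK₂⟩ := ih r' hsum
    refine ⟨K₁ + 3 * (2 * s + 1) * K₂, by positivity, fun N β h q t μ hp ht hμ => ?_⟩
    have h1 := hK₁ N β h q t μ hp ht hμ
    have h2 := hK₂ N β h q t μ hp ht hμ
    simp only [Function.update_self, Function.update_idem, Nat.add_sub_cancel] at h1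
    have h3 : Function.update (fun l => 2 * r l) l₀ (2 * s + 1 + 1) = fun l => 2 * r l := by
      rw [Function.update_eq_self_iff]
      omega
    have h4 : Function.update (fun l => 2 * r l) l₀ (2 * s) = fun l => 2 * r' l := by
      funext l
      rcases eq_or_ne l l₀ with rfl | hl
      · simp [hr']
      · simp [hr', hl]
    rw [h3, h4] at h1
    push_cast at h1
    set C := limitVar β h q t
    have hC : |C| ≤ 3 := hp.abs_limitVar_le ht
    calc |pairMoment β h t (fun l => 2 * r l) - C ^ (n + 1) * ∏ l, gaussMoment (2 * r l)|
        = |(pairMoment β h t (fun l => 2 * r l) -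
            C * ((2 * s + 1) * pairMoment β h t (fun l => 2 * r' l))) + C * (2 * s + 1) *
            (pairMoment β h t (fun l => 2 * r' l) - C ^ n * ∏ l, gaussMoment (2 * r' l))| := by
          rw [hprod]
          congr 1
          ring
      _ ≤ K₁ * μ + 3 * (2 * s + 1) * (K₂ * μ) := by
          refine (abs_add_le _ _).trans (add_le_add h1 ?_)
          rw [abs_mul, abs_mul, abs_of_nonneg (by positivity : (0 : ℝ) ≤ 2 * s + 1)]
          gcongr
      _ = _ := by ring

end MomentRecursion

section Factorization

variable {A L : Type} [Fintype A] [Fintype L] [DecidableEq L]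

theorem gibbsAvg_prod_pairs (H : A → ℝ) (F : L → A → A → ℝ) :
    gibbsAvg H (fun τ : L × Fin 2 → A => ∏ l, F l (τ (l, 0)) (τ (l, 1))) =
      ∏ l, gibbsAvg H fun τ : Fin 2 → A => F l (τ 0) (τ 1) := by
  unfold gibbsAvg
  rw [Finset.prod_univ_sum, Fintype.piFinset_univ]
  refine Fintype.sum_equiv (Equiv.curry L (Fin 2) A) _ _ fun τ => ?_
  rw [Fintype.prod_prod_type, ← Finset.prod_mul_distrib]
  rfl

variable {N : ℕ}

/-- The Gibbs moments of the sum attached to one pair of replicas. -/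
def pairGibbsMoment (β h : ℝ) (t : Fin N → ℝ) (g : Fin N → Fin N → ℝ) (j : ℕ) : ℝ :=
  gibbsAvg ((skModel N β h).ham g) fun τ : Fin 2 → Cfg N => pairSum t 0 1 τ ^ j

theorem gibbsAvg_prod_pairSum_pow (β h : ℝ) (t : Fin N → ℝ) (g : Fin N → Fin N → ℝ)
    (k : L → ℕ) :
    gibbsAvg ((skModel N β h).ham g) (fun τ : L × Fin 2 → Cfg N =>
      ∏ l, pairSum t (l, 0) (l, 1) τ ^ k l) = ∏ l, pairGibbsMoment β h t g (k l) :=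
  gibbsAvg_prod_pairs ((skModel N β h).ham g) fun l (σ σ' : Cfg N) =>
    (∑ i, t i * (spin (σ i) - spin (σ' i))) ^ k l

theorem integral_prod_pairGibbsMoment (β h : ℝ) (t : Fin N → ℝ) (k : L → ℕ) :
    ∫ g, ∏ l, pairGibbsMoment β h t g (k l) ∂gaussN N = pairMoment β h t k := by
  simp only [← gibbsAvg_prod_pairSum_pow]
  rfl

theorem integrable_prod_pairGibbsMoment (β h : ℝ) (t : Fin N → ℝ) (k : L → ℕ) :
    Integrable (fun g => ∏ l, pairGibbsMoment β h t g (k l)) (gaussN N) := by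
  simp only [← gibbsAvg_prod_pairSum_pow]
  exact integrable_gibbsAvg_ham _ _

theorem pairGibbsMoment_odd (β h : ℝ) (t : Fin N → ℝ) (g : Fin N → Fin N → ℝ) {j : ℕ}
    (hj : Odd j) : pairGibbsMoment β h t g j = 0 := by
  have h1 := gibbsAvg_comp ((skModel N β h).ham g) (Equiv.swap (0 : Fin 2) 1)
    (Equiv.swap (0 : Fin 2) 1).injective fun τ : Fin 2 → Cfg N => pairSum t 0 1 τ ^ j
  have h2 : ∀ τ : Fin 2 → Cfg N,
      pairSum t 0 1 (fun l => τ (Equiv.swap 0 1 l)) ^ j = (-1) * pairSum t 0 1 τ ^ j := by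
    intro τ
    rw [neg_one_mul, ← hj.neg_pow]
    congr 1
    rw [pairSum, pairSum, ← Finset.sum_neg_distrib]
    refine Finset.sum_congr rfl fun i _ => ?_
    rw [Equiv.swap_apply_left, Equiv.swap_apply_right]
    ring
  simp only [h2, gibbsAvg_const_mul] at h1
  unfold pairGibbsMoment
  linarith

theorem exists_abs_integral_prod_mul_prod_sub_le {L' : Type} [Fintype L'] [DecidableEq L']
    (r : L → ℕ) (r' : L' → ℕ) : ∃ K : ℝ, 0 ≤ K ∧
    ∀ (N : ℕ) (β h q : ℝ) (t : Fin N → ℝ) (μ : ℝ), CavityParams β h q → ∑ i, t i ^ 2 = 1 →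
    (∀ i, |t i| ≤ μ) →
    Integrable (fun g => (∏ l, pairGibbsMoment β h t g (2 * r l)) *
      ∏ l, pairGibbsMoment β h t g (2 * r' l)) (gaussN N) ∧
    |∫ g, (∏ l, pairGibbsMoment β h t g (2 * r l)) *
        (∏ l, pairGibbsMoment β h t g (2 * r' l)) ∂gaussN N -
      limitVar β h q t ^ (∑ l, r l + ∑ l, r' l) *
        ((∏ l, gaussMoment (2 * r l)) * ∏ l, gaussMoment (2 * r' l))| ≤ K * μ := by
  obtain ⟨K, hK0, hK⟩ := exists_abs_pairMoment_two_mul_sub_le (Sum.elim r r')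
  refine ⟨K, hK0, fun N β h q t μ hp ht hμ => ?_⟩
  have h1 : (fun g => (∏ l, pairGibbsMoment β h t g (2 * r l)) *
      ∏ l, pairGibbsMoment β h t g (2 * r' l)) =
      fun g => ∏ l, pairGibbsMoment β h t g (2 * Sum.elim r r' l) := by
    funext g
    rw [Fintype.prod_sum_type]
    rfl
  have h2 := hK N β h q t μ hp ht hμ
  rw [h1, integral_prod_pairGibbsMoment β h t fun l => 2 * Sum.elim r r' l]
  rw [Fintype.sum_sum_type, Fintype.prod_sum_type] at h2
  exact ⟨integrable_prod_pairGibbsMoment β h t fun l => 2 * Sum.elim r r' l, h2⟩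

end Factorization

section SecondMoment

variable {N : ℕ}

theorem gibbs_prod_Sbar_pow (β h : ℝ) (t : Fin N → ℝ) (g : Fin N → Fin N → ℝ) {n : ℕ}
    (k : Fin n → ℕ) :
    gibbs N β h g (fun σs : Fin n × Fin 2 → Cfg N => ∏ l, Sbar N n t σs l ^ k l) =
      ∏ l, pairGibbsMoment β h t g (k l) := by
  rw [gibbs_eq_gibbsAvg, negH_eq_skModel, ← gibbsAvg_prod_pairSum_pow]
  rfl

theorem gibbs_Sbar_sq (β h : ℝ) (t : Fin N → ℝ) (g : Fin N → Fin N → ℝ) :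
    gibbs N β h g (fun σs : Fin 1 × Fin 2 → Cfg N => Sbar N 1 t σs 0 ^ 2) =
      pairGibbsMoment β h t g 2 := by
  simpa using gibbs_prod_Sbar_pow β h t g fun _ : Fin 1 => 2

theorem exists_integral_sq_sub_le {n : ℕ} (r : Fin n → ℕ) : ∃ K : ℝ,
    ∀ (N : ℕ) (β h q : ℝ) (t : Fin N → ℝ) (μ : ℝ), CavityParams β h q → ∑ i, t i ^ 2 = 1 →
    (∀ i, |t i| ≤ μ) →
    ∫ g, (∏ l, pairGibbsMoment β h t g (2 * r l) - (∏ l, gaussMoment (2 * r l)) *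
      pairGibbsMoment β h t g 2 ^ (∑ l, r l)) ^ 2 ∂gaussN N ≤ K * μ := by
  set ρ := ∑ l, r l with hρ
  set a := ∏ l, gaussMoment (2 * r l) with ha
  obtain ⟨K₁, -, hK₁⟩ := exists_abs_integral_prod_mul_prod_sub_le r r
  obtain ⟨K₂, -, hK₂⟩ := exists_abs_integral_prod_mul_prod_sub_le r fun _ : Fin ρ => 1
  obtain ⟨K₃, -, hK₃⟩ := exists_abs_integral_prod_mul_prod_sub_le (fun _ : Fin ρ => 1)
    fun _ : Fin ρ => 1
  refine ⟨K₁ + 2 * |a| * K₂ + a ^ 2 * K₃, fun N β h q t μ hp ht hμ => ?_⟩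
  obtain ⟨hI₁, h₁⟩ := hK₁ N β h q t μ hp ht hμ
  obtain ⟨hI₂, h₂⟩ := hK₂ N β h q t μ hp ht hμ
  obtain ⟨hI₃, h₃⟩ := hK₃ N β h q t μ hp ht hμ
  simp only [mul_one, Finset.prod_const, Finset.sum_const, Finset.card_univ, Fintype.card_fin,
    smul_eq_mul, gaussMoment_two, one_pow, ← hρ, ← ha] at h₁ h₂ h₃ hI₁ hI₂ hI₃
  set C := limitVar β h q t ^ (ρ + ρ)
  have hsq : ∀ g, (∏ l, pairGibbsMoment β h t g (2 * r l) -
      a * pairGibbsMoment β h t g 2 ^ ρ) ^ 2 =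
      (∏ l, pairGibbsMoment β h t g (2 * r l)) * (∏ l, pairGibbsMoment β h t g (2 * r l)) -
      2 * a * ((∏ l, pairGibbsMoment β h t g (2 * r l)) * pairGibbsMoment β h t g 2 ^ ρ) +
      a ^ 2 * (pairGibbsMoment β h t g 2 ^ ρ * pairGibbsMoment β h t g 2 ^ ρ) := fun g => by ring
  simp only [hsq]
  have hI₄ : Integrable (fun g => (∏ l, pairGibbsMoment β h t g (2 * r l)) *
      (∏ l, pairGibbsMoment β h t g (2 * r l)) - 2 * a * ((∏ l, pairGibbsMoment β h t g (2 * r l)) *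
      pairGibbsMoment β h t g 2 ^ ρ)) (gaussN N) := hI₁.sub (hI₂.const_mul _)
  rw [integral_add hI₄ (hI₃.const_mul _),
    integral_sub hI₁ (hI₂.const_mul _), integral_const_mul, integral_const_mul]
  set I₁ := ∫ g, (∏ l, pairGibbsMoment β h t g (2 * r l)) *
    (∏ l, pairGibbsMoment β h t g (2 * r l)) ∂gaussN N
  set I₂ := ∫ g, (∏ l, pairGibbsMoment β h t g (2 * r l)) *
    pairGibbsMoment β h t g 2 ^ ρ ∂gaussN N
  set I₃ := ∫ g, pairGibbsMoment β h t g 2 ^ ρ * pairGibbsMoment β h t g 2 ^ ρ ∂gaussN N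
  calc I₁ - 2 * a * I₂ + a ^ 2 * I₃
      = (I₁ - C * (a * a)) + (-(2 * a)) * (I₂ - C * a) + a ^ 2 * (I₃ - C) := by ring
    _ ≤ |I₁ - C * (a * a)| + 2 * |a| * |I₂ - C * a| + a ^ 2 * |I₃ - C| := by
        refine add_le_add (add_le_add (le_abs_self _) ?_)
          (mul_le_mul_of_nonneg_left (le_abs_self _) (sq_nonneg a))
        refine (le_abs_self _).trans_eq ?_
        rw [abs_mul, abs_neg, abs_mul, abs_two]
    _ ≤ K₁ * μ + 2 * |a| * (K₂ * μ) + a ^ 2 * (K₃ * μ) := by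
        gcongr
    _ = _ := by ring

end SecondMoment

/-- the second-moment version of the CLT,
`E[(⟨∏_l S_l^{k_l}⟩ − (∏_l a(k_l))·⟨S₁²⟩^{k/2})²] ≤ K·max_i|t_i|`. -/
theorem stmt1 :
    ∃ β₀ : ℝ, 0 < β₀ ∧
      ∀ n : ℕ, 1 ≤ n → ∀ kvec : Fin n → ℕ,
        ∃ K : ℝ, ∀ β : ℝ, 0 < β → β < β₀ → ∀ M : ℕ, ∀ h : ℝ, 0 ≤ h →
          ∀ t : Fin (M + 1) → ℝ, (∑ i, t i ^ 2) = 1 →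
            (∫ g, (gibbs (M + 1) β h g
                  (fun σs : Fin n × Fin 2 → Cfg (M + 1) =>
                    ∏ l, Sbar (M + 1) n t σs l ^ kvec l) -
                (∏ l, gaussMoment (kvec l)) *
                  (gibbs (M + 1) β h g
                      (fun σs : Fin 1 × Fin 2 → Cfg (M + 1) =>
                        Sbar (M + 1) 1 t σs 0 ^ 2)) ^ (((∑ l, kvec l : ℕ) : ℝ) / 2)) ^ 2
                ∂ gaussN (M + 1)) ≤ K * ⨆ i, |t i| := by
  refine ⟨1 / 100, by norm_num, fun n _ k => ?_⟩
  by_cases hk : ∀ l, Even (k l)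
  · choose r hr using fun l => (hk l).exists_two_nsmul
    simp only [smul_eq_mul] at hr
    obtain rfl : k = fun l => 2 * r l := funext hr
    obtain ⟨K, hK⟩ := exists_integral_sq_sub_le r
    refine ⟨K, fun β hβ0 hβ M h _ t ht => ?_⟩
    obtain ⟨q, hq0, hq1, hq⟩ := exists_overlap_fixedPoint β h
    have hp : CavityParams β h q := ⟨by rw [abs_of_pos hβ0]; exact hβ.le, hq0, hq1, hq⟩
    have hexp : ((∑ l, 2 * r l : ℕ) : ℝ) / 2 = (∑ l, r l : ℕ) := by
      rw [← Finset.mul_sum]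
      push_cast
      ring
    simp only [hexp, Real.rpow_natCast, gibbs_Sbar_sq]
    simp only [gibbs_prod_Sbar_pow β h t _ fun l => 2 * r l]
    exact hK (M + 1) β h q t _ hp ht fun i => le_ciSup (f := fun i => |t i|)
      (Set.finite_range _).bddAbove i
  · push Not at hk
    obtain ⟨l₀, hl₀⟩ := hk
    rw [Nat.not_even_iff_odd] at hl₀
    refine ⟨0, fun β _ _ M h _ t _ => ?_⟩
    have h1 : ∏ l, gaussMoment (k l) = 0 := by
      obtain ⟨j, hj⟩ := hl₀
      exact Finset.prod_eq_zero (Finset.mem_univ l₀) (by rw [hj, gaussMoment_odd])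
    have h2 : ∀ g, ∏ l, pairGibbsMoment β h t g (k l) = 0 := fun g =>
      Finset.prod_eq_zero (Finset.mem_univ l₀) (pairGibbsMoment_odd β h t g hl₀)
    simp [gibbs_prod_Sbar_pow, h1, h2]

end
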